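/- For the reflection arrangement A of the complex reflection group G₂₇ (45 hyperplanes in ℂ³), every hyperplane H ∈ A satisfies |A^H| = 16, and the multiset of rank-2 point multiplicities is {{3^120, 4^45, 5^36}}. -/

import Mathlib

open Module Matrix
open scoped Classical

namespace Arrgt

variable {K : Type*} [Field K]

/-- A (central) hyperplane arrangement in `K^n`: a finite set of kernels of
nonzero linear forms. -/
structure Arrangement (K : Type*) [Field K] (n : ℕ) where
  hyperplanes : Finset (Submodule K (Fin n → K))
  isHyp : ∀ H ∈ hyperplanes, ∃ f : (Fin n → K) →ₗ[K] K, f ≠ 0 ∧ H = LinearMap.ker f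

/-- The deletion `A \ {H}`. -/
noncomputable def Arrangement.delete {n : ℕ} (A : Arrangement K n) (H : Submodule K (Fin n → K)) :
    Arrangement K n :=
  ⟨A.hyperplanes.erase H, fun H' hH' => A.isHyp H' (Finset.mem_of_mem_erase hH')⟩

/-- The empty arrangement of rank `n`. -/
def emptyArr (K : Type*) [Field K] (n : ℕ) : Arrangement K n := ⟨∅, by simp⟩

/-- The linear polynomial in `K[x_1,...,x_n]` attached to a linear form. -/
noncomputable def linPoly {n : ℕ} (f : (Fin n → K) →ₗ[K] K) : MvPolynomial (Fin n) K :=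
  ∑ i, MvPolynomial.C (f (Pi.single i 1)) * MvPolynomial.X i

/-- `Q` is a defining polynomial of the arrangement `A`: a product of linear forms
whose kernels are exactly the hyperplanes of `A`. -/
def IsDefiningPoly {n : ℕ} (A : Arrangement K n) (Q : MvPolynomial (Fin n) K) : Prop :=
  ∃ α : Submodule K (Fin n → K) → ((Fin n → K) →ₗ[K] K),
    (∀ H ∈ A.hyperplanes, α H ≠ 0 ∧ LinearMap.ker (α H) = H) ∧
    Q = ∏ H ∈ A.hyperplanes, linPoly (α H)

/-- Evaluation of a derivation at the polynomial `Q`, as a linear map. -/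
noncomputable def evalDer {n : ℕ} (Q : MvPolynomial (Fin n) K) :
    Derivation K (MvPolynomial (Fin n) K) (MvPolynomial (Fin n) K) →ₗ[MvPolynomial (Fin n) K]
      MvPolynomial (Fin n) K where
  toFun θ := θ Q
  map_add' _ _ := rfl
  map_smul' _ _ := rfl

/-- The module `D(A) = {θ : θ(Q) ∈ Q·S}` of `A`-derivations (for a chosen defining
polynomial `Q`). -/
noncomputable def DerModule {n : ℕ} (Q : MvPolynomial (Fin n) K) :
    Submodule (MvPolynomial (Fin n) K)
      (Derivation K (MvPolynomial (Fin n) K) (MvPolynomial (Fin n) K)) :=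
  Submodule.comap (evalDer Q) (Ideal.span {Q})

/-- `A` is a free arrangement: `D(A)` is a free module over `S = K[x_1,...,x_n]`. -/
def IsFree {n : ℕ} (A : Arrangement K n) : Prop :=
  ∃ Q, IsDefiningPoly A Q ∧ Module.Free (MvPolynomial (Fin n) K) (DerModule Q)

/-- A nonzero derivation is homogeneous of polynomial degree `p` if all its
coefficients are homogeneous of degree `p`. -/
def IsHomogeneousDer {n : ℕ}
    (θ : Derivation K (MvPolynomial (Fin n) K) (MvPolynomial (Fin n) K)) (p : ℕ) : Prop :=
  θ ≠ 0 ∧ ∀ i, (θ (MvPolynomial.X i)).IsHomogeneous p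

/-- `A` is free with exponents the multiset `e`: `D(A)` has a homogeneous basis whose
polynomial degrees form the multiset `e`. -/
def HasExponents {n : ℕ} (A : Arrangement K n) (e : Multiset ℕ) : Prop :=
  ∃ Q, IsDefiningPoly A Q ∧
    ∃ (l : List ℕ) (b : Basis (Fin l.length) (MvPolynomial (Fin n) K) (DerModule Q)),
      (l : Multiset ℕ) = e ∧ ∀ i : Fin l.length, IsHomogeneousDer ((b i : DerModule Q) :
        Derivation K (MvPolynomial (Fin n) K) (MvPolynomial (Fin n) K)) (l.get i)

/-- `B` is (a model, via a linear identification `H ≅ K^n`, of) the restriction `A^H`. -/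
def IsRestriction {n : ℕ} (A : Arrangement K (n + 1)) (H : Submodule K (Fin (n + 1) → K))
    (B : Arrangement K n) : Prop :=
  ∃ e : H ≃ₗ[K] (Fin n → K),
    B.hyperplanes = (A.hyperplanes.erase H).image
      (fun H' => Submodule.map (e : H →ₗ[K] (Fin n → K)) (H'.comap H.subtype))

variable (K) in
/-- The class of inductively free arrangements. -/
inductive InductivelyFree : {n : ℕ} → Arrangement K n → Prop
  | empty (n : ℕ) : InductivelyFree (emptyArr K n)
  | add {n : ℕ} (A : Arrangement K (n + 1)) (H : Submodule K (Fin (n + 1) → K))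
      (hH : H ∈ A.hyperplanes) (B : Arrangement K n) (hB : IsRestriction A H B)
      (e' e'' : Multiset ℕ)
      (h1 : InductivelyFree (A.delete H)) (h2 : InductivelyFree B)
      (h3 : HasExponents (A.delete H) e') (h4 : HasExponents B e'')
      (h5 : e'' ≤ e') : InductivelyFree A

variable (K) in
/-- The class of recursively free arrangements. -/
inductive RecursivelyFree : {n : ℕ} → Arrangement K n → Prop
  | empty (n : ℕ) : RecursivelyFree (emptyArr K n)
  | add {n : ℕ} (A : Arrangement K (n + 1)) (H : Submodule K (Fin (n + 1) → K))
      (hH : H ∈ A.hyperplanes) (B : Arrangement K n) (hB : IsRestriction A H B)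
      (e' e'' : Multiset ℕ)
      (h1 : RecursivelyFree (A.delete H)) (h2 : RecursivelyFree B)
      (h3 : HasExponents (A.delete H) e') (h4 : HasExponents B e'')
      (h5 : e'' ≤ e') : RecursivelyFree A
  | del {n : ℕ} (A : Arrangement K (n + 1)) (H : Submodule K (Fin (n + 1) → K))
      (hH : H ∈ A.hyperplanes) (B : Arrangement K n) (hB : IsRestriction A H B)
      (e e'' : Multiset ℕ)
      (h1 : RecursivelyFree A) (h2 : RecursivelyFree B)
      (h3 : HasExponents A e) (h4 : HasExponents B e'')
      (h5 : e'' ≤ e) : RecursivelyFree (A.delete H)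

/-- The intersection lattice of a set of hyperplanes: all intersections of finite
subsets (including the ambient space `⊤` as the empty intersection). -/
def setLattice {n : ℕ} (𝓐 : Set (Submodule K (Fin n → K))) : Set (Submodule K (Fin n → K)) :=
  {X | ∃ s : Finset (Submodule K (Fin n → K)), ↑s ⊆ 𝓐 ∧ X = s.inf id}

/-- The intersection lattice of an arrangement. -/
def Arrangement.lattice {n : ℕ} (A : Arrangement K n) : Set (Submodule K (Fin n → K)) :=
  setLattice (↑A.hyperplanes)

/-- The linear form `x ↦ ∑ v i * x i` attached to a normal vector `v`. -/
noncomputable def lf {n : ℕ} (v : Fin n → K) : (Fin n → K) →ₗ[K] K :=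
  ∑ i, v i • LinearMap.proj i

lemma lf_single {n : ℕ} (v : Fin n → K) (j : Fin n) : lf v (Pi.single j 1) = v j := by
  simp [lf, Pi.single_apply, mul_ite, Finset.sum_ite_eq']

lemma lf_ne_zero {n : ℕ} {v : Fin n → K} (hv : v ≠ 0) : lf v ≠ 0 := by
  intro h
  apply hv
  funext j
  have := congrArg (fun f : (Fin n → K) →ₗ[K] K => f (Pi.single j 1)) h
  simpa [lf_single] using this

/-- The hyperplane `v^⊥` with normal vector `v`. -/
noncomputable def perp {n : ℕ} (v : Fin n → K) : Submodule K (Fin n → K) :=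
  LinearMap.ker (lf v)

/-- Build an arrangement from a finite set of nonzero normal vectors. -/
noncomputable def mkArr {n : ℕ} (vs : Finset (Fin n → K)) (h : (0 : Fin n → K) ∉ vs) :
    Arrangement K n :=
  ⟨vs.image perp, by
    intro H hH
    obtain ⟨v, hv, rfl⟩ := Finset.mem_image.mp hH
    exact ⟨lf v, lf_ne_zero (fun h0 => h (h0 ▸ hv)), rfl⟩⟩

end Arrgt

open Arrgt

/-- The fixed subspace of an invertible matrix acting on `ℂ³`. -/
noncomputable def fixedSp (g : GL (Fin 3) ℂ) : Submodule ℂ (Fin 3 → ℂ) :=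
  LinearMap.ker (Matrix.toLin' ((g : Matrix (Fin 3) (Fin 3) ℂ) - 1))

/-- A (complex, possibly non-involutive) reflection: a nonidentity element whose fixed
space is a hyperplane. -/
def IsReflection (g : GL (Fin 3) ℂ) : Prop :=
  g ≠ 1 ∧ Module.finrank ℂ (fixedSp g) = 2

/-! ### Matrices of finite order -/

namespace Matrix

theorem exists_diagonal_of_pow_eq_one {A : Matrix (Fin 3) (Fin 3) ℂ} {n : ℕ} (hn : 0 < n)
    (h : A ^ n = 1) :
    ∃ (P Q : Matrix (Fin 3) (Fin 3) ℂ) (d : Fin 3 → ℂ),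
      P * Q = 1 ∧ Q * P = 1 ∧ A = P * diagonal d * Q ∧ ∀ i, d i ^ n = 1 := by
  set f : Module.End ℂ (Fin 3 → ℂ) := toLin' A with hf
  have hfn : f ^ n = 1 := by
    rw [hf, ← toLin'_pow, h, toLin'_one]; rfl
  have hss : f.IsSemisimple := by
    refine Module.End.isSemisimple_of_squarefree_aeval_eq_zero
      (p := Polynomial.X ^ n - 1) ?_ (by simp [hfn])
    exact (Polynomial.X_pow_sub_one_separable_iff.2 (by exact_mod_cast hn.ne')).squarefree
  set s : Set (Fin 3 → ℂ) := {v | ∃ μ : ℂ, f v = μ • v} with hs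
  have hsp : ⊤ ≤ Submodule.span ℂ s := by
    rw [← hss.iSup_eigenspace_eq_top]
    refine iSup_le fun μ v hv => Submodule.subset_span ⟨μ, Module.End.mem_eigenspace_iff.1 hv⟩
  set b₀ := Basis.ofSpan hsp with hb₀
  have hmem : ∀ i, b₀ i ∈ s := fun i => Basis.ofSpan_subset hsp ⟨i, rfl⟩
  have hfi : Finite _ := Module.Finite.finite_basis b₀
  have := Fintype.ofFinite ↑((linearIndepOn_empty ℂ (id : (Fin 3 → ℂ) → _)).extend
    (Set.empty_subset s))
  have hc := Module.finrank_eq_card_basis b₀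
  rw [Module.finrank_fin_fun] at hc
  let e := Fintype.equivFinOfCardEq hc.symm
  set b := b₀.reindex e with hb
  have hbs : ∀ i, b i ∈ s := fun i => by rw [hb, Basis.reindex_apply]; exact hmem _
  choose d hd using hbs
  refine ⟨(Pi.basisFun ℂ (Fin 3)).toMatrix b, b.toMatrix (Pi.basisFun ℂ (Fin 3)), d,
    Basis.toMatrix_mul_toMatrix_flip _ _, Basis.toMatrix_mul_toMatrix_flip _ _, ?_, ?_⟩
  · have key : A * (Pi.basisFun ℂ (Fin 3)).toMatrix b =
        (Pi.basisFun ℂ (Fin 3)).toMatrix b * diagonal d := by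
      ext i j
      have := congrFun (hd j) i
      rw [hf, toLin'_apply] at this
      simpa [Matrix.mul_apply, Basis.toMatrix_apply, Matrix.mulVec, dotProduct, diagonal_apply,
        mul_comm] using this
    rw [← key, mul_assoc, Basis.toMatrix_mul_toMatrix_flip, mul_one]
  · intro i
    have h1 : ∀ k : ℕ, (f ^ k) (b i) = d i ^ k • b i := by
      intro k
      induction k with
      | zero => simp
      | succ k ih => rw [pow_succ', Module.End.mul_apply, ih, map_smul, hd, smul_smul, pow_succ]
    have h2 := h1 n
    rw [hfn, Module.End.one_apply] at h2
    have h3 : (d i ^ n - 1) • b i = 0 := by rw [sub_smul, one_smul, ← h2, sub_self]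
    exact sub_eq_zero.1 ((smul_eq_zero.1 h3).resolve_right (b.ne_zero i))

theorem diagonal_pow_conj {P Q : Matrix (Fin 3) (Fin 3) ℂ} (hQP : Q * P = 1) (hPQ : P * Q = 1)
    (d : Fin 3 → ℂ) (k : ℕ) :
    (P * diagonal d * Q) ^ k = P * diagonal (fun i => d i ^ k) * Q := by
  induction k with
  | zero => simp [hPQ]
  | succ k ih =>
    rw [pow_succ, ih]
    calc P * diagonal (fun i => d i ^ k) * Q * (P * diagonal d * Q)
        = P * (diagonal (fun i => d i ^ k) * (Q * P) * diagonal d) * Q := by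
          simp only [mul_assoc]
      _ = _ := by rw [hQP, mul_one, diagonal_mul_diagonal]; simp [pow_succ]

theorem trace_conj_of_mul_eq_one {P Q : Matrix (Fin 3) (Fin 3) ℂ} (hQP : Q * P = 1)
    (D : Matrix (Fin 3) (Fin 3) ℂ) : (P * D * Q).trace = D.trace := by
  rw [trace_mul_comm, ← mul_assoc, hQP, one_mul]

theorem isIntegral_trace_of_pow_eq_one {A : Matrix (Fin 3) (Fin 3) ℂ} {n : ℕ} (hn : 0 < n)
    (h : A ^ n = 1) : IsIntegral ℤ A.trace := by
  obtain ⟨P, Q, d, hPQ, hQP, rfl, hd⟩ := exists_diagonal_of_pow_eq_one hn h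
  rw [trace_conj_of_mul_eq_one hQP, trace_diagonal]
  refine IsIntegral.sum _ fun i _ => IsIntegral.of_pow hn ?_
  rw [hd]; exact isIntegral_one

theorem trace_inv_eq_conj {A B : Matrix (Fin 3) (Fin 3) ℂ} {n : ℕ} (hn : 0 < n)
    (h : A ^ n = 1) (hAB : B * A = 1) : B.trace = starRingEnd ℂ A.trace := by
  obtain ⟨P, Q, d, hPQ, hQP, rfl, hd⟩ := exists_diagonal_of_pow_eq_one hn h
  have hnorm : ∀ i, d i * starRingEnd ℂ (d i) = 1 := fun i => by
    rw [Complex.mul_conj, Complex.normSq_eq_norm_sq,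
      Complex.norm_eq_one_of_pow_eq_one (hd i) hn.ne']; simp
  have hB : B = P * diagonal (fun i => starRingEnd ℂ (d i)) * Q := by
    refine (left_inv_eq_right_inv hAB ?_)
    calc P * diagonal d * Q * (P * diagonal (fun i => starRingEnd ℂ (d i)) * Q)
        = P * (diagonal d * (Q * P) * diagonal (fun i => starRingEnd ℂ (d i))) * Q := by
          simp only [mul_assoc]
      _ = 1 := by
        rw [hQP, mul_one, diagonal_mul_diagonal]; simp [hnorm, hPQ]
  rw [hB, trace_conj_of_mul_eq_one hQP, trace_conj_of_mul_eq_one hQP, trace_diagonal, trace_diagonal,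
    map_sum]

theorem eq_one_of_trace_eq_three {A : Matrix (Fin 3) (Fin 3) ℂ} {n : ℕ} (hn : 0 < n)
    (h : A ^ n = 1) (ht : A.trace = 3) : A = 1 := by
  obtain ⟨P, Q, d, hPQ, hQP, rfl, hd⟩ := exists_diagonal_of_pow_eq_one hn h
  rw [trace_conj_of_mul_eq_one hQP, trace_diagonal, Fin.sum_univ_three] at ht
  have hn1 : ∀ i, ‖d i‖ = 1 := fun i => Complex.norm_eq_one_of_pow_eq_one (hd i) hn.ne'
  have hre : ∀ i, (d i).re ≤ 1 := fun i => (Complex.re_le_norm _).trans (hn1 i).le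
  have hsum : (d 0).re + (d 1).re + (d 2).re = 3 := by simpa using congrArg Complex.re ht
  have hre1 : ∀ i, (d i).re = 1 := by
    have h0 := hre 0; have h1 := hre 1; have h2 := hre 2
    intro i
    fin_cases i <;> simp <;> linarith
  have hd1 : ∀ i, d i = 1 := fun i => by
    have h1 := hn1 i
    have h2 : Complex.normSq (d i) = 1 := by rw [Complex.normSq_eq_norm_sq, h1]; norm_num
    rw [Complex.normSq_apply, hre1 i] at h2
    have h3 : (d i).im = 0 := by nlinarith
    exact Complex.ext (by simp [hre1 i]) (by simp [h3])
  have : d = fun _ => 1 := funext hd1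
  rw [this, show diagonal (fun _ : Fin 3 => (1 : ℂ)) = 1 from diagonal_one, mul_one, hPQ]

theorem trace_sq_add (A B : Matrix (Fin 3) (Fin 3) ℂ) (hd : A.det = 1) (hAB : A * B = 1) :
    (A * A).trace = A.trace ^ 2 - 2 * B.trace := by
  have hB : B = A.adjugate := by
    have := A.adjugate_mul
    rw [hd, one_smul] at this
    exact (left_inv_eq_right_inv this hAB).symm
  subst hB
  simp only [adjugate_fin_three, trace_fin_three, Matrix.mul_apply, Fin.sum_univ_three,
    of_apply, cons_val', cons_val_zero, cons_val_one, cons_val_two]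
  simp
  ring

theorem det_sub_one_eq (A B : Matrix (Fin 3) (Fin 3) ℂ) (hd : A.det = 1) (hAB : A * B = 1) :
    (A - 1).det = B.trace * (-1) + A.trace := by
  have hB : B = A.adjugate := by
    have := A.adjugate_mul
    rw [hd, one_smul] at this
    exact (left_inv_eq_right_inv this hAB).symm
  subst hB
  rw [det_fin_three] at hd ⊢
  simp only [adjugate_fin_three, trace_fin_three]
  simp
  linear_combination hd

theorem det_add_one_eq (A B : Matrix (Fin 3) (Fin 3) ℂ) (hd : A.det = 1) (hAB : A * B = 1) :
    (A + 1).det = 2 + B.trace + A.trace := by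
  have hB : B = A.adjugate := by
    have := A.adjugate_mul
    rw [hd, one_smul] at this
    exact (left_inv_eq_right_inv this hAB).symm
  subst hB
  rw [det_fin_three] at hd ⊢
  simp only [adjugate_fin_three, trace_fin_three]
  simp
  linear_combination hd

theorem finrank_ker_diagonal_conj {P Q : Matrix (Fin 3) (Fin 3) ℂ} (hPQ : P * Q = 1)
    (hQP : Q * P = 1) (d : Fin 3 → ℂ) :
    finrank ℂ (LinearMap.ker (toLin' (P * diagonal d * Q - 1))) =
      (Finset.univ.filter fun i => d i = 1).card := by
  have hsub : P * diagonal d * Q - 1 = P * diagonal (fun i => d i - 1) * Q := by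
    have : diagonal (fun i => d i - 1) = diagonal d - 1 := by
      rw [← diagonal_one, diagonal_sub]
    rw [this, mul_sub, sub_mul, mul_one, hPQ]
  have hPu : IsUnit P.det := by
    rw [isUnit_iff_ne_zero]; intro h0
    have := congrArg det hPQ
    rw [det_mul, h0, zero_mul, det_one] at this; exact zero_ne_one this
  have hQu : IsUnit Q.det := by
    rw [isUnit_iff_ne_zero]; intro h0
    have := congrArg det hQP
    rw [det_mul, h0, zero_mul, det_one] at this; exact zero_ne_one this
  have hr : (P * diagonal d * Q - 1).rank = (Finset.univ.filter fun i => d i ≠ 1).card := by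
    rw [hsub, rank_mul_eq_left_of_isUnit_det _ _ hQu, rank_mul_eq_right_of_isUnit_det _ _ hPu,
      rank_diagonal, Fintype.card_subtype]
    simp [sub_eq_zero]
  have h1 := LinearMap.finrank_range_add_finrank_ker (toLin' (P * diagonal d * Q - 1))
  rw [Module.finrank_fin_fun] at h1
  have h2 : finrank ℂ (LinearMap.range (toLin' (P * diagonal d * Q - 1))) =
    (P * diagonal d * Q - 1).rank := rfl
  rw [h2, hr] at h1
  have h3 := Finset.card_filter_add_card_filter_not (s := (Finset.univ : Finset (Fin 3)))
    (fun i => d i = 1)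
  simp only [Finset.card_univ, Fintype.card_fin] at h3
  simp only [ne_eq] at h1
  omega

theorem eq_one_of_finrank_fixed {A : Matrix (Fin 3) (Fin 3) ℂ} {n : ℕ} (hn : 0 < n)
    (h : A ^ n = 1) (hd : A.det = 1) (hf : 2 ≤ finrank ℂ (LinearMap.ker (toLin' (A - 1)))) :
    A = 1 := by
  obtain ⟨P, Q, d, hPQ, hQP, rfl, hdn⟩ := exists_diagonal_of_pow_eq_one hn h
  rw [finrank_ker_diagonal_conj hPQ hQP] at hf
  rw [det_conj_of_mul_eq_one hPQ hQP, det_diagonal, Fin.prod_univ_three] at hd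
  have hall : ∀ i, d i = 1 := by
    by_contra! hne
    obtain ⟨i, hi⟩ := hne
    have h0 : ∀ j, j ≠ i → d j = 1 := by
      by_contra! hj
      obtain ⟨j, hji, hj⟩ := hj
      have : (Finset.univ.filter fun i => d i = 1) ⊆ Finset.univ \ {i, j} := by
        intro k hk
        simp only [Finset.mem_filter, Finset.mem_univ, true_and, Finset.mem_sdiff,
          Finset.mem_insert, Finset.mem_singleton, not_or] at hk ⊢
        exact ⟨fun e => hi (e ▸ hk), fun e => hj (e ▸ hk)⟩
      have := Finset.card_le_card this
      rw [Finset.card_sdiff, Finset.inter_univ, Finset.card_pair hji.symm] at this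
      simp at this
      omega
    apply hi
    fin_cases i
    · simpa [h0 1 (by decide), h0 2 (by decide)] using hd
    · simpa [h0 0 (by decide), h0 2 (by decide)] using hd
    · simpa [h0 0 (by decide), h0 1 (by decide)] using hd
  have : d = fun _ => 1 := funext hall
  rw [this, show diagonal (fun _ : Fin 3 => (1 : ℂ)) = 1 from diagonal_one, mul_one, hPQ]

/-- A matrix of finite order whose fixed space is a plane has spectrum `{1, 1, η}`, `η ≠ 1`. -/
theorem trace_det_of_finrank_fixed_eq_two {A : Matrix (Fin 3) (Fin 3) ℂ} {n : ℕ} (hn : 0 < n)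
    (h : A ^ n = 1) (hf : finrank ℂ (LinearMap.ker (toLin' (A - 1))) = 2) :
    A.det ≠ 1 ∧ A.trace = 2 + A.det ∧ (A.det = -1 → A ^ 2 = 1) := by
  obtain ⟨P, Q, d, hPQ, hQP, rfl, hdn⟩ := exists_diagonal_of_pow_eq_one hn h
  rw [finrank_ker_diagonal_conj hPQ hQP] at hf
  rw [det_conj_of_mul_eq_one hPQ hQP, det_diagonal, Fin.prod_univ_three,
    trace_conj_of_mul_eq_one hQP, trace_diagonal, Fin.sum_univ_three, diagonal_pow_conj hQP hPQ]
  rw [Finset.card_filter, Fin.sum_univ_three] at hf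
  by_cases h0 : d 0 = 1 <;> by_cases h1 : d 1 = 1 <;> by_cases h2 : d 2 = 1 <;>
    simp [h0, h1, h2] at hf <;>
    simp only [h0, h1, h2, one_mul, mul_one] <;>
    refine ⟨‹_›, by ring, fun hm => ?_⟩
  all_goals
    have : (fun i => d i ^ 2) = fun _ => 1 := by
      funext i
      fin_cases i <;> simp [h0, h1, h2, hm]
    rw [this, show diagonal (fun _ : Fin 3 => (1 : ℂ)) = 1 from diagonal_one, mul_one, hPQ]

theorem finrank_fixed_eq_two_of_sq {A : Matrix (Fin 3) (Fin 3) ℂ} (h : A ^ 2 = 1)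
    (ht : A.trace = 1) : finrank ℂ (LinearMap.ker (toLin' (A - 1))) = 2 := by
  obtain ⟨P, Q, d, hPQ, hQP, rfl, hdn⟩ := exists_diagonal_of_pow_eq_one two_pos h
  rw [finrank_ker_diagonal_conj hPQ hQP]
  rw [trace_conj_of_mul_eq_one hQP, trace_diagonal, Fin.sum_univ_three] at ht
  rw [Finset.card_filter, Fin.sum_univ_three]
  have hd : ∀ i, d i = 1 ∨ d i = -1 := fun i => sq_eq_one_iff.1 (hdn i)
  rcases hd 0 with h0 | h0 <;> rcases hd 1 with h1 | h1 <;> rcases hd 2 with h2 | h2 <;>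
    rw [h0, h1, h2] at ht <;> first | (exfalso; norm_num at ht; done) | norm_num [h0, h1, h2]

theorem trace_of_sq_eq_one {A : Matrix (Fin 3) (Fin 3) ℂ} (h : A ^ 2 = 1) (hd : A.det = 1) :
    A = 1 ∨ A.trace = -1 := by
  obtain ⟨P, Q, d, hPQ, hQP, rfl, hdn⟩ := exists_diagonal_of_pow_eq_one two_pos h
  by_cases hone : ∀ i, d i = 1
  · left
    have : d = fun _ => 1 := funext hone
    rw [this, show diagonal (fun _ : Fin 3 => (1 : ℂ)) = 1 from diagonal_one, mul_one, hPQ]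
  right
  rw [det_conj_of_mul_eq_one hPQ hQP, det_diagonal, Fin.prod_univ_three] at hd
  rw [trace_conj_of_mul_eq_one hQP, trace_diagonal, Fin.sum_univ_three]
  have hd' : ∀ i, d i = 1 ∨ d i = -1 := fun i => by
    have := hdn i; exact sq_eq_one_iff.1 this
  rcases hd' 0 with h0 | h0 <;> rcases hd' 1 with h1 | h1 <;> rcases hd' 2 with h2 | h2 <;>
    rw [h0, h1, h2] at hd <;> rw [h0, h1, h2] <;>
    first | (exfalso; norm_num at hd; done) | norm_num
  exact hone (fun i => by fin_cases i <;> simp [h0, h1, h2])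

end Matrix

/-! ### Character sums for three-dimensional representations -/

section Character

variable {G : Type*} [Group G] [Fintype G] (ρ : G →* Matrix (Fin 3) (Fin 3) ℂ)

theorem map_pow_card_eq_one (g : G) : ρ g ^ Fintype.card G = 1 := by
  rw [← map_pow, pow_card_eq_one, map_one]

omit [Fintype G] in
theorem map_mul_map_inv (g : G) : ρ g * ρ g⁻¹ = 1 := by
  rw [← map_mul, mul_inv_cancel, map_one]

omit [Fintype G] in
theorem map_inv_mul_map (g : G) : ρ g⁻¹ * ρ g = 1 := by
  rw [← map_mul, inv_mul_cancel, map_one]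

theorem isIntegral_trace (g : G) : IsIntegral ℤ (ρ g).trace :=
  isIntegral_trace_of_pow_eq_one Fintype.card_pos (map_pow_card_eq_one ρ g)

theorem trace_map_inv (g : G) : (ρ g⁻¹).trace = starRingEnd ℂ (ρ g).trace :=
  trace_inv_eq_conj Fintype.card_pos (map_pow_card_eq_one ρ g) (map_inv_mul_map ρ g)

theorem trace_map_mul_inv (g : G) :
    (ρ g).trace * (ρ g⁻¹).trace = (Complex.normSq (ρ g).trace : ℂ) := by
  rw [trace_map_inv, Complex.mul_conj]

omit [Fintype G] in
theorem trace_map_conj (g h : G) : (ρ (g * h * g⁻¹)).trace = (ρ h).trace := by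
  rw [map_mul, map_mul, trace_conj_of_mul_eq_one (map_inv_mul_map ρ g)]

theorem eq_one_of_trace_map (hρ : Function.Injective ρ) {g : G} (h : (ρ g).trace = 3) : g = 1 :=
  hρ ((eq_one_of_trace_eq_three Fintype.card_pos (map_pow_card_eq_one ρ g) h).trans
    (map_one ρ).symm)

/-- The character sum is the order of the group times the dimension of the invariants. -/
theorem exists_sum_trace_eq : ∃ m : ℕ, ∑ g, (ρ g).trace = Fintype.card G * m ∧
    ((∃ v : Fin 3 → ℂ, v ≠ 0 ∧ ∀ g, ρ g *ᵥ v = v) → 1 ≤ m) := by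
  have hn : (Fintype.card G : ℂ) ≠ 0 := by exact_mod_cast Fintype.card_ne_zero
  let U : Submodule ℂ (Fin 3 → ℂ) :=
    { carrier := {v | ∀ g, ρ g *ᵥ v = v}
      add_mem' := fun {a b} ha hb g => by rw [mulVec_add, ha g, hb g]
      zero_mem' := fun g => mulVec_zero _
      smul_mem' := fun c v hv g => by rw [mulVec_smul, hv g] }
  have hproj : LinearMap.IsProj U
      ((Fintype.card G : ℂ)⁻¹ • toLin' (∑ g, ρ g)) := by
    constructor
    · intro v g
      simp only [LinearMap.smul_apply, toLin'_apply, mulVec_smul, mulVec_mulVec]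
      rw [Finset.mul_sum]
      congr 2
      rw [← Equiv.sum_comp (Equiv.mulLeft g) ρ]
      simp
    · intro v hv
      simp only [LinearMap.smul_apply, toLin'_apply, sum_mulVec]
      rw [Finset.sum_congr rfl (fun g _ => hv g), Finset.sum_const, Finset.card_univ,
        ← Nat.cast_smul_eq_nsmul ℂ, smul_smul, inv_mul_cancel₀ hn, one_smul]
  refine ⟨finrank ℂ U, ?_, ?_⟩
  · have := hproj.trace
    rw [map_smul, trace_toLin'_eq, trace_sum, smul_eq_mul] at this
    rw [← this, mul_inv_cancel_left₀ hn]
  · rintro ⟨v, hv, hfix⟩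
    rw [Nat.one_le_iff_ne_zero, ← Nat.pos_iff_ne_zero, Module.finrank_pos_iff]
    exact ⟨⟨⟨v, hfix⟩, 0, fun h => hv (congrArg Subtype.val h)⟩⟩

omit [Fintype G] in
/-- **Schur's lemma** for matrices. -/
theorem exists_eq_smul_one_of_commute
    (hirr : ∀ U : Submodule ℂ (Fin 3 → ℂ), (∀ g, ∀ v ∈ U, ρ g *ᵥ v ∈ U) → U = ⊥ ∨ U = ⊤)
    {M : Matrix (Fin 3) (Fin 3) ℂ} (hM : ∀ g, ρ g * M = M * ρ g) : ∃ c : ℂ, M = c • 1 := by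
  obtain ⟨c, hc⟩ := Module.End.exists_eigenvalue (toLin' M)
  refine ⟨c, ?_⟩
  have hmem : ∀ v, v ∈ Module.End.eigenspace (toLin' M) c ↔ M *ᵥ v = c • v := fun v => by
    rw [Module.End.mem_eigenspace_iff, toLin'_apply]
  rcases hirr (Module.End.eigenspace (toLin' M) c) (fun g v hv => by
    rw [hmem] at hv ⊢
    rw [mulVec_mulVec, ← hM, ← mulVec_mulVec, hv, mulVec_smul]) with h | h
  · exact absurd h hc
  · apply toLin'.injective
    refine LinearMap.ext fun v => ?_
    have : v ∈ Module.End.eigenspace (toLin' M) c := h ▸ Submodule.mem_top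
    rw [hmem] at this
    simp [this]

variable (hirr : ∀ U : Submodule ℂ (Fin 3 → ℂ), (∀ g, ∀ v ∈ U, ρ g *ᵥ v ∈ U) → U = ⊥ ∨ U = ⊤)

omit [Fintype G] in
include hirr in
/-- Class sums act as scalars. -/
theorem sum_trace_mul_eq (X : Finset G) (hX : ∀ g, ∀ x ∈ X, g * x * g⁻¹ ∈ X) (h : G) :
    ∑ x ∈ X, (ρ (h * x)).trace * 3 = (ρ h).trace * ∑ x ∈ X, (ρ x).trace := by
  obtain ⟨c, hc⟩ := exists_eq_smul_one_of_commute ρ hirr (M := ∑ x ∈ X, ρ x) (fun g => by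
    rw [Finset.mul_sum, Finset.sum_mul]
    refine Finset.sum_bij' (fun x _ => g * x * g⁻¹) (fun x _ => g⁻¹ * x * g)
      (fun x hx => hX g x hx) (fun x hx => by simpa using hX g⁻¹ x hx) ?_ ?_ ?_
    · intro x _; simp [mul_assoc]
    · intro x _; simp [mul_assoc]
    · intro x _; rw [← map_mul, ← map_mul]; simp [mul_assoc])
  have h1 : ∑ x ∈ X, (ρ x).trace = 3 * c := by
    rw [← trace_sum, hc, trace_smul, trace_one]; simp [mul_comm]
  rw [← Finset.sum_mul, h1]
  have h2 : ∑ x ∈ X, (ρ (h * x)).trace = c * (ρ h).trace := by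
    simp only [map_mul]
    rw [← trace_sum, ← Finset.mul_sum, hc, Matrix.mul_smul, mul_one, trace_smul, smul_eq_mul]
  rw [h2]; ring

include hirr in
/-- An irreducible character has norm one. -/
theorem sum_trace_mul_trace_inv :
    ∑ g, (ρ g).trace * (ρ g⁻¹).trace = Fintype.card G := by
  have key : ∀ i j k l : Fin 3, ∑ g, ρ g k i * ρ g⁻¹ j l * 3 =
      if k = l then (if i = j then (Fintype.card G : ℂ) else 0) else 0 := by
    intro i j k l
    obtain ⟨c, hc⟩ := exists_eq_smul_one_of_commute ρ hirr
      (M := ∑ g, ρ g * single i j (1 : ℂ) * ρ g⁻¹) (fun h => by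
        rw [Finset.mul_sum, Finset.sum_mul, ← Equiv.sum_comp (Equiv.mulLeft h)
          (fun g => ρ g * single i j (1 : ℂ) * ρ g⁻¹ * ρ h)]
        refine Finset.sum_congr rfl fun g _ => ?_
        simp only [Equiv.coe_mulLeft, _root_.mul_inv_rev, map_mul, mul_assoc, map_inv_mul_map,
          mul_one])
    have htr := congrArg trace hc
    rw [trace_sum, trace_smul, trace_one] at htr
    simp only [trace_conj_of_mul_eq_one (map_inv_mul_map ρ _)] at htr
    have hcc : c * 3 = if i = j then (Fintype.card G : ℂ) else 0 := by
      have : (single i j (1 : ℂ)).trace = if i = j then 1 else 0 := by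
        split_ifs with hij
        · subst hij; simp
        · exact trace_single_eq_of_ne _ _ _ hij
      rw [this] at htr
      simp at htr
      rw [← htr]
    have hkl := congrFun (congrFun hc k) l
    rw [Matrix.sum_apply] at hkl
    have h3 : ∀ g, (ρ g * single i j (1 : ℂ) * ρ g⁻¹) k l = ρ g k i * ρ g⁻¹ j l := by
      intro g
      rw [Matrix.mul_apply, Finset.sum_eq_single j]
      · simp
      · intro b _ hb; simp [mul_single_apply_of_ne, hb]
      · simp
    simp only [h3] at hkl
    rw [← Finset.sum_mul, hkl, Matrix.smul_apply, one_apply, smul_eq_mul]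
    split_ifs <;> simp_all
  have h3 : (∑ g, (ρ g).trace * (ρ g⁻¹).trace) * 3 = Fintype.card G * 3 := by
    calc (∑ g, (ρ g).trace * (ρ g⁻¹).trace) * 3
        = ∑ k : Fin 3, ∑ l : Fin 3, ∑ g, ρ g k k * ρ g⁻¹ l l * 3 := by
          simp only [trace_fin_three, Fin.sum_univ_three, ← Finset.sum_add_distrib,
            Finset.sum_mul]
          exact Finset.sum_congr rfl fun g _ => by ring
      _ = _ := by
          simp only [key, Fin.sum_univ_three]
          simp
          ring
  exact mul_right_cancel₀ three_ne_zero h3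

omit [Fintype G] in
theorem card_modEq_card_commute {p : ℕ} [Fact p.Prime] {g : G} (hg : g ^ p = 1) (X : Finset G)
    (hX : ∀ x ∈ X, g * x * g⁻¹ ∈ X) :
    X.card ≡ (X.filter fun x => g * x * g⁻¹ = x).card [MOD p] := by
  let f : Function.End X := fun x => ⟨g * x * g⁻¹, hX x x.2⟩
  have hf : ∀ k : ℕ, ∀ x : X, ((f ^ k) x : G) = g ^ k * x * (g ^ k)⁻¹ := by
    intro k
    induction k with
    | zero => intro x; simp only [pow_zero, one_mul, inv_one, mul_one]; rfl
    | succ k ih =>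
      intro x
      have : (f ^ (k + 1)) x = f ((f ^ k) x) := by rw [pow_succ']; rfl
      rw [this]
      change g * ((f ^ k) x : G) * g⁻¹ = _
      rw [ih, pow_succ']; group
  have := Equiv.Perm.card_fixedPoints_modEq (f := f) (p := p) (n := 1) (by
    funext x
    apply Subtype.ext
    rw [hf, pow_one, hg]; simp only [one_mul, inv_one, mul_one]; rfl)
  rw [Fintype.card_coe] at this
  refine this.trans ?_
  rw [← Fintype.card_coe (X.filter _)]
  refine congrArg (· % p) ?_
  refine Fintype.card_congr
    ⟨fun x => ⟨x.1, Finset.mem_filter.2 ⟨x.1.2, congrArg Subtype.val x.2⟩⟩,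
     fun x => ⟨⟨x.1, (Finset.mem_filter.1 x.2).1⟩, Subtype.ext (Finset.mem_filter.1 x.2).2⟩,
     fun _ => rfl, fun _ => rfl⟩

omit [Fintype G] in
theorem exists_sum_eq_sum_commute_add {p : ℕ} [Fact p.Prime] {g : G} (hg : g ^ p = 1)
    (X : Finset G) (hX : ∀ x ∈ X, g * x * g⁻¹ ∈ X) {R : Type*} [CommRing R] (F : G → R)
    (hF : ∀ x ∈ X, F (g * x * g⁻¹) = F x) :
    ∃ r : R, ∑ x ∈ X, F x = ∑ x ∈ X.filter (fun x => g * x * g⁻¹ = x), F x + p * r := by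
  have hfib : ∀ y : R, ∃ k : ℤ, ((X.filter fun x => F x = y).card : ℤ) =
      (((X.filter fun x => g * x * g⁻¹ = x).filter fun x => F x = y).card : ℤ) + p * k := by
    intro y
    have h := card_modEq_card_commute hg (X.filter fun x => F x = y) (fun x hx => by
      rw [Finset.mem_filter] at hx ⊢
      exact ⟨hX x hx.1, (hF x hx.1).trans hx.2⟩)
    rw [Finset.filter_comm] at h
    obtain ⟨k, hk⟩ := (Nat.modEq_iff_dvd.1 h.symm)
    exact ⟨k, by rw [← hk]; ring⟩
  choose k hk using hfib
  refine ⟨∑ y ∈ X.image F, (k y : R) * y, ?_⟩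
  have hmaps : ∀ Y ⊆ X, ∑ x ∈ Y, F x =
      ∑ y ∈ X.image F, (((Y.filter fun x => F x = y).card : ℤ) : R) * y := by
    intro Y hY
    rw [← Finset.sum_fiberwise_of_maps_to
      (fun x hx => Finset.mem_image_of_mem F (hY hx)) F]
    refine Finset.sum_congr rfl fun y _ => ?_
    rw [Finset.sum_congr rfl (fun x hx => (Finset.mem_filter.1 hx).2), Finset.sum_const,
      nsmul_eq_mul, Int.cast_natCast]
  rw [hmaps X subset_rfl, hmaps _ (Finset.filter_subset _ _), Finset.mul_sum,
    ← Finset.sum_add_distrib]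
  refine Finset.sum_congr rfl fun y _ => ?_
  rw [hk y]; push_cast; ring

end Character

/-! ### Automorphisms of order five of groups of order dividing `432` -/

theorem Matrix.exists_int_trace_of_sq_eq_one {A : Matrix (Fin 3) (Fin 3) ℂ} (h : A ^ 2 = 1) :
    ∃ k : ℤ, A.trace = k ∧ (A = 1 ∨ k ≤ 1) := by
  obtain ⟨P, Q, d, hPQ, hQP, rfl, hdn⟩ := exists_diagonal_of_pow_eq_one two_pos h
  rw [trace_conj_of_mul_eq_one hQP, trace_diagonal, Fin.sum_univ_three]
  by_cases hone : ∀ i, d i = 1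
  · have hd : d = fun _ => 1 := funext hone
    refine ⟨3, by rw [hone, hone, hone]; norm_num, Or.inl ?_⟩
    rw [hd, show diagonal (fun _ : Fin 3 => (1 : ℂ)) = 1 from diagonal_one, mul_one, hPQ]
  have hd' : ∀ i, d i = 1 ∨ d i = -1 := fun i => by
    have := hdn i; exact sq_eq_one_iff.1 this
  rcases hd' 0 with h0 | h0 <;> rcases hd' 1 with h1 | h1 <;> rcases hd' 2 with h2 | h2
  · exact absurd (fun i => by fin_cases i <;> simp [h0, h1, h2]) hone
  · exact ⟨1, by rw [h0, h1, h2]; norm_num, Or.inr (by norm_num)⟩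
  · exact ⟨1, by rw [h0, h1, h2]; norm_num, Or.inr (by norm_num)⟩
  · exact ⟨-1, by rw [h0, h1, h2]; norm_num, Or.inr (by norm_num)⟩
  · exact ⟨1, by rw [h0, h1, h2]; norm_num, Or.inr (by norm_num)⟩
  · exact ⟨-1, by rw [h0, h1, h2]; norm_num, Or.inr (by norm_num)⟩
  · exact ⟨-1, by rw [h0, h1, h2]; norm_num, Or.inr (by norm_num)⟩
  · exact ⟨-3, by rw [h0, h1, h2]; norm_num, Or.inr (by norm_num)⟩

section FixedPoints

variable {M : Type*} [Group M] [Fintype M]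

theorem card_filter_mem_subgroup (H : Subgroup M) :
    (Finset.univ.filter fun x : M => x ∈ H).card = Nat.card H := by
  rw [Nat.card_eq_fintype_card, ← Fintype.card_subtype]

theorem exists_sum_trace_subgroup (ρ : M →* Matrix (Fin 3) (Fin 3) ℂ) (H : Subgroup M) :
    ∃ m : ℕ, ∑ x ∈ Finset.univ.filter (fun x : M => x ∈ H), (ρ x).trace = Nat.card H * m ∧
      ((∃ v : Fin 3 → ℂ, v ≠ 0 ∧ ∀ x ∈ H, ρ x *ᵥ v = v) → 1 ≤ m) := by
  obtain ⟨m, hm, h⟩ := exists_sum_trace_eq (ρ.comp H.subtype)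
  refine ⟨m, ?_, fun ⟨v, hv, hfix⟩ => h ⟨v, hv, fun x => hfix x x.2⟩⟩
  rw [Nat.card_eq_fintype_card, ← hm]
  exact Finset.sum_subtype (Finset.univ.filter (fun x : M => x ∈ H)) (by simp)
    (fun x => (ρ x).trace)

theorem Subgroup.card_modEq_card_inf_centralizer {p : ℕ} [Fact p.Prime] {g : M} (hg : g ^ p = 1)
    (H : Subgroup M) (hH : ∀ x ∈ H, g * x * g⁻¹ ∈ H) :
    Nat.card H ≡ Nat.card (H ⊓ Subgroup.centralizer {g} : Subgroup M) [MOD p] := by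
  have := card_modEq_card_commute hg (Finset.univ.filter fun x : M => x ∈ H)
    (fun x hx => by simpa using hH x (by simpa using hx))
  rw [card_filter_mem_subgroup, Finset.filter_filter] at this
  rw [← card_filter_mem_subgroup (H ⊓ _)]
  convert this using 3 with x
  rw [Subgroup.mem_inf, Subgroup.mem_centralizer_singleton_iff, mul_inv_eq_iff_eq_mul]
  exact ⟨fun h => ⟨h.1, h.2.symm⟩, fun h => ⟨h.1, h.2.symm⟩⟩

/-- An element of order five normalizing a subgroup of order `16` whose only fixed point is the
identity cannot exist in a three-dimensional linear group. -/
theorem Subgroup.not_card_eq_sixteen_of_inf_centralizer_eq_bot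
    (ρ : M →* Matrix (Fin 3) (Fin 3) ℂ) (hρ : Function.Injective ρ) {g : M} (hg : g ^ 5 = 1)
    (Q : Subgroup M) (hQ : ∀ x ∈ Q, g * x * g⁻¹ ∈ Q)
    (hfix : Q ⊓ Subgroup.centralizer {g} = ⊥) : Nat.card Q ≠ 16 := by
  intro hQc
  have : Fact (Nat.Prime 5) := ⟨by norm_num⟩
  have : Fact (Nat.Prime 2) := ⟨by norm_num⟩
  have key : ∀ H : Subgroup M, H ≤ Q → (∀ x ∈ H, g * x * g⁻¹ ∈ H) → H ≠ ⊥ → H = Q := by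
    intro H hHQ hH hne
    have h1 := Subgroup.card_modEq_card_inf_centralizer hg H hH
    have h2 : H ⊓ Subgroup.centralizer {g} = ⊥ :=
      le_bot_iff.1 (hfix ▸ inf_le_inf_right _ hHQ)
    rw [h2, Subgroup.card_bot] at h1
    have h3 : Nat.card H ∣ 2 ^ 4 := by
      rw [show 2 ^ 4 = 16 by norm_num, ← hQc]
      exact Subgroup.card_dvd_of_le hHQ
    obtain ⟨e, he, heq⟩ := (Nat.dvd_prime_pow Nat.prime_two).1 h3
    have h4 : Nat.card H ≠ 1 := fun h => hne (Subgroup.card_eq_one.1 h)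
    refine Subgroup.eq_of_le_of_card_ge hHQ ?_
    rw [hQc, heq]
    rw [heq] at h1 h4
    interval_cases e <;> simp [Nat.ModEq] at h1 h4 ⊢
  have hQp : IsPGroup 2 Q := IsPGroup.of_card (n := 4) (by rw [hQc]; norm_num)
  have : Nontrivial Q := Finite.one_lt_card_iff_nontrivial.1 (by rw [hQc]; norm_num)
  have hconj : ∀ x ∈ Q, ∀ y ∈ Q, (x * y = y * x) := by
    have hZ := key ((Subgroup.center Q).map Q.subtype) (Subgroup.map_subtype_le _) ?_ ?_
    · intro x hx y hy
      rw [← hZ] at hx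
      obtain ⟨z, hz, rfl⟩ := hx
      exact (congrArg Subtype.val (Subgroup.mem_center_iff.1 hz ⟨y, hy⟩)).symm
    · rintro _ ⟨z, hz, rfl⟩
      refine ⟨⟨g * z * g⁻¹, hQ _ z.2⟩, ?_, rfl⟩
      refine Subgroup.mem_center_iff.2 fun y => Subtype.ext ?_
      have hy : g⁻¹ * (y : M) * g ∈ Q := by
        have h5 : ∀ k : ℕ, g ^ k * (y : M) * (g ^ k)⁻¹ ∈ Q := by
          intro k
          induction k with
          | zero => simp
          | succ k ih => convert hQ _ ih using 1; rw [pow_succ']; group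
        have h4 : g ^ 4 = g⁻¹ := eq_inv_of_mul_eq_one_left (by rw [← pow_succ, hg])
        simpa [h4] using h5 4
      have hc := congrArg Subtype.val (Subgroup.mem_center_iff.1 hz ⟨_, hy⟩)
      simp only [Subgroup.coe_mul] at hc ⊢
      calc (y : M) * (g * z * g⁻¹) = g * (g⁻¹ * y * g * z) * g⁻¹ := by group
        _ = g * (z * (g⁻¹ * y * g)) * g⁻¹ := by rw [hc]
        _ = _ := by group
    · intro h
      rw [Subgroup.map_eq_bot_iff_of_injective _ Q.subtype_injective] at h
      have := hQp.center_nontrivial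
      exact (Subgroup.nontrivial_iff_ne_bot _).1 this h
  have hsq : ∀ x ∈ Q, x ^ 2 = 1 := by
    let Ω : Subgroup M :=
      { carrier := {x | x ∈ Q ∧ x ^ 2 = 1}
        mul_mem' := fun {a b} ha hb => ⟨Q.mul_mem ha.1 hb.1, by
          rw [(show Commute a b from hconj a ha.1 b hb.1).mul_pow, ha.2, hb.2, one_mul]⟩
        one_mem' := ⟨Q.one_mem, one_pow 2⟩
        inv_mem' := fun {a} ha => ⟨Q.inv_mem ha.1, by rw [inv_pow, ha.2, inv_one]⟩ }
    have hΩ := key Ω (fun x hx => hx.1)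
      (fun x hx => ⟨hQ x hx.1, by rw [conj_pow, hx.2]; simp⟩) (by
        obtain ⟨x, hx⟩ := exists_prime_orderOf_dvd_card' (G := Q) 2 (by rw [hQc]; norm_num)
        intro h
        have hmem : (x : M) ∈ Ω := ⟨x.2, by
          rw [← Subgroup.coe_pow, ← hx, pow_orderOf_eq_one]; rfl⟩
        rw [h, Subgroup.mem_bot] at hmem
        have : x = 1 := Subtype.ext hmem
        rw [this, orderOf_one] at hx
        norm_num at hx)
    intro x hx
    rw [← hΩ] at hx
    exact hx.2
  have hex : ∀ x : M, ∃ k : ℤ, x ∈ Q → (ρ x).trace = k ∧ (x = 1 ∨ k ≤ 1) := by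
    intro x
    by_cases hx : x ∈ Q
    · obtain ⟨k, hk, h⟩ := exists_int_trace_of_sq_eq_one (A := ρ x)
        (by rw [← map_pow, hsq x hx, map_one])
      exact ⟨k, fun _ => ⟨hk, h.imp (fun h => hρ (h.trans (map_one ρ).symm)) id⟩⟩
    · exact ⟨0, fun h => absurd h hx⟩
  choose F hF using hex
  obtain ⟨m, hm, -⟩ := exists_sum_trace_subgroup ρ Q
  have hsum : ∑ x ∈ Finset.univ.filter (fun x : M => x ∈ Q), F x = 16 * m := by
    have h1 : ((∑ x ∈ Finset.univ.filter (fun x : M => x ∈ Q), F x : ℤ) : ℂ) = 16 * m := by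
      push_cast
      rw [hQc] at hm
      rw [show (16 : ℂ) = ((16 : ℕ) : ℂ) by norm_num, ← hm]
      exact Finset.sum_congr rfl fun x hx => ((hF x (Finset.mem_filter.1 hx).2).1).symm
    exact_mod_cast h1
  obtain ⟨r, hr⟩ := exists_sum_eq_sum_commute_add hg (Finset.univ.filter (fun x : M => x ∈ Q))
    (fun x hx => by simpa using hQ x (by simpa using hx)) F (fun x hx => by
      have hx : x ∈ Q := by simpa using hx
      have h1 := (hF _ (hQ x hx)).1
      rw [trace_map_conj, (hF x hx).1] at h1
      exact_mod_cast h1.symm)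
  have hfx : (Finset.univ.filter (fun x : M => x ∈ Q)).filter (fun x => g * x * g⁻¹ = x) = {1} := by
    ext x
    simp only [Finset.mem_filter, Finset.mem_univ, true_and, Finset.mem_singleton]
    constructor
    · rintro ⟨h1, h2⟩
      have : x ∈ Q ⊓ Subgroup.centralizer {g} := ⟨h1,
        Subgroup.mem_centralizer_singleton_iff.2 (mul_inv_eq_iff_eq_mul.1 h2).symm⟩
      rwa [hfix, Subgroup.mem_bot] at this
    · rintro rfl; exact ⟨Q.one_mem, by simp⟩
  have hF1 : F 1 = 3 := by
    have := (hF 1 Q.one_mem).1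
    rw [map_one, trace_one] at this
    have h3 : ((F 1 : ℤ) : ℂ) = ((3 : ℤ) : ℂ) := by rw [← this]; simp
    exact_mod_cast h3
  rw [hfx, Finset.sum_singleton, hF1, hsum] at hr
  have hle : ∑ x ∈ Finset.univ.filter (fun x : M => x ∈ Q), F x ≤ 18 := by
    rw [← Finset.add_sum_erase _ _ (show (1 : M) ∈ Finset.univ.filter (fun x : M => x ∈ Q) by
      simp [Q.one_mem]), hF1]
    have h2 := Finset.sum_le_card_nsmul ((Finset.univ.filter (fun x : M => x ∈ Q)).erase 1) F 1
      (fun x hx => by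
        rw [Finset.mem_erase, Finset.mem_filter] at hx
        exact (hF x hx.2.2).2.resolve_left hx.1)
    rw [Finset.card_erase_of_mem (by simp [Q.one_mem]), card_filter_mem_subgroup, hQc] at h2
    rw [nsmul_eq_mul] at h2
    push_cast at h2
    linarith
  rw [hsum] at hle
  push_cast at hr
  omega

end FixedPoints

section NormalComplement

variable {M : Type*} [Group M] [Fintype M]

open scoped Pointwise in
theorem Subgroup.exists_stable_sylow {g : M} (hg : g ^ 5 = 1) (K : Subgroup M) [K.Normal]
    (hK : Nat.card K ∣ 432) (p : ℕ) [Fact p.Prime] :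
    ∃ Q : Subgroup M, Q ≤ K ∧ (∀ x ∈ Q, g * x * g⁻¹ ∈ Q) ∧
      ∃ b a : ℕ, Nat.card Q = p ^ b ∧ Nat.card K = p ^ b * a ∧ ¬ p ∣ a := by
  have : Fact (Nat.Prime 5) := ⟨by norm_num⟩
  have hfin : Finite (Sylow p K) := inferInstance
  have := Fintype.ofFinite (Sylow p K)
  set φ : MulAut K := MulAut.conjNormal g with hφ
  have hφ5 : φ ^ 5 = 1 := by rw [hφ, ← map_pow, hg, map_one]
  let f : Function.End (Sylow p K) := fun Q => φ • Q
  have hf : ∀ k : ℕ, ∀ Q, (f ^ k) Q = φ ^ k • Q := by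
    intro k
    induction k with
    | zero => intro Q; rw [pow_zero, pow_zero, one_smul]; rfl
    | succ k ih =>
      intro Q
      have : (f ^ (k + 1)) Q = f ((f ^ k) Q) := by rw [pow_succ']; rfl
      rw [this, ih, pow_succ', mul_smul]
  have hmod := Equiv.Perm.card_fixedPoints_modEq (f := f) (p := 5) (n := 1) (by
    funext Q
    rw [pow_one, hf, hφ5, one_smul]; rfl)
  have hne : Nonempty f.fixedPoints := by
    by_contra hne
    rw [not_nonempty_iff] at hne
    rw [Fintype.card_eq_zero (α := f.fixedPoints)] at hmod
    have h5 : 5 ∣ Nat.card (Sylow p K) := by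
      rw [Nat.card_eq_fintype_card]; exact (Nat.modEq_zero_iff_dvd).1 hmod
    have h1 := (default : Sylow p K).card_dvd_index
    have h2 := (default : Sylow p K).toSubgroup.index_dvd_card
    have := ((h5.trans h1).trans h2).trans hK
    norm_num at this
  obtain ⟨⟨Q, hQ⟩⟩ := hne
  have hQ' : φ • Q = Q := hQ
  obtain ⟨b, hb⟩ := IsPGroup.iff_card.1 Q.2
  have hcQ : Nat.card (Q.toSubgroup.map K.subtype) = p ^ b := by
    rw [← hb]
    exact Nat.card_congr (Subgroup.equivMapOfInjective _ _ K.subtype_injective).toEquiv.symm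
  refine ⟨Q.toSubgroup.map K.subtype, Subgroup.map_subtype_le _, ?_, b, Q.index, hcQ, ?_,
    Q.not_dvd_index⟩
  · rintro _ ⟨x, hx, rfl⟩
    refine ⟨φ x, ?_, by simp [hφ]⟩
    have : φ • x ∈ φ • Q.toSubgroup := Subgroup.smul_mem_pointwise_smul _ _ _ hx
    rw [← Sylow.pointwise_smul_def, hQ'] at this
    exact this
  · rw [← hb]; exact (Q.toSubgroup.card_mul_index).symm

/-- A linear group of order `5m`, `m ∣ 432`, in which the normalizer of a Sylow `5`-subgroup is its
centralizer, centralizes that subgroup. -/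
theorem mul_comm_of_normalizer_le_centralizer
    (ρ : M →* Matrix (Fin 3) (Fin 3) ℂ) (hρ : Function.Injective ρ) {m : ℕ}
    (hM : Nat.card M = 5 * m) (hm : m ∣ 432) {g : M} (hg : g ^ 5 = 1) (hg1 : g ≠ 1)
    (hN : ∀ (n : M) (k : ℕ), n * g * n⁻¹ = g ^ k → n * g * n⁻¹ = g) (x : M) :
    x * g = g * x := by
  have : Fact (Nat.Prime 5) := ⟨by norm_num⟩
  have : Fact (Nat.Prime 2) := ⟨by norm_num⟩
  have : Fact (Nat.Prime 3) := ⟨by norm_num⟩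
  have hm0 : m ≠ 0 := fun h => by rw [h] at hm; norm_num at hm
  have h5m : ¬ 5 ∣ m := fun h => by have := h.trans hm; norm_num at this
  have hord : orderOf g = 5 := orderOf_eq_prime hg hg1
  have hfac : (Nat.card M).factorization 5 = 1 := by
    rw [hM, Nat.factorization_mul (by norm_num) hm0]
    simp [Nat.factorization_eq_zero_of_not_dvd h5m, Nat.Prime.factorization_self Nat.prime_five]
  let P : Sylow 5 M := Sylow.ofCard (Subgroup.zpowers g) (by
    rw [hfac, Nat.card_zpowers, hord, pow_one])
  have hPz : (P : Subgroup M) = Subgroup.zpowers g := rfl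
  have hpow : ∀ y ∈ Subgroup.zpowers g, ∃ k : ℕ, g ^ k = y := fun y hy =>
    (mem_powers_iff_mem_zpowers.2 hy)
  have hP : Subgroup.normalizer ((P : Subgroup M) : Set M) ≤
      Subgroup.centralizer ((P : Subgroup M) : Set M) := by
    intro n hn y hy
    rw [hPz] at hn hy
    have h1 : n * g * n⁻¹ ∈ Subgroup.zpowers g :=
      (Subgroup.mem_normalizer_iff.1 hn g).1 (Subgroup.mem_zpowers g)
    obtain ⟨k, hk⟩ := hpow _ h1
    have h2 := mul_inv_eq_iff_eq_mul.1 (hN n k hk.symm)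
    obtain ⟨j, rfl⟩ := hpow y hy
    exact (show Commute g n from h2.symm).pow_left j
  set K := (MonoidHom.transferSylow P hP).ker with hKdef
  have hcompl : K.IsComplement' P := MonoidHom.ker_transferSylow_isComplement' P hP
  have hKc : Nat.card K = m := by
    have h1 := hcompl.card_mul_card
    have h2 : Nat.card P = 5 := by
      change Nat.card (Subgroup.zpowers g) = 5
      rw [Nat.card_zpowers, hord]
    rw [h2, hM] at h1
    omega
  have hK432 : Nat.card K ∣ 432 := hKc ▸ hm
  have hbig : ∀ p : ℕ, p = 2 ∨ p = 3 → ∃ b a : ℕ, Nat.card K = p ^ b * a ∧ ¬ p ∣ a ∧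
      p ^ b ∣ Nat.card (K ⊓ Subgroup.centralizer {g} : Subgroup M) := by
    intro p hp
    have : Fact (Nat.Prime p) := ⟨by rcases hp with rfl | rfl <;> norm_num⟩
    obtain ⟨Q, hQK, hQ, b, a, hQc, hKa, ha⟩ := K.exists_stable_sylow hg hK432 p
    refine ⟨b, a, hKa, ha, ?_⟩
    have hle : Q ≤ Subgroup.centralizer {g} := by
      have h1 := Q.card_modEq_card_inf_centralizer hg hQ
      have h2 : Nat.card (Q ⊓ Subgroup.centralizer {g} : Subgroup M) ∣ p ^ b :=
        hQc ▸ Subgroup.card_dvd_of_le inf_le_left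
      obtain ⟨c, hc, hceq⟩ := (Nat.dvd_prime_pow Fact.out).1 h2
      rw [hQc, hceq] at h1
      have hpb : p ^ b ∣ 432 := (Dvd.intro _ hKa.symm).trans hK432
      have heq : c = b := by
        rcases hp with rfl | rfl
        · have hb : b ≤ 4 := by
            by_contra! hb
            have := (pow_dvd_pow 2 hb).trans hpb
            norm_num at this
          have hne : ¬ (b = 4 ∧ c = 0) := by
            rintro ⟨rfl, rfl⟩
            refine Q.not_card_eq_sixteen_of_inf_centralizer_eq_bot ρ hρ hg hQ ?_ hQc
            exact Subgroup.card_eq_one.1 hceq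
          interval_cases b <;> interval_cases c <;> simp [Nat.ModEq] at h1 hne ⊢
        · have hb : b ≤ 3 := by
            by_contra! hb
            have := (pow_dvd_pow 3 hb).trans hpb
            norm_num at this
          interval_cases b <;> interval_cases c <;> simp [Nat.ModEq] at h1 ⊢
      have := Subgroup.eq_of_le_of_card_ge (inf_le_left (a := Q) (b := Subgroup.centralizer {g}))
        (by rw [hQc, hceq, heq])
      rw [← this]; exact inf_le_right
    rw [← hQc]
    exact Subgroup.card_dvd_of_le (le_inf hQK hle)
  have hKle : K ≤ Subgroup.centralizer {g} := by
    obtain ⟨b, a, hKa, ha, hd⟩ := hbig 2 (Or.inl rfl)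
    obtain ⟨b', a', hKa', ha', hd'⟩ := hbig 3 (Or.inr rfl)
    obtain ⟨e, he⟩ : Nat.card (K ⊓ Subgroup.centralizer {g} : Subgroup M) ∣ Nat.card K :=
      Subgroup.card_dvd_of_le inf_le_left
    have hne : ∀ q c d : ℕ, q.Prime → Nat.card K = q ^ c * d → ¬ q ∣ d →
        q ^ c ∣ Nat.card (K ⊓ Subgroup.centralizer {g} : Subgroup M) → ¬ q ∣ e := by
      rintro q c d hq hKd hd ⟨t, ht⟩ hqe
      rw [hKd, ht, mul_assoc] at he
      have := Nat.eq_of_mul_eq_mul_left (pow_pos hq.pos c) he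
      exact hd (this ▸ hqe.mul_left t)
    have h2 := hne 2 b a Nat.prime_two hKa ha hd
    have h3 := hne 3 b' a' Nat.prime_three hKa' ha' hd'
    have he1 : e = 1 := by
      have h432 : e ∣ 2 ^ 4 * 3 ^ 3 := (Dvd.intro_left _ he.symm).trans hK432
      have hc2 : Nat.Coprime e (2 ^ 4) :=
        (Nat.Coprime.pow_left 4 ((Nat.Prime.coprime_iff_not_dvd Nat.prime_two).2 h2)).symm
      have hc3 : Nat.Coprime e (3 ^ 3) :=
        (Nat.Coprime.pow_left 3 ((Nat.Prime.coprime_iff_not_dvd Nat.prime_three).2 h3)).symm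
      exact Nat.Coprime.eq_one_of_dvd (Nat.Coprime.mul_right hc2 hc3) h432
    rw [he1, mul_one] at he
    have := Subgroup.eq_of_le_of_card_ge (inf_le_left (a := K) (b := Subgroup.centralizer {g}))
      he.le
    rw [← this]; exact inf_le_right
  have hPle : (P : Subgroup M) ≤ Subgroup.centralizer {g} := by
    intro y hy
    obtain ⟨j, rfl⟩ := hpow y hy
    exact Subgroup.mem_centralizer_singleton_iff.2 ((Commute.refl g).pow_left j)
  have htop : x ∈ K ⊔ (P : Subgroup M) := by
    rw [hcompl.sup_eq_top]; exact Subgroup.mem_top x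
  exact Subgroup.mem_centralizer_singleton_iff.1 (sup_le hKle hPle htop)

end NormalComplement

section SylowFive

variable {M : Type*} [Group M] [Fintype M]

/-- In a group of order `5m` with `5 ∤ m`, any two elements of order five generate conjugate
subgroups. -/
theorem exists_conj_eq_pow {m : ℕ} (hM : Nat.card M = 5 * m) (hm : ¬ 5 ∣ m) {x y : M}
    (hx : x ^ 5 = 1) (hx1 : x ≠ 1) (hy : y ^ 5 = 1) (hy1 : y ≠ 1) :
    ∃ (u : M) (j : ℕ), u * y * u⁻¹ = x ^ j := by
  have : Fact (Nat.Prime 5) := ⟨by norm_num⟩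
  have hm0 : m ≠ 0 := fun h => hm (h ▸ dvd_zero 5)
  have hfac : (Nat.card M).factorization 5 = 1 := by
    rw [hM, Nat.factorization_mul (by norm_num) hm0]
    simp [Nat.factorization_eq_zero_of_not_dvd hm, Nat.Prime.factorization_self Nat.prime_five]
  let S : ∀ z : M, z ^ 5 = 1 → z ≠ 1 → Sylow 5 M := fun z hz hz1 =>
    Sylow.ofCard (Subgroup.zpowers z) (by
      rw [hfac, Nat.card_zpowers, orderOf_eq_prime hz hz1, pow_one])
  obtain ⟨u, hu⟩ := MulAction.exists_smul_eq M (S y hy hy1) (S x hx hx1)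
  have h1 : u * y * u⁻¹ ∈ (u • S y hy hy1 : Sylow 5 M) := by
    have := Subgroup.smul_mem_pointwise_smul y (MulAut.conj u) (Subgroup.zpowers y)
      (Subgroup.mem_zpowers y)
    exact this
  rw [hu] at h1
  have h2 : u * y * u⁻¹ ∈ Subgroup.zpowers x := h1
  obtain ⟨j, hj⟩ := mem_powers_iff_mem_zpowers.2 h2
  exact ⟨u, j, hj.symm⟩

/-- The conjugacy class of `g` as a finite set. -/
noncomputable def conjFinset (g : M) : Finset M := Finset.univ.image fun w => w * g * w⁻¹

theorem mem_conjFinset {g x : M} : x ∈ conjFinset g ↔ ∃ w, w * g * w⁻¹ = x := by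
  simp [conjFinset]

theorem conj_mem_conjFinset {g : M} (w x : M) (hx : x ∈ conjFinset g) :
    w * x * w⁻¹ ∈ conjFinset g := by
  obtain ⟨v, rfl⟩ := mem_conjFinset.1 hx
  exact mem_conjFinset.2 ⟨w * v, by group⟩

theorem card_conjFinset_mul (g : M) :
    (conjFinset g).card * Nat.card (Subgroup.centralizer ({g} : Set M)) = Nat.card M := by
  have h := Finset.card_eq_sum_card_image (fun w : M => w * g * w⁻¹) Finset.univ
  have hfib : ∀ x ∈ Finset.univ.image (fun w : M => w * g * w⁻¹),
      (Finset.univ.filter fun w : M => w * g * w⁻¹ = x).card =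
        Nat.card (Subgroup.centralizer ({g} : Set M)) := by
    intro x hx
    obtain ⟨w, -, rfl⟩ := Finset.mem_image.1 hx
    rw [← card_filter_mem_subgroup]
    refine Finset.card_bij (fun v _ => w⁻¹ * v) ?_ (fun _ _ _ _ h => mul_left_cancel h) ?_
    · intro v hv
      have hv' := (Finset.mem_filter.1 hv).2
      refine Finset.mem_filter.2 ⟨Finset.mem_univ _, Subgroup.mem_centralizer_singleton_iff.2 ?_⟩
      have := mul_inv_eq_iff_eq_mul.1 hv'
      rw [mul_assoc, this]; group
    · intro c hc
      have hc' := Subgroup.mem_centralizer_singleton_iff.1 (Finset.mem_filter.1 hc).2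
      refine ⟨w * c, Finset.mem_filter.2 ⟨Finset.mem_univ _, ?_⟩, by group⟩
      rw [mul_assoc w c g, hc']; group
  rw [Finset.sum_congr rfl hfib, Finset.sum_const, smul_eq_mul, Finset.card_univ] at h
  rw [Nat.card_eq_fintype_card (α := M), h]; rfl

end SylowFive

namespace Matrix

theorem pow_three_of_det_eq_one (A B : Matrix (Fin 3) (Fin 3) ℂ) (hd : A.det = 1)
    (hAB : A * B = 1) : A ^ 3 = A.trace • A ^ 2 - B.trace • A + 1 := by
  have hB : B = A.adjugate := by
    have := A.adjugate_mul
    rw [hd, one_smul] at this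
    exact (left_inv_eq_right_inv this hAB).symm
  subst hB
  have key : A ^ 3 = A.trace • A ^ 2 - A.adjugate.trace • A + A.det • 1 := by
    rw [det_fin_three]
    ext i j
    simp only [adjugate_fin_three, trace_fin_three, pow_succ, pow_zero, one_mul, Matrix.add_apply,
      Matrix.sub_apply, Matrix.smul_apply, smul_eq_mul, Matrix.mul_apply, Fin.sum_univ_three,
      Matrix.one_apply]
    fin_cases i <;> fin_cases j <;> simp <;> ring
  rw [key, hd, one_smul]

end Matrix

/-- Roots of unity of order dividing `2160` that agree modulo a prime above `5` differ by a fifth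
root of unity. -/
theorem pow_five_eq_pow_five_of_map_eq {R F : Type*} [CommRing R] [IsDomain R] [Field F]
    (φ : R →+* F) (h5 : (5 : F) = 0) {a b : R} (ha : a ^ 2160 = 1) (hb : b ^ 2160 = 1)
    (h : φ a = φ b) : b ^ 5 = a ^ 5 := by
  set y := b ^ 5 * a ^ 2155 with hy
  have hy1 : y ^ 432 = 1 := by
    calc y ^ 432 = b ^ 2160 * (a ^ 2160) ^ 431 := by rw [hy]; ring
      _ = 1 := by rw [ha, hb]; simp
  have hφ : φ y = 1 := by
    rw [hy, map_mul, map_pow, map_pow, ← h, ← pow_add, ← map_pow, ha, map_one]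
  have hy2 : y = 1 := by
    by_contra hne
    have h1 : (y - 1) * ∑ i ∈ Finset.range 432, y ^ i = 0 := by
      rw [mul_geom_sum, hy1, sub_self]
    have h2 := (mul_eq_zero.1 h1).resolve_left (sub_ne_zero.2 hne)
    have h3 := congrArg φ h2
    simp only [map_sum, map_pow, hφ, one_pow, map_zero, Finset.sum_const, Finset.card_range,
      nsmul_eq_mul, mul_one] at h3
    push_cast at h3
    have : (1 : F) = 0 := by linear_combination 173 * h5 - 2 * h3
    exact one_ne_zero this
  calc b ^ 5 = b ^ 5 * a ^ 2160 := by rw [ha, mul_one]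
    _ = y * a ^ 5 := by rw [hy]; ring
    _ = a ^ 5 := by rw [hy2, one_mul]

theorem pow_five_eq_of_trace_congr {α s a b c r₁ r₂ : ℂ} (hα : α ^ 2 = α + 1) (hs : s = 2 * α - 1)
    (ha : a ^ 2160 = 1) (hb : b ^ 2160 = 1) (hc : c ^ 2160 = 1)
    (hr₁ : IsIntegral ℤ r₁) (hr₂ : IsIntegral ℤ r₂)
    (h1 : α * a + b + c = s * r₁) (h2 : α * a ^ 2 + b ^ 2 + c ^ 2 = s * r₂) :
    b ^ 5 = a ^ 5 ∧ c ^ 5 = a ^ 5 := by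
  let R := integralClosure ℤ ℂ
  have hzint : ∀ z : ℂ, z ^ 2160 = 1 → IsIntegral ℤ z := fun z hz =>
    IsIntegral.of_pow (by norm_num : 0 < 2160) (hz ▸ isIntegral_one)
  have hαi : IsIntegral ℤ α := by
    refine ⟨Polynomial.X ^ 2 - Polynomial.X - 1, by monicity!, ?_⟩
    simp only [Polynomial.eval₂_sub, Polynomial.eval₂_pow, Polynomial.eval₂_X,
      Polynomial.eval₂_one]
    linear_combination hα
  let α' : R := ⟨α, hαi⟩
  let a' : R := ⟨a, hzint a ha⟩
  let b' : R := ⟨b, hzint b hb⟩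
  let c' : R := ⟨c, hzint c hc⟩
  let r₁' : R := ⟨r₁, hr₁⟩
  let r₂' : R := ⟨r₂, hr₂⟩
  have h5 : ¬ IsUnit (5 : R) := by
    intro hu
    obtain ⟨t, ht⟩ := hu.exists_right_inv
    have ht' : (5 : ℂ) * (t : ℂ) = 1 := congrArg Subtype.val ht
    have hti : IsIntegral ℤ (t : ℂ) := t.2
    have htq : (t : ℂ) = algebraMap ℚ ℂ (1 / 5) := by
      have : (t : ℂ) = 1 / 5 := by linear_combination (1 / 5) * ht'
      rw [this]; simp
    rw [htq, isIntegral_algebraMap_iff (algebraMap ℚ ℂ).injective] at hti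
    obtain ⟨n, hn⟩ := IsIntegrallyClosed.isIntegral_iff.1 hti
    have : (5 * n : ℚ) = 1 := by
      have : (n : ℚ) = 1 / 5 := by simpa using hn
      rw [this]; norm_num
    have : (5 * n : ℤ) = 1 := by exact_mod_cast this
    omega
  obtain ⟨𝔪, h𝔪, hle⟩ := Ideal.exists_le_maximal (Ideal.span {(5 : R)})
    (by rwa [Ne, Ideal.span_singleton_eq_top])
  let F := R ⧸ 𝔪
  let _ : Field F := Ideal.Quotient.field 𝔪
  let φ : R →+* F := Ideal.Quotient.mk 𝔪
  have hφ5 : (5 : F) = 0 := by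
    have : φ 5 = 0 := Ideal.Quotient.eq_zero_iff_mem.2 (hle (Ideal.mem_span_singleton_self 5))
    exact (map_ofNat φ 5).symm.trans this
  have e1 : α' * a' + b' + c' = (2 * α' - 1) * r₁' := by
    apply Subtype.ext; rw [hs] at h1; exact h1
  have e2 : α' * a' ^ 2 + b' ^ 2 + c' ^ 2 = (2 * α' - 1) * r₂' := by
    apply Subtype.ext; rw [hs] at h2; exact h2
  have e3 : α' ^ 2 = α' + 1 := Subtype.ext hα
  have f1 := congrArg φ e1
  have f2 := congrArg φ e2
  have f3 := congrArg φ e3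
  simp only [map_add, map_mul, map_pow, map_sub, map_one, map_ofNat] at f1 f2 f3
  have g0 : 2 * φ α' - 1 = 0 := by
    have : (2 * φ α' - 1) ^ 2 = 0 := by linear_combination 4 * f3 + hφ5
    exact pow_eq_zero_iff two_ne_zero |>.1 this
  have g1 : φ α' = 3 := by linear_combination 3 * g0 - φ α' * hφ5
  rw [g0, zero_mul, g1] at f1 f2
  have g2 : (2 : F) ≠ 0 := by
    intro h
    have : (1 : F) = 0 := by linear_combination hφ5 - 2 * h
    exact one_ne_zero this
  have key : ∀ x y : F, 3 * φ a' + x + y = 0 → 3 * φ a' ^ 2 + x ^ 2 + y ^ 2 = 0 → φ a' = x := by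
    intro x y hx hy
    have : 2 * (φ a' - x) ^ 2 = 0 := by
      linear_combination hy - (y - 3 * φ a' - x) * hx - 2 * φ a' ^ 2 * hφ5 - 2 * φ a' * x * hφ5
    exact sub_eq_zero.1 (pow_eq_zero_iff two_ne_zero |>.1 ((mul_eq_zero.1 this).resolve_left g2))
  have kb := key _ _ f1 f2
  have kc := key (φ c') (φ b') (by linear_combination f1) (by linear_combination f2)
  have hp : ∀ z : R, (z : ℂ) ^ 2160 = 1 → z ^ 2160 = 1 := fun z hz =>
    Subtype.ext (by rw [SubmonoidClass.coe_pow, hz]; rfl)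
  have pb := pow_five_eq_pow_five_of_map_eq φ hφ5 (hp a' ha) (hp b' hb) kb
  have pc := pow_five_eq_pow_five_of_map_eq φ hφ5 (hp a' ha) (hp c' hc) kc
  exact ⟨congrArg Subtype.val pb, congrArg Subtype.val pc⟩

/-! ### Irreducible reflection groups of order `2160` in dimension three -/

section Reflection

variable {G : Type*} [Group G] [Fintype G]

/-- The element `r` acts as a reflection. -/
def IsReflectionIn (ρ : G →* Matrix (Fin 3) (Fin 3) ℂ) (r : G) : Prop :=
  r ≠ 1 ∧ finrank ℂ (LinearMap.ker (toLin' (ρ r - 1))) = 2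

/-- A faithful irreducible representation of a group of order `2160` generated by reflections. -/
structure IsReflectionRep (ρ : G →* Matrix (Fin 3) (Fin 3) ℂ) : Prop where
  card : Nat.card G = 2160
  inj : Function.Injective ρ
  irr : ∀ U : Submodule ℂ (Fin 3 → ℂ), (∀ g, ∀ v ∈ U, ρ g *ᵥ v ∈ U) → U = ⊥ ∨ U = ⊤
  gen : ∀ K : Subgroup G, (∀ r, IsReflectionIn ρ r → r ∈ K) → K = ⊤

theorem exists_fixed_vector {A : Matrix (Fin 3) (Fin 3) ℂ} (h : (A - 1).det = 0) :
    ∃ v : Fin 3 → ℂ, v ≠ 0 ∧ A *ᵥ v = v := by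
  obtain ⟨v, hv, h⟩ := exists_mulVec_eq_zero_iff.2 h
  exact ⟨v, hv, by rwa [sub_mulVec, one_mulVec, sub_eq_zero] at h⟩

namespace IsReflectionRep

variable {ρ : G →* Matrix (Fin 3) (Fin 3) ℂ} (h : IsReflectionRep ρ)
include h

theorem fintypeCard : Fintype.card G = 2160 := by rw [← Nat.card_eq_fintype_card, h.card]

theorem map_pow (g : G) : ρ g ^ 2160 = 1 := h.fintypeCard ▸ map_pow_card_eq_one ρ g

theorem pow_eq_one (g : G) : g ^ 2160 = 1 := h.fintypeCard ▸ pow_card_eq_one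

theorem exists_reflection_notMem {K : Subgroup G} (hK : K ≠ ⊤) :
    ∃ r, IsReflectionIn ρ r ∧ r ∉ K := by
  by_contra! hc
  exact hK (h.gen K hc)

theorem conj_pow {x y : G} (hx : x ^ 5 = 1) (hx1 : x ≠ 1) (hy : y ^ 5 = 1) (hy1 : y ≠ 1) :
    ∃ (u : G) (j : ℕ), u * y * u⁻¹ = x ^ j :=
  exists_conj_eq_pow (m := 432) h.card (by norm_num) hx hx1 hy hy1

omit [Fintype G] in
theorem mem_center_iff {z : G} : z ∈ Subgroup.center G ↔ ∃ c : ℂ, ρ z = c • 1 := by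
  constructor
  · intro hz
    exact exists_eq_smul_one_of_commute ρ h.irr fun g => by
      rw [← map_mul, ← map_mul, (Subgroup.mem_center_iff.1 hz g)]
  · rintro ⟨c, hc⟩
    refine Subgroup.mem_center_iff.2 fun g => h.inj ?_
    rw [map_mul, map_mul, hc]; simp

omit [Fintype G] in
theorem mem_center_of_fixed {z : G} (hz : z ∈ Subgroup.center G) {v : Fin 3 → ℂ} (hv : v ≠ 0)
    (hzv : ρ z *ᵥ v = v) : z = 1 := by
  obtain ⟨c, hc⟩ := h.mem_center_iff.1 hz
  rw [hc, smul_mulVec, one_mulVec] at hzv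
  have hc1 : c = 1 := by
    by_contra hne
    have : (c - 1) • v = 0 := by rw [sub_smul, one_smul, hzv, sub_self]
    exact hv ((smul_eq_zero.1 this).resolve_left (sub_ne_zero.2 hne))
  exact h.inj (by rw [hc, hc1, one_smul, map_one])

omit h [Fintype G] in
theorem exists_fixed_of_reflection {r : G} (hr : IsReflectionIn ρ r) :
    ∃ v : Fin 3 → ℂ, v ≠ 0 ∧ ρ r *ᵥ v = v := by
  have : LinearMap.ker (toLin' (ρ r - 1)) ≠ ⊥ := by
    intro hb
    have := hr.2
    rw [hb, finrank_bot] at this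
    norm_num at this
  obtain ⟨v, hv, hv0⟩ := (Submodule.ne_bot_iff _).1 this
  refine ⟨v, hv0, ?_⟩
  rwa [LinearMap.mem_ker, toLin'_apply, sub_mulVec, one_mulVec, sub_eq_zero] at hv

omit h [Fintype G] in
theorem pow_mulVec_eq {r : G} {v : Fin 3 → ℂ} (hv : ρ r *ᵥ v = v) (n : ℕ) :
    ρ (r ^ n) *ᵥ v = v := by
  induction n with
  | zero => simp
  | succ n ih => rw [pow_succ, map_mul, ← mulVec_mulVec, hv, ih]

theorem notMem_center_of_pow_five {g : G} (hg : g ^ 5 = 1) (hg1 : g ≠ 1) :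
    g ∉ Subgroup.center G := by
  intro hc
  obtain ⟨c, hc'⟩ := h.mem_center_iff.1 hc
  have hc5 : c ^ 5 = 1 := by
    have : ρ (g ^ 5) = 1 := by rw [hg, map_one]
    rw [_root_.map_pow, hc', smul_pow, one_pow] at this
    have := congrFun (congrFun this 0) 0
    simpa using this
  have hc1 : c ≠ 1 := fun hc1 => hg1 (h.inj (by rw [hc', hc1, one_smul, map_one]))
  let f : G →* ℂ := (powMonoidHom 432).comp (Matrix.detMonoidHom.comp ρ)
  have hf : ∀ x, f x = (ρ x).det ^ 432 := fun x => rfl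
  have hK : f.ker ≠ ⊤ := by
    intro htop
    have : g ∈ f.ker := htop ▸ Subgroup.mem_top g
    rw [MonoidHom.mem_ker, hf, hc', det_smul, det_one, Fintype.card_fin] at this
    apply hc1
    calc c = (c ^ 5) ^ 259 * c := by rw [hc5]; simp
      _ = (c ^ 3 * 1) ^ 432 := by ring
      _ = 1 := this
  obtain ⟨r, hr, hrK⟩ := h.exists_reflection_notMem hK
  have hy : (r ^ 432) ^ 5 = 1 := by rw [← pow_mul]; exact h.pow_eq_one r
  have hy1 : r ^ 432 ≠ 1 := by
    intro h1
    apply hrK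
    rw [MonoidHom.mem_ker, hf, ← det_pow, ← _root_.map_pow, h1, map_one, det_one]
  obtain ⟨u, j, huj⟩ := h.conj_pow hg hg1 hy hy1
  have hgj : g ^ j ∈ Subgroup.center G := Subgroup.pow_mem _ hc j
  have hyc : r ^ 432 = g ^ j := by
    have := Subgroup.mem_center_iff.1 hgj u⁻¹
    rw [← huj] at this ⊢
    calc r ^ 432 = u⁻¹ * (u * r ^ 432 * u⁻¹) * u := by group
      _ = u * r ^ 432 * u⁻¹ * u⁻¹ * u := by rw [this]
      _ = _ := by group
  obtain ⟨v, hv0, hv⟩ := exists_fixed_of_reflection hr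
  exact hy1 (h.mem_center_of_fixed (hyc ▸ hgj) hv0 (pow_mulVec_eq hv 432))

theorem exists_conj_ne {g : G} (hg : g ^ 5 = 1) (hg1 : g ≠ 1) :
    ∃ (n : G) (k : ℕ), n * g * n⁻¹ = g ^ k ∧ n * g * n⁻¹ ≠ g := by
  by_contra! hc
  refine h.notMem_center_of_pow_five hg hg1 (Subgroup.mem_center_iff.2 fun x => ?_)
  exact mul_comm_of_normalizer_le_centralizer ρ h.inj h.card dvd_rfl hg hg1 hc x

omit h [Fintype G] in
theorem conj_pow_eq {g n : G} {k : ℕ} (hn : n * g * n⁻¹ = g ^ k) (j : ℕ) :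
    n * g ^ j * n⁻¹ = g ^ (k * j) := by
  rw [← _root_.conj_pow, hn, pow_mul]

/-- Values of the character on an element of order five. -/
theorem trace_of_pow_five {g : G} (hg : g ^ 5 = 1) (hg1 : g ≠ 1) :
    (ρ g).det = 1 ∧ (∃ n, n * g * n⁻¹ = g⁻¹) ∧
      (∀ (w : G) (k : ℕ), w * g * w⁻¹ = g ^ k → w * g * w⁻¹ = g ∨ w * g * w⁻¹ = g⁻¹) ∧
      (ρ g).trace ^ 2 = (ρ g).trace + 1 ∧ (ρ (g ^ 2)).trace = 1 - (ρ g).trace ∧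
      (ρ g⁻¹).trace = (ρ g).trace := by
  have hmod : ∀ k : ℕ, g ^ k = g ^ (k % 5) := fun k => pow_eq_pow_mod k hg
  have hinv : g⁻¹ = g ^ 4 := by
    rw [inv_eq_iff_mul_eq_one, ← pow_succ', hg]
  have h3 : (ρ g).trace ≠ 3 := fun h3 => hg1 (eq_one_of_trace_map ρ h.inj h3)
  obtain ⟨n, k, hn, hne⟩ := h.exists_conj_ne hg hg1
  have hcases : ∀ (w : G) (k : ℕ), w * g * w⁻¹ = g ^ k → w * g * w⁻¹ = g ∨
      w * g * w⁻¹ = g ^ 4 ∨ w * g * w⁻¹ = g ^ 2 ∨ w * g * w⁻¹ = g ^ 3 := by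
    intro w k hw
    rw [hmod] at hw
    have : k % 5 < 5 := Nat.mod_lt _ (by norm_num)
    interval_cases hk : k % 5
    · rw [pow_zero] at hw
      exact absurd (conj_eq_one_iff.1 hw) hg1
    · left; rwa [pow_one] at hw
    · tauto
    · tauto
    · tauto
  have hdet5 : (ρ g).det ^ 5 = 1 := by rw [← det_pow, ← _root_.map_pow, hg, map_one, det_one]
  have hdetc : ∀ (w : G) (k : ℕ), w * g * w⁻¹ = g ^ k → (ρ g).det = (ρ g).det ^ k := by
    intro w k hw
    rw [← det_pow, ← _root_.map_pow, ← hw, map_mul, map_mul,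
      det_conj_of_mul_eq_one (map_mul_map_inv ρ w) (map_inv_mul_map ρ w)]
  have hdet0 : (ρ g).det ≠ 0 := fun h0 => by rw [h0] at hdet5; norm_num at hdet5
  have hdet : (ρ g).det = 1 := by
    rcases hcases n k hn with h1 | h1 | h1 | h1
    · exact absurd h1 hne
    · have e := hdetc _ _ h1
      have h2 : (ρ g).det ^ 2 = 1 := by linear_combination hdet5 + (ρ g).det * e
      linear_combination e + ((ρ g).det ^ 2 + 1) * h2
    · have e := hdetc _ _ h1
      linear_combination hdet5 + (1 + (ρ g).det + (ρ g).det ^ 2 + (ρ g).det ^ 3) * e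
    · have e := hdetc _ _ h1
      linear_combination hdet5 + (1 + (ρ g).det ^ 2) * e
  have hsq : ∀ x : G, (ρ x).det = 1 →
      (ρ (x ^ 2)).trace = (ρ x).trace ^ 2 - 2 * (ρ x⁻¹).trace := fun x hx => by
    rw [pow_two, map_mul, trace_sq_add _ _ hx (map_mul_map_inv ρ x)]
  have hnot : (ρ (g ^ 2)).trace = (ρ g).trace → (ρ g⁻¹).trace = (ρ g).trace → False := by
    intro h2 hi
    have e := hsq g hdet
    rw [h2, hi] at e
    have h0 : (ρ g).trace = 0 :=
      (mul_eq_zero.1 (show (ρ g).trace * ((ρ g).trace - 3) = 0 by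
        linear_combination -e)).resolve_right
        (sub_ne_zero.2 h3)
    have hA := pow_three_of_det_eq_one _ _ hdet (map_mul_map_inv ρ g)
    rw [hi, h0, zero_smul, zero_smul, sub_zero, zero_add, ← _root_.map_pow] at hA
    have hg3 : g ^ 3 = 1 := h.inj (by rw [hA, map_one])
    apply hg1
    calc g = (g ^ 3) ^ 2 * (g ^ 5)⁻¹ := by group
      _ = 1 := by rw [hg3, hg]; simp
  have hpow : ∀ (w : G) (i j : ℕ), w * g ^ i * w⁻¹ = g ^ j →
      (ρ (g ^ j)).trace = (ρ (g ^ i)).trace := fun w i j hw => by rw [← hw, trace_map_conj]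
  have h23 : ∀ w : G, w * g * w⁻¹ = g ^ 2 ∨ w * g * w⁻¹ = g ^ 3 → False := by
    rintro w (hw | hw)
    · have e1 := hpow w 1 2 (by rw [pow_one, hw])
      have e2 := hpow w 2 4 (by rw [conj_pow_eq hw])
      rw [pow_one] at e1
      exact hnot e1 (by rw [hinv, e2, e1])
    · have e1 := hpow w 1 3 (by rw [pow_one, hw])
      have e2 := hpow w 3 4 (by rw [conj_pow_eq hw, hmod])
      have e3 := hpow w 4 2 (by rw [conj_pow_eq hw, hmod])
      rw [pow_one] at e1
      exact hnot (by rw [e3, e2, e1]) (by rw [hinv, e2, e1])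
  have hdich : ∀ (w : G) (k : ℕ), w * g * w⁻¹ = g ^ k → w * g * w⁻¹ = g ∨ w * g * w⁻¹ = g⁻¹ := by
    intro w k hw
    rw [hinv]
    rcases hcases w k hw with h1 | h1 | h1 | h1
    · exact Or.inl h1
    · exact Or.inr h1
    · exact (h23 w (Or.inl h1)).elim
    · exact (h23 w (Or.inr h1)).elim
  have hninv : n * g * n⁻¹ = g⁻¹ := (hdich n k hn).resolve_left hne
  have ht4 : (ρ g⁻¹).trace = (ρ g).trace := by rw [← hninv, trace_map_conj]
  have e1 := hsq g hdet
  have e2 := hsq (g ^ 2) (by rw [_root_.map_pow, det_pow, hdet, one_pow])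
  have e3 : (ρ (g ^ 2)⁻¹).trace = (ρ (g ^ 2)).trace := by
    rw [← trace_map_conj ρ n (g ^ 2), ← _root_.conj_pow, hninv, inv_pow]
  have e4 : (ρ ((g ^ 2) ^ 2)).trace = (ρ g).trace := by
    rw [← pow_mul, ← ht4, hinv]
  rw [ht4] at e1
  rw [e3, e4] at e2
  have hne2 : (ρ g).trace - (ρ (g ^ 2)).trace ≠ 0 := fun h0 =>
    hnot (sub_eq_zero.1 h0).symm ht4
  have hsum : (ρ g).trace + (ρ (g ^ 2)).trace - 1 = 0 := by
    apply (mul_eq_zero.1 _).resolve_left hne2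
    linear_combination e2 - e1
  refine ⟨hdet, ⟨n, hninv⟩, hdich, ?_, ?_, ht4⟩
  · linear_combination -e1 + hsum
  · linear_combination hsum

theorem exists_conj_ne_pow {g : G} (hg : g ^ 5 = 1) (hg1 : g ≠ 1) :
    ∃ w : G, ∀ k : ℕ, w * g * w⁻¹ ≠ g ^ k := by
  obtain ⟨hdet, ⟨n, hn⟩, -, -, -, ht⟩ := h.trace_of_pow_five hg hg1
  by_contra! hc
  obtain ⟨v, hv0, hv⟩ : ∃ v : Fin 3 → ℂ, v ≠ 0 ∧ ρ g *ᵥ v = v :=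
    exists_fixed_vector (by rw [det_sub_one_eq _ _ hdet (map_mul_map_inv ρ g), ht]; ring)
  let U : Submodule ℂ (Fin 3 → ℂ) :=
    { carrier := {v | ρ g *ᵥ v = v}
      add_mem' := fun {a b} ha hb => by
        rw [Set.mem_ofPred_eq] at *; rw [mulVec_add, ha, hb]
      zero_mem' := mulVec_zero _
      smul_mem' := fun c v hv => by
        rw [Set.mem_ofPred_eq] at *; rw [mulVec_smul, hv] }
  have hU : ∀ v, v ∈ U ↔ ρ g *ᵥ v = v := fun v => Iff.rfl
  rcases h.irr U (fun w u hu => by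
    obtain ⟨k, hk⟩ := hc w⁻¹
    rw [hU] at hu ⊢
    have : g * w = w * g ^ k := by rw [← hk]; group
    rw [mulVec_mulVec, ← map_mul, this, map_mul, ← mulVec_mulVec, pow_mulVec_eq hu k]) with hb | ht
  · exact hv0 ((Submodule.mem_bot ℂ).1 (hb ▸ (hU v).2 hv))
  · apply hg1
    apply h.inj
    rw [map_one]
    apply Matrix.toLin'.injective
    apply LinearMap.ext
    intro u
    rw [toLin'_apply, toLin'_apply, one_mulVec]
    exact (hU u).1 (ht ▸ Submodule.mem_top)

omit [Fintype G] in
theorem exists_card_eq_five_mul {g : G} (hg : g ^ 5 = 1) (hg1 : g ≠ 1) {M : Subgroup G}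
    (hgM : g ∈ M) : ∃ m, Nat.card M = 5 * m ∧ m ∣ 432 := by
  have : Fact (Nat.Prime 5) := ⟨by norm_num⟩
  have h5 : 5 ∣ Nat.card M := by
    rw [← orderOf_eq_prime hg hg1, ← Subgroup.orderOf_mk g hgM]
    exact orderOf_dvd_natCard _
  obtain ⟨m, hm⟩ := h5
  have hm2 := M.card_subgroup_dvd_card
  rw [hm, h.card] at hm2
  exact ⟨m, hm, Nat.dvd_of_mul_dvd_mul_left (by norm_num) (hm2 : 5 * m ∣ 5 * 432)⟩

/-- If an element of order five is central in a subgroup, it generates the Sylow subgroup there. -/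
theorem eq_pow_of_central {g : G} (hg : g ^ 5 = 1) (hg1 : g ≠ 1) {M : Subgroup G} (hgM : g ∈ M)
    (hc : ∀ x ∈ M, x * g = g * x) {y : G} (hy : y ∈ M) (hy5 : y ^ 5 = 1) : ∃ j : ℕ, y = g ^ j := by
  by_cases hy1 : y = 1
  · exact ⟨0, by rw [hy1, pow_zero]⟩
  obtain ⟨m, hm, hm3⟩ := h.exists_card_eq_five_mul hg hg1 hgM
  obtain ⟨u, j, hu⟩ := exists_conj_eq_pow (M := M) (x := ⟨g, hgM⟩) (y := ⟨y, hy⟩) hm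
    (fun h5 => by have := h5.trans hm3; norm_num at this) (Subtype.ext hg)
    (fun h => hg1 (congrArg Subtype.val h)) (Subtype.ext hy5)
    (fun h => hy1 (congrArg Subtype.val h))
  have hu' : (u : G) * y * (u : G)⁻¹ = g ^ j := congrArg Subtype.val hu
  refine ⟨j, ?_⟩
  have hcu : Commute (u : G) (g ^ j) := (show Commute (u : G) g from hc u u.2).pow_right j
  calc y = (u : G)⁻¹ * ((u : G) * y * (u : G)⁻¹) * u := by group
    _ = (u : G)⁻¹ * (u * g ^ j) := by rw [hu', mul_assoc, hcu.eq]
    _ = g ^ j := by group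

/-- A subgroup containing all elements of order five inverts each of them. -/
theorem exists_mem_conj_eq_inv {M : Subgroup G} (hM : ∀ x : G, x ^ 5 = 1 → x ∈ M) {g : G}
    (hg : g ^ 5 = 1) (hg1 : g ≠ 1) : ∃ n ∈ M, n * g * n⁻¹ = g⁻¹ := by
  obtain ⟨-, -, hdich, -⟩ := h.trace_of_pow_five hg hg1
  by_contra! hc
  obtain ⟨m, hm, hm3⟩ := h.exists_card_eq_five_mul hg hg1 (hM g hg)
  have hcen := mul_comm_of_normalizer_le_centralizer (ρ.comp M.subtype)
    (h.inj.comp M.subtype_injective) hm hm3 (g := ⟨g, hM g hg⟩) (Subtype.ext hg)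
    (fun h => hg1 (congrArg Subtype.val h)) (fun n k hn => Subtype.ext
      ((hdich n k (congrArg Subtype.val hn)).resolve_right (hc n n.2)))
  obtain ⟨w, hw⟩ := h.exists_conj_ne_pow hg hg1
  have hw5 : (w * g * w⁻¹) ^ 5 = 1 := by rw [_root_.conj_pow, hg]; group
  obtain ⟨j, hj⟩ := h.eq_pow_of_central hg hg1 (hM g hg)
    (fun x hx => congrArg Subtype.val (hcen ⟨x, hx⟩)) (hM _ hw5) hw5
  exact hw j hj

/-- The size of the class of an element of order five. -/
theorem card_conjFinset_cases {g : G} (hg : g ^ 5 = 1) (hg1 : g ≠ 1) :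
    ((conjFinset g).filter fun x => g * x * g⁻¹ = x) = {g, g⁻¹} ∧
    ((conjFinset g).card = 12 ∨ (conjFinset g).card = 72 ∨ (conjFinset g).card = 432) := by
  obtain ⟨-, ⟨n, hn⟩, hdich, -⟩ := h.trace_of_pow_five hg hg1
  have hfive : ∀ x ∈ conjFinset g, x ^ 5 = 1 ∧ x ≠ 1 := by
    intro x hx
    obtain ⟨w, rfl⟩ := mem_conjFinset.1 hx
    exact ⟨by rw [_root_.conj_pow, hg]; group, fun h1 => hg1 (conj_eq_one_iff.1 h1)⟩
  have hgi : ∀ x : G, x ^ 5 = 1 → x ≠ 1 → x⁻¹ ≠ x := by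
    intro x hx hx1 hi
    have h2 : x ^ 2 = 1 := by rw [pow_two]; nth_rw 1 [← hi]; group
    apply hx1
    calc x = x ^ 5 * ((x ^ 2) ^ 2)⁻¹ := by group
      _ = 1 := by rw [hx, h2]; simp
  have hF : ((conjFinset g).filter fun x => g * x * g⁻¹ = x) = {g, g⁻¹} := by
    ext x
    rw [Finset.mem_filter, Finset.mem_insert, Finset.mem_singleton]
    constructor
    · rintro ⟨hx, hc⟩
      obtain ⟨j, hj⟩ := h.eq_pow_of_central (M := Subgroup.centralizer {g}) hg hg1
        (Subgroup.mem_centralizer_singleton_iff.2 rfl)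
        (fun y hy => Subgroup.mem_centralizer_singleton_iff.1 hy)
        (Subgroup.mem_centralizer_singleton_iff.2 (mul_inv_eq_iff_eq_mul.1 hc).symm) (hfive x hx).1
      obtain ⟨w, rfl⟩ := mem_conjFinset.1 hx
      exact hdich w j hj
    · rintro (rfl | rfl)
      · exact ⟨mem_conjFinset.2 ⟨1, by group⟩, by group⟩
      · exact ⟨mem_conjFinset.2 ⟨n, hn⟩, by group⟩
  refine ⟨hF, ?_⟩
  have : Fact (Nat.Prime 5) := ⟨by norm_num⟩
  have hmod := card_modEq_card_commute (p := 5) hg (conjFinset g)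
    (fun x hx => conj_mem_conjFinset g x hx)
  rw [hF, Finset.card_pair (hgi g hg hg1).symm] at hmod
  have hdvd : (conjFinset g).card ∣ 432 := by
    have h1 := card_conjFinset_mul g
    have hgC : g ∈ Subgroup.centralizer ({g} : Set G) :=
      Subgroup.mem_centralizer_singleton_iff.2 rfl
    obtain ⟨m, hm, -⟩ := h.exists_card_eq_five_mul hg hg1 hgC
    rw [hm, h.card] at h1
    exact ⟨m, by linarith⟩
  have heven : ((conjFinset g).card : ZMod 2) = 0 := by
    have := Finset.sum_involution (s := conjFinset g) (f := fun _ => (1 : ZMod 2))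
      (fun x _ => x⁻¹) (fun _ _ => by decide) (fun x hx _ => hgi x (hfive x hx).1 (hfive x hx).2)
      (fun x hx => by
        obtain ⟨w, rfl⟩ := mem_conjFinset.1 hx
        refine mem_conjFinset.2 ⟨w * n, ?_⟩
        calc w * n * g * (w * n)⁻¹ = w * (n * g * n⁻¹) * w⁻¹ := by group
          _ = _ := by rw [hn]; group)
      (fun x _ => inv_inv x)
    simpa using this
  rw [ZMod.natCast_eq_zero_iff] at heven
  have hne2 : (conjFinset g).card ≠ 2 := by
    intro h2
    obtain ⟨w, hw⟩ := h.exists_conj_ne_pow hg hg1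
    have hfull : ((conjFinset g).filter fun x => g * x * g⁻¹ = x) = conjFinset g :=
      Finset.eq_of_subset_of_card_le (Finset.filter_subset _ _) (by
        rw [hF, h2, Finset.card_pair (hgi g hg hg1).symm])
    have hm : w * g * w⁻¹ ∈ conjFinset g := mem_conjFinset.2 ⟨w, rfl⟩
    rw [← hfull, hF, Finset.mem_insert, Finset.mem_singleton] at hm
    rcases hm with hm | hm
    · exact hw 1 (by rw [hm, pow_one])
    · refine hw 4 (by rw [hm, inv_eq_iff_mul_eq_one, ← pow_succ', hg])
  have hmem : (conjFinset g).card ∈ Nat.divisors 432 := Nat.mem_divisors.2 ⟨hdvd, by norm_num⟩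
  have hall : ∀ t ∈ Nat.divisors 432, t % 5 = 2 → t % 2 = 0 → t ≠ 2 →
      t = 12 ∨ t = 72 ∨ t = 432 := by
    decide +kernel
  exact hall _ hmem hmod (Nat.mod_eq_zero_of_dvd heven) hne2

end IsReflectionRep

end Reflection

namespace Matrix

theorem exists_eq_conj_diagonal_of_commute {P Q : Matrix (Fin 3) (Fin 3) ℂ} (hPQ : P * Q = 1)
    (hQP : Q * P = 1) {d : Fin 3 → ℂ} (hd : Function.Injective d) {B : Matrix (Fin 3) (Fin 3) ℂ}
    (hB : B * (P * diagonal d * Q) = P * diagonal d * Q * B) :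
    ∃ e : Fin 3 → ℂ, B = P * diagonal e * Q := by
  set E := Q * B * P with hE
  have hBE : B = P * E * Q := by
    calc B = (P * Q) * B * (P * Q) := by rw [hPQ, one_mul, mul_one]
      _ = _ := by rw [hE]; simp only [mul_assoc]
  have hc : E * diagonal d = diagonal d * E := by
    calc E * diagonal d = Q * B * P * diagonal d * (Q * P) := by rw [hQP, mul_one]
      _ = Q * (B * (P * diagonal d * Q)) * P := by simp only [mul_assoc]
      _ = (Q * P) * diagonal d * (Q * B * P) := by rw [hB]; simp only [mul_assoc]
      _ = _ := by rw [hQP, one_mul]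
  refine ⟨fun i => E i i, ?_⟩
  have hdiag : E = diagonal fun i => E i i := by
    ext p q
    by_cases hpq : p = q
    · rw [hpq, diagonal_apply_eq]
    rw [diagonal_apply_ne _ hpq]
    have := congrFun (congrFun hc p) q
    rw [mul_diagonal, diagonal_mul] at this
    have h0 : (d q - d p) * E p q = 0 := by linear_combination this
    exact (mul_eq_zero.1 h0).resolve_left (sub_ne_zero.2 fun h => hpq (hd h).symm)
  rw [← hdiag, ← hBE]

/-- The spectrum of an element of order five. -/
theorem exists_eigenvalue_labelling {d : Fin 3 → ℂ} {α : ℂ} (h5 : ∀ i, d i ^ 5 = 1)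
    (h3 : d 0 * d 1 * d 2 = 1) (h1 : d 0 + d 1 + d 2 = α)
    (h2 : d 0 * d 1 + d 0 * d 2 + d 1 * d 2 = α) (hα : α ≠ 3) :
    ∃ i j k : Fin 3, (∀ f : Fin 3 → ℂ, ∑ p, f p = f i + f j + f k) ∧
      (∀ p, p = i ∨ p = j ∨ p = k) ∧ d i = 1 ∧ d j * d k = 1 ∧ d j + d k = α - 1 ∧
      Function.Injective d := by
  have key : ∀ x y : ℂ, x ^ 5 = 1 → x * y = 1 → x + y = α - 1 → x ≠ 1 ∧ y ≠ 1 ∧ x ≠ y := by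
    intro x y hx hxy hs
    have hx1 : x ≠ 1 := by
      rintro rfl
      exact hα (by linear_combination -hs + hxy)
    refine ⟨hx1, ?_, ?_⟩
    · rintro rfl
      exact hx1 (by linear_combination hxy)
    · rintro rfl
      exact hx1 (by linear_combination hx - (x ^ 3 + x) * hxy)
  have hz : (d 0 - 1) * ((d 1 - 1) * (d 2 - 1)) = 0 := by linear_combination h3 + h1 - h2
  have hinj : ∀ i j k : Fin 3, (∀ p, p = i ∨ p = j ∨ p = k) → d i = 1 → d j ≠ 1 → d k ≠ 1 →
      d j ≠ d k → Function.Injective d := by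
    intro i j k hp hi hj hk hjk p q hpq
    rcases hp p with rfl | rfl | rfl <;> rcases hp q with rfl | rfl | rfl <;>
      first | rfl | (exfalso; simp_all)
  rcases mul_eq_zero.1 hz with h0 | h0
  · have e : d 0 = 1 := sub_eq_zero.1 h0
    have a1 : d 1 * d 2 = 1 := by rw [e] at h3; linear_combination h3
    have a2 : d 1 + d 2 = α - 1 := by rw [e] at h1; linear_combination h1
    obtain ⟨b1, b2, b3⟩ := key _ _ (h5 1) a1 a2
    have hp : ∀ p : Fin 3, p = 0 ∨ p = 1 ∨ p = 2 := by decide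
    exact ⟨0, 1, 2, fun f => by rw [Fin.sum_univ_three], hp, e, a1, a2, hinj _ _ _ hp e b1 b2 b3⟩
  rcases mul_eq_zero.1 h0 with h0 | h0
  · have e : d 1 = 1 := sub_eq_zero.1 h0
    have a1 : d 0 * d 2 = 1 := by rw [e] at h3; linear_combination h3
    have a2 : d 0 + d 2 = α - 1 := by rw [e] at h1; linear_combination h1
    obtain ⟨b1, b2, b3⟩ := key _ _ (h5 0) a1 a2
    have hp : ∀ p : Fin 3, p = 1 ∨ p = 0 ∨ p = 2 := by decide
    exact ⟨1, 0, 2, fun f => by rw [Fin.sum_univ_three]; ring, hp, e, a1, a2,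
      hinj _ _ _ hp e b1 b2 b3⟩
  · have e : d 2 = 1 := sub_eq_zero.1 h0
    have a1 : d 0 * d 1 = 1 := by rw [e] at h3; linear_combination h3
    have a2 : d 0 + d 1 = α - 1 := by rw [e] at h1; linear_combination h1
    obtain ⟨b1, b2, b3⟩ := key _ _ (h5 0) a1 a2
    have hp : ∀ p : Fin 3, p = 2 ∨ p = 0 ∨ p = 1 := by decide
    exact ⟨2, 0, 1, fun f => by rw [Fin.sum_univ_three]; ring, hp, e, a1, a2,
      hinj _ _ _ hp e b1 b2 b3⟩

end Matrix

namespace IsReflectionRep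

variable {G : Type*} [Group G] [Fintype G]
variable {ρ : G →* Matrix (Fin 3) (Fin 3) ℂ} (h : IsReflectionRep ρ)
include h

/-- A congruence modulo five for the character on the centralizer of an element of order five. -/
theorem exists_trace_congr {g : G} (hg : g ^ 5 = 1) (hg1 : g ≠ 1) {x : G} (hx : x * g = g * x) :
    ∃ r : ℂ, IsIntegral ℤ r ∧
      (ρ (x * g)).trace + (ρ (x * g⁻¹)).trace + (ρ g).trace * (ρ x).trace = 5 * r := by
  have : Fact (Nat.Prime 5) := ⟨by norm_num⟩
  obtain ⟨hF, hcard⟩ := h.card_conjFinset_cases hg hg1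
  have hgi : g ≠ g⁻¹ := by
    intro hi
    have h2 : g ^ 2 = 1 := by rw [pow_two]; nth_rw 1 [hi]; group
    apply hg1
    calc g = g ^ 5 * ((g ^ 2) ^ 2)⁻¹ := by group
      _ = 1 := by rw [hg, h2]; simp
  obtain ⟨q, hq⟩ : ∃ q : ℤ, ((conjFinset g).card : ℂ) = 3 * (5 * (q : ℂ) - 1) := by
    rcases hcard with hc | hc | hc <;> rw [hc]
    · exact ⟨1, by norm_num⟩
    · exact ⟨5, by norm_num⟩
    · exact ⟨29, by norm_num⟩
  have hsum := sum_trace_mul_eq ρ h.irr (conjFinset g) (fun w y hy => conj_mem_conjFinset w y hy) x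
  have hconst : ∑ y ∈ conjFinset g, (ρ y).trace = (conjFinset g).card * (ρ g).trace := by
    rw [Finset.sum_congr rfl (g := fun _ => (ρ g).trace), Finset.sum_const, nsmul_eq_mul]
    intro y hy
    obtain ⟨w, rfl⟩ := mem_conjFinset.1 hy
    exact trace_map_conj ρ w g
  rw [hconst, ← Finset.sum_mul, hq] at hsum
  let F : G → integralClosure ℤ ℂ := fun y => ⟨(ρ (x * y)).trace, isIntegral_trace ρ _⟩
  obtain ⟨r, hr⟩ := exists_sum_eq_sum_commute_add (p := 5) hg (conjFinset g)
    (fun y hy => conj_mem_conjFinset g y hy) F (fun y _ => Subtype.ext (by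
      change (ρ (x * (g * y * g⁻¹))).trace = (ρ (x * y)).trace
      rw [← trace_map_conj ρ g (x * y)]
      congr 2
      rw [← mul_assoc, ← mul_assoc, hx, mul_assoc g x y]))
  rw [hF, Finset.sum_pair hgi] at hr
  have hr' := congrArg (fun z : integralClosure ℤ ℂ => (z : ℂ)) hr
  simp only [F] at hr'
  push_cast at hr'
  rw [show ((5 : integralClosure ℤ ℂ) : ℂ) = 5 from map_ofNat (integralClosure ℤ ℂ).val 5] at hr'
  refine ⟨q * (ρ g).trace * (ρ x).trace - r, ?_, ?_⟩
  · exact ((isIntegral_algebraMap (x := q)).mul (isIntegral_trace ρ g)).mul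
      (isIntegral_trace ρ x) |>.sub r.2
  · linear_combination -hr' + (1 / 3) * hsum

/-- The fifth power of an element commuting with an element of order five is scalar. -/
theorem pow_five_mem_center {g : G} (hg : g ^ 5 = 1) (hg1 : g ≠ 1) {x : G} (hx : x * g = g * x) :
    x ^ 5 ∈ Subgroup.center G := by
  obtain ⟨hdet, -, -, hα, -, hti⟩ := h.trace_of_pow_five hg hg1
  have h3 : (ρ g).trace ≠ 3 := fun h3 => hg1 (eq_one_of_trace_map ρ h.inj h3)
  set α := (ρ g).trace with hαdef
  obtain ⟨P, Q, d, hPQ, hQP, hA, hd5⟩ := exists_diagonal_of_pow_eq_one (A := ρ g) (n := 5)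
    (by norm_num) (by rw [← _root_.map_pow, hg, map_one])
  have hAd := hdet
  rw [hA, det_conj_of_mul_eq_one hPQ hQP, det_diagonal, Fin.prod_univ_three] at hAd
  have hd1 : ∑ i, d i = α := by rw [hαdef, hA, trace_conj_of_mul_eq_one hQP, trace_diagonal]
  have hAinv : ρ g⁻¹ = P * diagonal (fun i => d i ^ 4) * Q := by
    rw [← diagonal_pow_conj hQP hPQ, ← hA, ← _root_.map_pow]
    congr 1
    rw [inv_eq_iff_mul_eq_one, ← pow_succ', hg]
  have hd2 : ∑ i, d i ^ 4 = α := by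
    rw [← hti, hAinv, trace_conj_of_mul_eq_one hQP, trace_diagonal]
  have hd2' : d 0 * d 1 + d 0 * d 2 + d 1 * d 2 = α := by
    rw [← hd2, Fin.sum_univ_three]
    linear_combination (d 0 ^ 4 + d 1 ^ 4 + d 2 ^ 4) * hAd - d 1 * d 2 * hd5 0 - d 0 * d 2 * hd5 1
      - d 0 * d 1 * hd5 2
  obtain ⟨i, j, k, hsum, hall, hi, hjk, hjk', hinj⟩ := exists_eigenvalue_labelling hd5 hAd
    (by rw [← hd1, Fin.sum_univ_three]) hd2' h3
  obtain ⟨e, he⟩ := exists_eq_conj_diagonal_of_commute hPQ hQP hinj (B := ρ x)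
    (by rw [← hA, ← map_mul, hx, map_mul])
  have hd4 : d j ^ 4 = d k ∧ d k ^ 4 = d j := by
    constructor
    · linear_combination d k * hd5 j - d j ^ 4 * hjk
    · linear_combination d j * hd5 k - d k ^ 4 * hjk
  have hs0 : 2 * α - 1 ≠ 0 := by
    intro h0
    have : (5 : ℂ) = 0 := by linear_combination (2 * α - 1) * h0 - 4 * hα
    norm_num at this
  have hcongr : ∀ y : G, ∀ f : Fin 3 → ℂ, ρ y = P * diagonal f * Q → y * g = g * y →
      ∃ r, IsIntegral ℤ r ∧ α * f i + f j + f k = (2 * α - 1) * r := by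
    intro y f hf hy
    obtain ⟨r, hr, hre⟩ := h.exists_trace_congr hg hg1 hy
    refine ⟨r, hr, ?_⟩
    have hmul : ∀ f' : Fin 3 → ℂ, (P * diagonal f * Q * (P * diagonal f' * Q)).trace =
        ∑ p, f p * f' p := by
      intro f'
      have : P * diagonal f * Q * (P * diagonal f' * Q) =
          P * diagonal (fun p => f p * f' p) * Q := by
        rw [← diagonal_mul_diagonal]
        calc _ = P * (diagonal f * (Q * P) * diagonal f') * Q := by simp only [mul_assoc]
          _ = _ := by rw [hQP, mul_one]
      rw [this, trace_conj_of_mul_eq_one hQP, trace_diagonal]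
    rw [map_mul, map_mul, hAinv, ← hαdef, hA, hf, hmul, hmul, trace_conj_of_mul_eq_one hQP,
      trace_diagonal, hsum, hsum, hsum, hi, hd4.1, hd4.2] at hre
    apply mul_left_cancel₀ hs0
    linear_combination hre + (2 * f i - 4 * r) * hα - (f j + f k) * hjk'
  obtain ⟨r₁, hr₁, e1⟩ := hcongr x e he hx
  obtain ⟨r₂, hr₂, e2⟩ := hcongr (x ^ 2) (fun p => e p ^ 2)
    (by rw [_root_.map_pow, he, diagonal_pow_conj hQP hPQ])
    (by
      have : Commute x g := hx
      exact this.pow_left 2)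
  have heq : ∀ p, e p ^ 2160 = 1 := by
    have := h.map_pow x
    rw [he, diagonal_pow_conj hQP hPQ] at this
    intro p
    have h1 : diagonal (fun i => e i ^ 2160) = 1 := by
      calc _ = (Q * P) * diagonal (fun i => e i ^ 2160) * (Q * P) := by rw [hQP, one_mul, mul_one]
        _ = Q * (P * diagonal (fun i => e i ^ 2160) * Q) * P := by simp only [mul_assoc]
        _ = 1 := by rw [this, mul_one, hQP]
    have h2 := congrFun (congrFun h1 p) p
    rwa [diagonal_apply_eq, one_apply_eq] at h2
  obtain ⟨hj, hk⟩ := pow_five_eq_of_trace_congr hα rfl (heq i) (heq j) (heq k) hr₁ hr₂ e1 e2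
  refine h.mem_center_iff.2 ⟨e i ^ 5, ?_⟩
  rw [_root_.map_pow, he, diagonal_pow_conj hQP hPQ]
  have : (fun p => e p ^ 5) = fun _ => e i ^ 5 := by
    funext p
    rcases hall p with rfl | rfl | rfl
    · rfl
    · exact hj
    · exact hk
  rw [this, ← smul_one_eq_diagonal, Matrix.mul_smul, mul_one, Matrix.smul_mul, hPQ]

theorem exists_eq_pow_mul_of_commute {g : G} (hg : g ^ 5 = 1) (hg1 : g ≠ 1) {x : G}
    (hx : x * g = g * x) : ∃ k : ℕ, ∃ z ∈ Subgroup.center G, x = g ^ k * z := by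
  obtain ⟨j, hj⟩ := h.eq_pow_of_central (M := Subgroup.centralizer {g}) hg hg1
    (Subgroup.mem_centralizer_singleton_iff.2 rfl)
    (fun y hy => Subgroup.mem_centralizer_singleton_iff.1 hy) (y := x ^ 432)
    (Subgroup.mem_centralizer_singleton_iff.2 ((show Commute x g from hx).pow_left 432))
    (by rw [← pow_mul]; exact h.pow_eq_one x)
  refine ⟨j * 3, ((x ^ 5) ^ 259)⁻¹, Subgroup.inv_mem _ (Subgroup.pow_mem _
    (h.pow_five_mem_center hg hg1 hx) _), ?_⟩
  rw [pow_mul, ← hj]; group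

theorem card_conjFinset_mul_card_center {g : G} (hg : g ^ 5 = 1) (hg1 : g ≠ 1) :
    (conjFinset g).card * Nat.card (Subgroup.center G) = 432 := by
  obtain ⟨-, ⟨n, hn⟩, -⟩ := h.trace_of_pow_five hg hg1
  have hord : orderOf g = 5 := by
    have : Fact (Nat.Prime 5) := ⟨by norm_num⟩
    exact orderOf_eq_prime hg hg1
  have hcard : Nat.card (Subgroup.centralizer ({g} : Set G)) =
      5 * Nat.card (Subgroup.center G) := by
    have hmem : ∀ (k : ℕ), ∀ z ∈ Subgroup.center G,
        g ^ k * z ∈ Subgroup.centralizer ({g} : Set G) := by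
      intro k z hz
      rw [Subgroup.mem_centralizer_singleton_iff]
      have h1 : Commute (g ^ k) g := (Commute.refl g).pow_left k
      have h2 : Commute z g := (Subgroup.mem_center_iff.1 hz g).symm
      exact h1.mul_left h2
    let f : Fin 5 × Subgroup.center G → Subgroup.centralizer ({g} : Set G) :=
      fun p => ⟨g ^ (p.1 : ℕ) * p.2, hmem p.1 p.2 p.2.2⟩
    have hf : Function.Bijective f := by
      constructor
      · rintro ⟨k, z, hz⟩ ⟨l, y, hy⟩ hkl
        have e : g ^ (k : ℕ) * z = g ^ (l : ℕ) * y := congrArg Subtype.val hkl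
        have hconj : ∀ (m : ℕ), ∀ t ∈ Subgroup.center G,
            n * (g ^ m * t) * n⁻¹ = (g ^ m)⁻¹ * t := by
          intro m t ht
          calc n * (g ^ m * t) * n⁻¹ = n * g ^ m * (t * n⁻¹) := by group
            _ = (n * g ^ m * n⁻¹) * t := by rw [← Subgroup.mem_center_iff.1 ht]; group
            _ = _ := by rw [← _root_.conj_pow, hn, inv_pow]
        have e' : (g ^ (k : ℕ))⁻¹ * z = (g ^ (l : ℕ))⁻¹ * y := by
          rw [← hconj _ z hz, ← hconj _ y hy, e]
        have e2 : g ^ (2 * (k : ℕ)) = g ^ (2 * (l : ℕ)) := by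
          calc g ^ (2 * (k : ℕ)) = (g ^ (k : ℕ) * z) * ((g ^ (k : ℕ))⁻¹ * z)⁻¹ := by group
            _ = _ := by rw [e, e']; group
        rw [pow_inj_mod, hord] at e2
        have hkl' : k = l := by apply Fin.ext; omega
        subst hkl'
        simpa using mul_left_cancel e
      · rintro ⟨x, hx⟩
        obtain ⟨k, z, hz, e⟩ := h.exists_eq_pow_mul_of_commute hg hg1
          (Subgroup.mem_centralizer_singleton_iff.1 hx)
        refine ⟨(⟨k % 5, Nat.mod_lt _ (by norm_num)⟩, ⟨z, hz⟩), Subtype.ext ?_⟩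
        change g ^ (k % 5) * z = x
        rw [e, ← pow_eq_pow_mod k hg]
    rw [← Nat.card_congr (Equiv.ofBijective f hf), Nat.card_prod, Nat.card_fin]
  have := card_conjFinset_mul g
  rw [hcard, h.card] at this
  linarith

theorem exists_eq_mul_center {M : Subgroup G} (hM : ∀ x : G, x ^ 5 = 1 → x ∈ M) (w : G) :
    ∃ m ∈ M, ∃ z ∈ Subgroup.center G, w = m * z := by
  have : Fact (Nat.Prime 5) := ⟨by norm_num⟩
  obtain ⟨g, hgord⟩ := exists_prime_orderOf_dvd_card (G := G) 5 (by rw [h.fintypeCard]; norm_num)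
  have hg : g ^ 5 = 1 := hgord ▸ pow_orderOf_eq_one g
  have hg1 : g ≠ 1 := by
    rintro rfl
    rw [orderOf_one] at hgord
    norm_num at hgord
  obtain ⟨-, -, hdich, -⟩ := h.trace_of_pow_five hg hg1
  obtain ⟨n, hnM, hn⟩ := h.exists_mem_conj_eq_inv hM hg hg1
  have hw5 : (w * g * w⁻¹) ^ 5 = 1 := by rw [_root_.conj_pow, hg]; group
  obtain ⟨m, hm, hm3⟩ := h.exists_card_eq_five_mul hg hg1 (hM g hg)
  obtain ⟨u, j, hu⟩ := exists_conj_eq_pow (M := M) (x := ⟨g, hM g hg⟩) (y := ⟨_, hM _ hw5⟩) hm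
    (fun h5 => by have := h5.trans hm3; norm_num at this) (Subtype.ext hg)
    (fun h => hg1 (congrArg Subtype.val h)) (Subtype.ext hw5)
    (fun h => hg1 (conj_eq_one_iff.1 (congrArg Subtype.val h)))
  have hu' : (u * w : G) * g * (u * w : G)⁻¹ = g ^ j := by
    have := congrArg Subtype.val hu
    calc (u * w : G) * g * (u * w : G)⁻¹ = u * (w * g * w⁻¹) * (u : G)⁻¹ := by group
      _ = _ := this
  obtain ⟨m, hmM, hm⟩ : ∃ m ∈ M, (m * w) * g * (m * w)⁻¹ = g := by
    rcases hdich _ j hu' with h1 | h1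
    · exact ⟨u, u.2, h1⟩
    · refine ⟨n * u, M.mul_mem hnM u.2, ?_⟩
      calc n * u * w * g * (n * u * w)⁻¹ = n * (u * w * g * (u * w)⁻¹) * n⁻¹ := by group
        _ = (n * g * n⁻¹)⁻¹ := by rw [h1]; group
        _ = g := by rw [hn, inv_inv]
  obtain ⟨k, z, hz, e⟩ := h.exists_eq_pow_mul_of_commute hg hg1 (mul_inv_eq_iff_eq_mul.1 hm)
  exact ⟨m⁻¹ * g ^ k, M.mul_mem (M.inv_mem hmM) (M.pow_mem (hM g hg) k), z, hz, by
    rw [mul_assoc, ← e]; group⟩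

end IsReflectionRep

/-- A group with a cyclic Sylow `2`-subgroup has a subgroup containing all elements of odd order
but no generator of the Sylow subgroup. -/
theorem exists_subgroup_of_orderOf_eq_two_pow {M : Type*} [Group M] [Finite M] {k m : ℕ}
    (hm : ¬ 2 ∣ m) (hM : Nat.card M = 2 ^ (k + 1) * m) {t : M} (ht : orderOf t = 2 ^ (k + 1)) :
    ∃ K : Subgroup M, t ∉ K ∧ ∀ x : M, ∀ j : ℕ, ¬ 2 ∣ j → x ^ j = 1 → x ∈ K := by
  have : Fact (Nat.Prime 2) := ⟨Nat.prime_two⟩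
  have hm0 : m ≠ 0 := fun h => hm (h ▸ dvd_zero 2)
  have hfac : (Nat.card M).factorization 2 = k + 1 := by
    rw [hM, Nat.factorization_mul (by positivity) hm0, Finsupp.add_apply,
      Nat.factorization_eq_zero_of_not_dvd hm, Nat.Prime.factorization_pow Nat.prime_two]
    simp
  let P : Sylow 2 M := Sylow.ofCard (Subgroup.zpowers t) (by rw [Nat.card_zpowers, ht, hfac])
  have hPdef : (P : Subgroup M) = Subgroup.zpowers t := rfl
  have hcyc : IsCyclic P := by
    rw [hPdef]; infer_instance
  have hmin : (Nat.card M).minFac = 2 :=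
    (Nat.minFac_eq_two_iff _).2 (hM ▸ (dvd_pow_self 2 (Nat.succ_ne_zero k)).mul_right m)
  have hP := IsCyclic.normalizer_le_centralizer hmin hcyc
  set K := (MonoidHom.transferSylow P hP).ker with hKdef
  have hcompl : K.IsComplement' P := MonoidHom.ker_transferSylow_isComplement' P hP
  refine ⟨K, fun htK => ?_, fun x j hj hx => ?_⟩
  · have h1 : t ∈ K ⊓ (P : Subgroup M) := ⟨htK, hPdef ▸ Subgroup.mem_zpowers t⟩
    rw [disjoint_iff.1 hcompl.disjoint, Subgroup.mem_bot] at h1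
    rw [h1, orderOf_one] at ht
    exact absurd ht (Nat.one_lt_two_pow (Nat.succ_ne_zero k)).ne
  · rw [hKdef, MonoidHom.mem_ker]
    set y := MonoidHom.transferSylow P hP x
    have h1 : y ^ j = 1 := by rw [← map_pow, hx, map_one]
    have h2 : y ^ 2 ^ (k + 1) = 1 := by
      have hc : Nat.card P = 2 ^ (k + 1) := by
        rw [hPdef, Nat.card_zpowers, ht]
      rw [← hc, pow_card_eq_one']
    have hco : Nat.Coprime j (2 ^ (k + 1)) :=
      Nat.Coprime.pow_right _ (((Nat.prime_two.coprime_iff_not_dvd).2 hj).symm)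
    rw [← orderOf_eq_one_iff]
    exact Nat.eq_one_of_dvd_coprimes hco (orderOf_dvd_of_pow_eq_one h1)
      (orderOf_dvd_of_pow_eq_one h2)

namespace IsReflectionRep

variable {G : Type*} [Group G] [Fintype G]
variable {ρ : G →* Matrix (Fin 3) (Fin 3) ℂ} (h : IsReflectionRep ρ)
include h

theorem exists_pow_five : ∃ g : G, g ^ 5 = 1 ∧ g ≠ 1 := by
  have : Fact (Nat.Prime 5) := ⟨by norm_num⟩
  obtain ⟨g, hgord⟩ := exists_prime_orderOf_dvd_card (G := G) 5 (by rw [h.fintypeCard]; norm_num)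
  refine ⟨g, hgord ▸ pow_orderOf_eq_one g, ?_⟩
  rintro rfl
  rw [orderOf_one] at hgord
  norm_num at hgord

theorem exists_scalar {ζ : ℂ} (hζ : ζ ^ Nat.card (Subgroup.center G) = 1) :
    ∃ z ∈ Subgroup.center G, ρ z = ζ • 1 := by
  choose c hc using fun z : Subgroup.center G => h.mem_center_iff.1 z.2
  set N := Nat.card (Subgroup.center G) with hN
  have hN0 : N ≠ 0 := Nat.card_pos.ne'
  have hinj : Function.Injective c := fun x y hxy =>
    Subtype.ext (h.inj (by rw [hc, hc, hxy]))
  have hpow : ∀ z, c z ^ N = 1 := by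
    intro z
    have h1 : z ^ N = 1 := pow_card_eq_one'
    have h2 : ρ ((z : G) ^ N) = 1 := by
      rw [← SubgroupClass.coe_pow, h1, OneMemClass.coe_one, map_one]
    rw [_root_.map_pow, hc, smul_pow, one_pow] at h2
    have := congrFun (congrFun h2 0) 0
    simpa using this
  have himg : Finset.univ.image c = Polynomial.nthRootsFinset N (1 : ℂ) := by
    apply Finset.eq_of_subset_of_card_le
    · intro x hx
      obtain ⟨z, -, rfl⟩ := Finset.mem_image.1 hx
      exact (Polynomial.mem_nthRootsFinset (Nat.pos_of_ne_zero hN0) _).2 (hpow z)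
    · rw [(Complex.isPrimitiveRoot_exp N hN0).card_nthRootsFinset,
        Finset.card_image_of_injective _ hinj, Finset.card_univ, hN, Nat.card_eq_fintype_card]
  have := (Polynomial.mem_nthRootsFinset (Nat.pos_of_ne_zero hN0) (1 : ℂ)).2 hζ
  rw [← himg] at this
  obtain ⟨z, -, hz⟩ := Finset.mem_image.1 this
  exact ⟨z, z.2, by rw [hc, hz]⟩

omit h in
/-- The subgroup of elements of determinant one. -/
noncomputable def detHom (ρ : G →* Matrix (Fin 3) (Fin 3) ℂ) : G →* ℂˣ :=
  MonoidHom.toHomUnits (Matrix.detMonoidHom.comp ρ)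

omit h [Fintype G] in
theorem coe_detHom (g : G) : (detHom ρ g : ℂ) = (ρ g).det := rfl

omit h [Fintype G] in
theorem mem_ker_detHom {g : G} : g ∈ (detHom ρ).ker ↔ (ρ g).det = 1 := by
  rw [MonoidHom.mem_ker, ← Units.val_inj, coe_detHom, Units.val_one]

theorem pow_five_mem_ker (x : G) (hx : x ^ 5 = 1) : x ∈ (detHom ρ).ker := by
  by_cases hx1 : x = 1
  · rw [hx1]; exact one_mem _
  · exact mem_ker_detHom.2 (h.trace_of_pow_five hx hx1).1

omit h [Fintype G] in
theorem det_of_scalar {z : G} {c : ℂ} (hz : ρ z = c • 1) : (ρ z).det = c ^ 3 := by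
  rw [hz, det_smul, det_one, mul_one, Fintype.card_fin]

omit h [Fintype G] in
theorem scalar_pow {z : G} {c : ℂ} (hz : ρ z = c • 1) {n : ℕ} (hn : z ^ n = 1) : c ^ n = 1 := by
  have h2 : ρ (z ^ n) = 1 := by rw [hn, map_one]
  rw [_root_.map_pow, hz, smul_pow, one_pow] at h2
  have := congrFun (congrFun h2 0) 0
  simpa using this

omit [Fintype G] in
theorem pow_eq_one_of_scalar {z : G} {c : ℂ} (hz : ρ z = c • 1) {n : ℕ} (hn : c ^ n = 1) :
    z ^ n = 1 :=
  h.inj (by rw [_root_.map_pow, hz, smul_pow, one_pow, hn, one_smul, map_one])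

omit h [Fintype G] in
theorem pow_card_center {z : G} (hz : z ∈ Subgroup.center G) :
    z ^ Nat.card (Subgroup.center G) = 1 := by
  have h1 : (⟨z, hz⟩ : Subgroup.center G) ^ Nat.card (Subgroup.center G) = 1 := pow_card_eq_one'
  exact congrArg Subtype.val h1

theorem card_ker_detHom {t : ℕ} (ht : Nat.card (Subgroup.center G) = 3 * t) :
    Nat.card (detHom ρ).ker * t = 2160 := by
  have ht0 : t ≠ 0 := by
    rintro rfl
    exact Nat.card_pos.ne' ht
  have : NeZero t := ⟨ht0⟩
  have hrange : (detHom ρ).range = rootsOfUnity t ℂ := by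
    ext u
    rw [MonoidHom.mem_range, mem_rootsOfUnity']
    constructor
    · rintro ⟨w, rfl⟩
      obtain ⟨s, hs, z, hz, rfl⟩ := h.exists_eq_mul_center h.pow_five_mem_ker w
      obtain ⟨c, hc⟩ := h.mem_center_iff.1 hz
      have := scalar_pow hc (pow_card_center hz)
      rw [coe_detHom, map_mul, det_mul, mem_ker_detHom.1 hs, one_mul, det_of_scalar hc, ← pow_mul,
        ← ht, this]
    · intro hu
      obtain ⟨ξ, hξ⟩ := IsAlgClosed.exists_pow_nat_eq (u : ℂ) (n := 3) (by norm_num)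
      obtain ⟨z, -, hz⟩ := h.exists_scalar (ζ := ξ) (by rw [ht, pow_mul, hξ, hu])
      exact ⟨z, Units.ext (by rw [coe_detHom, det_of_scalar hz, hξ])⟩
  rw [← h.card, ← Subgroup.card_mul_index (detHom ρ).ker, Subgroup.index_ker, hrange,
    Complex.card_rootsOfUnity]

theorem det_ne_one_of_reflection {r : G} (hr : IsReflectionIn ρ r) : (ρ r).det ≠ 1 :=
  (trace_det_of_finrank_fixed_eq_two (n := 2160) (by norm_num) (h.map_pow r) hr.2).1

theorem exists_reflection : ∃ r, IsReflectionIn ρ r := by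
  obtain ⟨g, -, hg1⟩ := h.exists_pow_five
  have : (⊥ : Subgroup G) ≠ ⊤ := fun hb => hg1 (by
    have : g ∈ (⊥ : Subgroup G) := hb ▸ Subgroup.mem_top g
    exact Subgroup.mem_bot.1 this)
  obtain ⟨r, hr, -⟩ := h.exists_reflection_notMem this
  exact ⟨r, hr⟩

theorem card_center_ne_thirty_six : Nat.card (Subgroup.center G) ≠ 36 := by
  intro hZ
  have hS : Nat.card (detHom ρ).ker = 180 := by
    have := h.card_ker_detHom (t := 12) (by rw [hZ])
    omega
  let f : G →* ℂˣ := (powMonoidHom 6).comp (detHom ρ)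
  have hf : ∀ x, (f x : ℂ) = (ρ x).det ^ 6 := fun x => rfl
  obtain ⟨ζ, hζ⟩ := IsAlgClosed.exists_pow_nat_eq (-1 : ℂ) (n := 18) (by norm_num)
  obtain ⟨y, -, hy⟩ := h.exists_scalar (ζ := ζ) (by
    rw [hZ, show 36 = 18 * 2 from rfl, pow_mul, hζ]; norm_num)
  have hK : f.ker ≠ ⊤ := by
    intro htop
    have : y ∈ f.ker := htop ▸ Subgroup.mem_top y
    rw [MonoidHom.mem_ker, ← Units.val_inj, hf, det_of_scalar hy, ← pow_mul, hζ,
      Units.val_one] at this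
    norm_num at this
  obtain ⟨r, hr, hrK⟩ := h.exists_reflection_notMem hK
  obtain ⟨s, hs, z, hz, rfl⟩ := h.exists_eq_mul_center h.pow_five_mem_ker r
  obtain ⟨c, hc⟩ := h.mem_center_iff.1 hz
  have hc36 : c ^ 36 = 1 := scalar_pow hc (hZ ▸ pow_card_center hz)
  have hc18 : c ^ 18 = -1 := by
    have hne : c ^ 18 - 1 ≠ 0 := by
      intro h0
      apply hrK
      rw [MonoidHom.mem_ker, ← Units.val_inj, hf, map_mul, det_mul, mem_ker_detHom.1 hs, one_mul,
        det_of_scalar hc, ← pow_mul, Units.val_one]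
      exact sub_eq_zero.1 h0
    have : (c ^ 18 - 1) * (c ^ 18 + 1) = 0 := by linear_combination hc36
    linear_combination (mul_eq_zero.1 this).resolve_left hne
  set S := (detHom ρ).ker with hSdef
  have hs180 : (⟨s, hs⟩ : S) ^ 180 = 1 := by rw [← hS, pow_card_eq_one']
  have hs90 : s ^ 90 ≠ 1 := by
    intro h1
    obtain ⟨v, hv0, hv⟩ := exists_fixed_of_reflection hr
    have h2 := pow_mulVec_eq hv 90
    have hcomm : Commute s z := Subgroup.mem_center_iff.1 hz s
    rw [hcomm.mul_pow, h1, one_mul, _root_.map_pow, hc, smul_pow, one_pow, smul_mulVec, one_mulVec,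
      show c ^ 90 = -1 by linear_combination (c ^ 72 - c ^ 54 + c ^ 36 - c ^ 18 + 1) * hc18] at h2
    apply hv0
    have : (2 : ℂ) • v = 0 := by
      rw [two_smul]; nth_rw 1 [← h2]; simp
    exact (smul_eq_zero.1 this).resolve_left two_ne_zero
  have hord : orderOf ((⟨s, hs⟩ : S) ^ 45) = 2 ^ (1 + 1) := by
    have : Fact (Nat.Prime 2) := ⟨Nat.prime_two⟩
    refine orderOf_eq_prime_pow ?_ ?_
    · rw [← pow_mul]
      intro h0
      exact hs90 (congrArg Subtype.val h0)
    · rw [← pow_mul, ← hs180]; norm_num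
  obtain ⟨K, htK, hK⟩ := exists_subgroup_of_orderOf_eq_two_pow (M := S) (k := 1) (m := 45)
    (by norm_num) (by rw [hS]; norm_num) hord
  obtain ⟨m, hm, w, hw, e⟩ := h.exists_eq_mul_center (M := K.map S.subtype) (fun x hx =>
    ⟨⟨x, h.pow_five_mem_ker x hx⟩, hK _ 5 (by norm_num) (Subtype.ext hx), rfl⟩) (s ^ 45)
  obtain ⟨m, hmK, rfl⟩ := hm
  obtain ⟨b, hb⟩ := h.mem_center_iff.1 hw
  have hwS : w ∈ S := by
    have : w = (m : G)⁻¹ * s ^ 45 := by rw [e]; simp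
    rw [this]
    exact S.mul_mem (S.inv_mem m.2) (S.pow_mem hs 45)
  have hw3 : w ^ 3 = 1 :=
    h.pow_eq_one_of_scalar hb (by rw [← det_of_scalar hb, mem_ker_detHom.1 hwS])
  apply htK
  have : (⟨s, hs⟩ : S) ^ 45 = m * ⟨w, hwS⟩ := Subtype.ext e
  rw [this]
  exact K.mul_mem hmK (hK _ 3 (by norm_num) (Subtype.ext hw3))

theorem card_center : Nat.card (Subgroup.center G) = 6 := by
  obtain ⟨g, hg, hg1⟩ := h.exists_pow_five
  have hX := h.card_conjFinset_mul_card_center hg hg1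
  rcases (h.card_conjFinset_cases hg hg1).2 with hc | hc | hc
  · exact absurd (by rw [hc] at hX; omega) h.card_center_ne_thirty_six
  · rw [hc] at hX; omega
  · have h1 : Nat.card (Subgroup.center G) = 1 := by rw [hc] at hX; omega
    obtain ⟨r, hr⟩ := h.exists_reflection
    obtain ⟨s, hs, z, hz, rfl⟩ := h.exists_eq_mul_center h.pow_five_mem_ker r
    have hz1 : z = 1 := by
      have := pow_card_center hz
      rwa [h1, pow_one] at this
    rw [hz1, mul_one] at hr
    exact absurd (mem_ker_detHom.1 hs) (h.det_ne_one_of_reflection hr)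

theorem card_detHom_ker : Nat.card (detHom ρ).ker = 1080 := by
  have := h.card_ker_detHom (t := 2) (by rw [h.card_center])
  omega

theorem card_conjFinset {g : G} (hg : g ^ 5 = 1) (hg1 : g ≠ 1) : (conjFinset g).card = 72 := by
  have hX := h.card_conjFinset_mul_card_center hg hg1
  rw [h.card_center] at hX
  omega

theorem card_pow_five : (Finset.univ.filter fun x : G => x ^ 5 = 1 ∧ x ≠ 1).card = 144 := by
  obtain ⟨g, hg, hg1⟩ := h.exists_pow_five
  have hg2 : (g ^ 2) ^ 5 = 1 := by rw [← pow_mul, mul_comm, pow_mul, hg, one_pow]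
  have hg21 : g ^ 2 ≠ 1 := by
    intro h2
    apply hg1
    calc g = g ^ 5 * ((g ^ 2) ^ 2)⁻¹ := by group
      _ = 1 := by rw [hg, h2]; simp
  obtain ⟨-, ⟨n, hn⟩, -, hα, hα2, -⟩ := h.trace_of_pow_five hg hg1
  have hdisj : Disjoint (conjFinset g) (conjFinset (g ^ 2)) := by
    rw [Finset.disjoint_left]
    intro x h1 h2
    obtain ⟨u, rfl⟩ := mem_conjFinset.1 h1
    obtain ⟨w, hw⟩ := mem_conjFinset.1 h2
    have := congrArg (fun y => (ρ y).trace) hw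
    simp only [trace_map_conj] at this
    rw [hα2] at this
    have : (5 : ℂ) = 0 := by linear_combination (2 * (ρ g).trace - 1) * (-this) - 4 * hα
    norm_num at this
  have key : (Finset.univ.filter fun x : G => x ^ 5 = 1 ∧ x ≠ 1) =
      conjFinset g ∪ conjFinset (g ^ 2) := by
    ext x
    rw [Finset.mem_filter, Finset.mem_union]
    constructor
    · rintro ⟨-, hx, hx1⟩
      obtain ⟨u, j, hu⟩ := h.conj_pow hg hg1 hx hx1
      have hu' : x = u⁻¹ * g ^ j * u := by rw [← hu]; group
      rw [pow_eq_pow_mod j hg] at hu'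
      have : j % 5 < 5 := Nat.mod_lt _ (by norm_num)
      have h5 : n * g ^ 4 * n⁻¹ = g := by
        rw [← _root_.conj_pow, hn]
        calc g⁻¹ ^ 4 = g * (g ^ 5)⁻¹ := by group
          _ = g := by rw [hg]; simp
      have h3 : n * g ^ 3 * n⁻¹ = g ^ 2 := by
        rw [← _root_.conj_pow, hn]
        calc g⁻¹ ^ 3 = g ^ 2 * (g ^ 5)⁻¹ := by group
          _ = g ^ 2 := by rw [hg]; simp
      interval_cases j % 5
      · exact absurd (by rw [hu']; group) hx1
      · left; exact mem_conjFinset.2 ⟨u⁻¹, by rw [hu']; group⟩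
      · right; exact mem_conjFinset.2 ⟨u⁻¹, by rw [hu']; group⟩
      · right; exact mem_conjFinset.2 ⟨u⁻¹ * n⁻¹, by
          rw [hu', ← h3]; group⟩
      · left; exact mem_conjFinset.2 ⟨u⁻¹ * n⁻¹, by
          rw [hu']; nth_rw 1 [← h5]; group⟩
    · rintro (hx | hx) <;> obtain ⟨u, rfl⟩ := mem_conjFinset.1 hx
      · exact ⟨Finset.mem_univ _, by rw [_root_.conj_pow, hg]; group,
          fun h1 => hg1 (conj_eq_one_iff.1 h1)⟩
      · exact ⟨Finset.mem_univ _, by rw [_root_.conj_pow, hg2]; group,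
          fun h1 => hg21 (conj_eq_one_iff.1 h1)⟩
  rw [key, Finset.card_union_of_disjoint hdisj, h.card_conjFinset hg hg1,
    h.card_conjFinset hg2 hg21]

end IsReflectionRep

/-- The properties of the unimodular subgroup of `G₂₇`, a triple cover of the alternating group of
degree six, from which the lattice of its reflection arrangement is computed. -/
structure IsValentinerRep {M : Type*} [Group M] [Fintype M]
    (ρ : M →* Matrix (Fin 3) (Fin 3) ℂ) : Prop where
  card : Nat.card M = 1080
  inj : Function.Injective ρ
  irr : ∀ U : Submodule ℂ (Fin 3 → ℂ), (∀ g, ∀ v ∈ U, ρ g *ᵥ v ∈ U) → U = ⊥ ∨ U = ⊤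
  det : ∀ x, (ρ x).det = 1
  scalar : ∃ (z : M) (ω : ℂ), ω ^ 2 + ω + 1 = 0 ∧ ρ z = ω • 1
  conj_inv : ∀ g : M, g ^ 5 = 1 → g ≠ 1 → ∃ n, n * g * n⁻¹ = g⁻¹
  trace_sq : ∀ g : M, g ^ 5 = 1 → g ≠ 1 → (ρ g).trace ^ 2 = (ρ g).trace + 1
  trace_pow_two : ∀ g : M, g ^ 5 = 1 → g ≠ 1 → (ρ (g ^ 2)).trace = 1 - (ρ g).trace
  commute : ∀ g : M, g ^ 5 = 1 → g ≠ 1 → ∀ x, x * g = g * x →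
    ∃ k : ℕ, ∃ z ∈ Subgroup.center M, x = g ^ k * z
  card_pow_five : (Finset.univ.filter fun x : M => x ^ 5 = 1 ∧ x ≠ 1).card = 144
  eq_mul_center : ∀ K : Subgroup M, (∀ x : M, x ^ 5 = 1 → x ∈ K) →
    ∀ w, ∃ m ∈ K, ∃ z ∈ Subgroup.center M, w = m * z

namespace IsReflectionRep

variable {G : Type*} [Group G] [Fintype G]
variable {ρ : G →* Matrix (Fin 3) (Fin 3) ℂ} (h : IsReflectionRep ρ)
include h

/-- Every element is, up to sign, of determinant one. -/
theorem exists_eq_or_eq_neg (w : G) : ∃ s : (detHom ρ).ker, ρ w = ρ s ∨ ρ w = -ρ s := by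
  obtain ⟨s, hs, z, hz, rfl⟩ := h.exists_eq_mul_center h.pow_five_mem_ker w
  obtain ⟨c, hc⟩ := h.mem_center_iff.1 hz
  have hc6 : c ^ 6 = 1 := scalar_pow hc (h.card_center ▸ pow_card_center hz)
  have h36 : c ^ 3 = 1 ∨ c ^ 3 = -1 := by
    have : (c ^ 3 - 1) * (c ^ 3 + 1) = 0 := by linear_combination hc6
    rcases mul_eq_zero.1 this with h1 | h1
    · exact Or.inl (by linear_combination h1)
    · exact Or.inr (by linear_combination h1)
  rcases h36 with h1 | h1
  · exact ⟨⟨s * z, mem_ker_detHom.2 (by rw [map_mul, det_mul, mem_ker_detHom.1 hs,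
      det_of_scalar hc, h1, one_mul])⟩, Or.inl rfl⟩
  · obtain ⟨y, -, hy⟩ := h.exists_scalar (ζ := -c) (by
      rw [h.card_center]; linear_combination hc6)
    refine ⟨⟨s * y, mem_ker_detHom.2 ?_⟩, Or.inr ?_⟩
    · rw [map_mul, det_mul, mem_ker_detHom.1 hs, det_of_scalar hy, one_mul]
      linear_combination -h1
    rw [map_mul, map_mul, hc, hy]
    simp

theorem exists_map_eq_neg (w : G) : ∃ x, ρ x = -ρ w := by
  obtain ⟨y, -, hy⟩ := h.exists_scalar (ζ := -1) (by rw [h.card_center]; norm_num)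
  exact ⟨y * w, by rw [map_mul, hy]; simp⟩

theorem isValentinerRep : IsValentinerRep (ρ.comp (detHom ρ).ker.subtype) where
  card := h.card_detHom_ker
  inj := h.inj.comp (Subgroup.subtype_injective _)
  irr U hU := h.irr U fun w v hv => by
    obtain ⟨s, hs | hs⟩ := h.exists_eq_or_eq_neg w
    · rw [hs]; exact hU s v hv
    · rw [hs, neg_mulVec]; exact U.neg_mem (hU s v hv)
  det x := mem_ker_detHom.1 x.2
  scalar := by
    obtain ⟨ω, hω⟩ : ∃ ω : ℂ, ω ^ 2 + ω + 1 = 0 := by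
      obtain ⟨r, hr⟩ := IsAlgClosed.exists_pow_nat_eq (-3 : ℂ) (n := 2) (by norm_num)
      exact ⟨(r - 1) / 2, by linear_combination (1 / 4) * hr⟩
    have hω3 : ω ^ 3 = 1 := by linear_combination (ω - 1) * hω
    obtain ⟨z, -, hz⟩ := h.exists_scalar (ζ := ω) (by
      rw [h.card_center]; linear_combination (ω ^ 3 + 1) * hω3)
    exact ⟨⟨z, mem_ker_detHom.2 (by rw [det_of_scalar hz, hω3])⟩, ω, hω, hz⟩
  conj_inv g hg hg1 := by
    obtain ⟨n, hn, e⟩ := h.exists_mem_conj_eq_inv h.pow_five_mem_ker (g := g)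
      (congrArg Subtype.val hg) fun h1 => hg1 (Subtype.ext h1)
    exact ⟨⟨n, hn⟩, Subtype.ext e⟩
  trace_sq g hg hg1 :=
    (h.trace_of_pow_five (congrArg Subtype.val hg) fun h1 => hg1 (Subtype.ext h1)).2.2.2.1
  trace_pow_two g hg hg1 :=
    (h.trace_of_pow_five (congrArg Subtype.val hg) fun h1 => hg1 (Subtype.ext h1)).2.2.2.2.1
  commute g hg hg1 x hx := by
    obtain ⟨k, z, hz, e⟩ := h.exists_eq_pow_mul_of_commute (congrArg Subtype.val hg)
      (fun h1 => hg1 (Subtype.ext h1)) (congrArg Subtype.val hx)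
    have hzS : z ∈ (detHom ρ).ker := by
      have : z = ((g ^ k)⁻¹ * x : (detHom ρ).ker) := by
        rw [Subgroup.coe_mul, e, Subgroup.coe_inv, Subgroup.coe_pow]; group
      rw [this]; exact Subtype.property _
    exact ⟨k, ⟨z, hzS⟩, Subgroup.mem_center_iff.2 fun y =>
      Subtype.ext (Subgroup.mem_center_iff.1 hz y), Subtype.ext e⟩
  card_pow_five := by
    rw [← h.card_pow_five]
    refine Finset.card_bij (fun x _ => (x : G)) (fun x hx => ?_)
      (fun x _ y _ hxy => Subtype.ext hxy) fun x hx => ?_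
    · simp only [Finset.mem_filter, Finset.mem_univ, true_and] at hx ⊢
      exact ⟨congrArg Subtype.val hx.1, fun h3 => hx.2 (Subtype.ext h3)⟩
    · simp only [Finset.mem_filter, Finset.mem_univ, true_and] at hx
      refine ⟨⟨x, h.pow_five_mem_ker x hx.1⟩, ?_, rfl⟩
      simp only [Finset.mem_filter, Finset.mem_univ, true_and]
      exact ⟨Subtype.ext hx.1, fun h3 => hx.2 (congrArg Subtype.val h3)⟩
  eq_mul_center K hK w := by
    obtain ⟨m, hm, z, hz, e⟩ := h.exists_eq_mul_center (M := K.map (detHom ρ).ker.subtype)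
      (fun x hx => ⟨⟨x, h.pow_five_mem_ker x hx⟩, hK _ (Subtype.ext hx), rfl⟩) w
    obtain ⟨m, hmK, rfl⟩ := hm
    have hzS : z ∈ (detHom ρ).ker := by
      have : z = (m⁻¹ * w : (detHom ρ).ker) := by
        rw [Subgroup.coe_mul, e, Subgroup.coe_inv, Subgroup.subtype_apply]; group
      rw [this]; exact Subtype.property _
    exact ⟨m, hmK, ⟨z, hzS⟩, Subgroup.mem_center_iff.2 fun y =>
      Subtype.ext (Subgroup.mem_center_iff.1 hz y), Subtype.ext e⟩

/-- The reflections are the negatives of the unimodular involutions. -/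
theorem sq_eq_one_of_reflection {r : G} (hr : IsReflectionIn ρ r) :
    ∃ s : (detHom ρ).ker, s ^ 2 = 1 ∧ s ≠ 1 ∧ ρ r = -ρ s := by
  obtain ⟨hdet, htr, hsq⟩ :=
    trace_det_of_finrank_fixed_eq_two (n := 2160) (by norm_num) (h.map_pow r) hr.2
  obtain ⟨s, hs | hs⟩ := h.exists_eq_or_eq_neg r
  · exact absurd (by rw [hs, mem_ker_detHom.1 s.2]) hdet
  have hd : (ρ r).det = -1 := by
    rw [hs, det_neg, mem_ker_detHom.1 s.2, Fintype.card_fin]; norm_num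
  have h2 := hsq hd
  refine ⟨s, Subtype.ext (h.inj ?_), ?_, hs⟩
  · rw [Subgroup.coe_pow, _root_.map_pow, Subgroup.coe_one, map_one, ← h2, hs, neg_sq]
  · rintro rfl
    rw [hd, hs, Subgroup.coe_one, map_one, trace_neg, trace_one, Fintype.card_fin] at htr
    norm_num at htr

omit [Fintype G] in
theorem isReflectionIn_of_sq {s : (detHom ρ).ker} (hs : s ^ 2 = 1) (hs1 : s ≠ 1) {r : G}
    (hr : ρ r = -ρ s) : IsReflectionIn ρ r := by
  have hsq : ρ s ^ 2 = 1 := by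
    rw [← _root_.map_pow, ← Subgroup.coe_pow, hs, Subgroup.coe_one, map_one]
  have ht : (ρ s).trace = -1 := by
    rcases trace_of_sq_eq_one hsq (mem_ker_detHom.1 s.2) with h1 | h1
    · exact absurd (Subtype.ext (h.inj (by rw [h1, Subgroup.coe_one, map_one]))) hs1
    · exact h1
  refine ⟨?_, ?_⟩
  · rintro rfl
    have := congrArg Matrix.trace hr
    rw [map_one, trace_one, Fintype.card_fin, trace_neg, ht] at this
    norm_num at this
  · rw [hr]
    exact finrank_fixed_eq_two_of_sq (by rw [neg_sq, hsq]) (by rw [trace_neg, ht, neg_neg])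

end IsReflectionRep

/-- The involutions of a finite group. -/
noncomputable def involutions (M : Type*) [Group M] [Fintype M] : Finset M :=
  Finset.univ.filter fun x => x ^ 2 = 1 ∧ x ≠ 1

theorem mem_involutions {M : Type*} [Group M] [Fintype M] {x : M} :
    x ∈ involutions M ↔ x ^ 2 = 1 ∧ x ≠ 1 := by
  simp [involutions]

theorem inv_eq_of_pow_two {M : Type*} [Group M] {x : M} (hx : x ^ 2 = 1) : x⁻¹ = x := by
  rw [inv_eq_iff_mul_eq_one, ← pow_two, hx]

theorem conj_mem_involutions {M : Type*} [Group M] [Fintype M] {x : M} (w : M)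
    (hx : x ∈ involutions M) : w * x * w⁻¹ ∈ involutions M := by
  rw [mem_involutions] at *
  exact ⟨by rw [_root_.conj_pow, hx.1]; group, fun h1 => hx.2 (conj_eq_one_iff.1 h1)⟩

namespace IsValentinerRep

variable {M : Type*} [Group M] [Fintype M]
variable {ρ : M →* Matrix (Fin 3) (Fin 3) ℂ} (h : IsValentinerRep ρ)
include h

theorem fintypeCard : Fintype.card M = 1080 := by rw [← Nat.card_eq_fintype_card, h.card]

theorem exists_center_generator : ∃ (z : M) (ω : ℂ), ω ^ 2 + ω + 1 = 0 ∧ ρ z = ω • 1 ∧ z ^ 3 = 1 ∧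
    z ∈ Subgroup.center M ∧ ∀ y ∈ Subgroup.center M, ∃ j < 3, y = z ^ j := by
  obtain ⟨z, ω, hω, hz⟩ := h.scalar
  have hω3 : ω ^ 3 = 1 := by linear_combination (ω - 1) * hω
  refine ⟨z, ω, hω, hz, h.inj (by rw [map_pow, hz, smul_pow, one_pow, hω3, one_smul, map_one]),
    Subgroup.mem_center_iff.2 fun g => h.inj (by rw [map_mul, map_mul, hz]; simp),
    fun y hy => ?_⟩
  obtain ⟨c, hc⟩ := exists_eq_smul_one_of_commute (M := ρ y) ρ h.irr fun g => by
    rw [← map_mul, ← map_mul, (Subgroup.mem_center_iff.1 hy g)]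
  have hc3 : c ^ 3 = 1 := by
    have := h.det y
    rwa [hc, det_smul, det_one, mul_one, Fintype.card_fin] at this
  have hpow : ∀ j : ℕ, c = ω ^ j → y = z ^ j := fun j hj => h.inj (by
    rw [map_pow, hc, hz, smul_pow, one_pow, hj])
  have : (c - 1) * ((c - ω) * (c - ω ^ 2)) = 0 := by
    linear_combination hc3 - hω3 + (-c ^ 2 + c * ω) * hω
  rcases mul_eq_zero.1 this with h1 | h1
  · exact ⟨0, by norm_num, hpow 0 (by linear_combination h1)⟩
  rcases mul_eq_zero.1 h1 with h1 | h1
  · exact ⟨1, by norm_num, hpow 1 (by linear_combination h1)⟩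
  · exact ⟨2, by norm_num, hpow 2 (by linear_combination h1)⟩

theorem pow_three_of_mem_center {z : M} (hz : z ∈ Subgroup.center M) : z ^ 3 = 1 := by
  obtain ⟨z0, ω, -, -, h3, -, hall⟩ := h.exists_center_generator
  obtain ⟨j, -, rfl⟩ := hall z hz
  rw [← pow_mul, mul_comm, pow_mul, h3, one_pow]

theorem trace_of_mem_involutions {x : M} (hx : x ∈ involutions M) : (ρ x).trace = -1 := by
  rw [mem_involutions] at hx
  rcases trace_of_sq_eq_one (A := ρ x) (by rw [← map_pow, hx.1, map_one]) (h.det x) with h1 | h1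
  · exact absurd (h.inj (by rw [h1, map_one])) hx.2
  · exact h1

/-- The group has no nontrivial sign character. -/
theorem hom_eq_one (f : M →* ℤˣ) : f = 1 := by
  ext w
  have hodd : ∀ (x : M) (k : ℕ), x ^ (2 * k + 1) = 1 → f x = 1 := by
    intro x k hx
    have : f x ^ (2 * k + 1) = 1 := by rw [← map_pow, hx, map_one]
    rwa [pow_succ, pow_mul, Int.units_sq, one_pow, one_mul] at this
  obtain ⟨m, hm, z, hz, rfl⟩ := h.eq_mul_center f.ker (fun x hx => hodd x 2 hx) w
  rw [map_mul, MonoidHom.mem_ker.1 hm, hodd z 1 (h.pow_three_of_mem_center hz)]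
  simp

/-- There is an element of order four. -/
theorem exists_orderOf_four : ∃ y : M, y ^ 4 = 1 ∧ y ^ 2 ≠ 1 := by
  have : Fact (Nat.Prime 2) := ⟨Nat.prime_two⟩
  obtain ⟨Q, hQ⟩ := Sylow.exists_subgroup_card_pow_prime (G := M) 2 (n := 3)
    (by rw [h.card]; norm_num)
  have hpow : ∀ x ∈ Q, x ^ 8 = 1 := by
    intro x hx
    have : (⟨x, hx⟩ : Q) ^ Nat.card Q = 1 := pow_card_eq_one'
    rw [hQ] at this
    exact congrArg Subtype.val this
  by_contra! hc
  have h2 : ∀ x ∈ Q, x ^ 2 = 1 := by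
    intro x hx
    refine hc x ?_
    rw [show 4 = 2 * 2 from rfl, pow_mul]
    exact hc (x ^ 2) (by rw [← pow_mul]; exact hpow x hx)
  obtain ⟨m, hm, -⟩ := exists_sum_trace_subgroup ρ Q
  have h1Q : (1 : M) ∈ Finset.univ.filter (· ∈ Q) := by simp [Q.one_mem]
  rw [← Finset.add_sum_erase _ _ h1Q, map_one, trace_one, Fintype.card_fin,
    Finset.sum_congr rfl (g := fun _ => (-1 : ℂ)), Finset.sum_const, Finset.card_erase_of_mem h1Q,
    card_filter_mem_subgroup, hQ] at hm
  · have : (1 : ℂ) = ((-2 * m : ℤ) : ℂ) := by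
      push_cast
      push_cast at hm
      norm_num at hm
      linear_combination (-1 / 4) * hm
    have : (1 : ℤ) = -2 * m := by exact_mod_cast this
    omega
  · intro x hx
    rw [Finset.mem_erase, Finset.mem_filter] at hx
    exact h.trace_of_mem_involutions (mem_involutions.2 ⟨h2 x hx.2.2, hx.1⟩)

theorem isConj_of_mem_involutions {i j : M} (hi : i ∈ involutions M) (hj : j ∈ involutions M) :
    ∃ w, w * i * w⁻¹ = j := by
  obtain ⟨y, hy4, hy2⟩ := h.exists_orderOf_four
  suffices hs : ∀ i ∈ involutions M, ∃ w, w * i * w⁻¹ = y ^ 2 by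
    obtain ⟨u, hu⟩ := hs i hi
    obtain ⟨w, hw⟩ := hs j hj
    refine ⟨w⁻¹ * u, ?_⟩
    calc w⁻¹ * u * i * (w⁻¹ * u)⁻¹ = w⁻¹ * (u * i * u⁻¹) * w := by group
      _ = j := by rw [hu, ← hw]; group
  intro i hi
  by_contra! hc
  rw [mem_involutions] at hi
  have : Fact (Nat.Prime 2) := ⟨Nat.prime_two⟩
  have hord : orderOf y = 2 ^ (1 + 1) := orderOf_eq_prime_pow (by simpa using hy2)
    (by simpa using hy4)
  set H := Subgroup.zpowers y
  let σ := MulAction.toPermHom M (M ⧸ H) i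
  have hσ2 : σ ^ 2 = 1 := by rw [← map_pow, hi.1, map_one]
  have hfix : ∀ q : M ⧸ H, σ q ≠ q := by
    intro q
    induction q using QuotientGroup.induction_on with
    | H g =>
      intro hq
      have hq' : ((i * g : M) : M ⧸ H) = (g : M ⧸ H) := hq
      have hmem : g⁻¹ * (i * g) ∈ H := QuotientGroup.eq.1 hq'.symm
      obtain ⟨n, hn⟩ := (mem_zpowers_iff_mem_range_orderOf.1 hmem : _ ∈ Finset.image _ _) |>
        Finset.mem_image.1
      have hn' : y ^ n = g⁻¹ * i * g⁻¹⁻¹ := by rw [hn.2]; group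
      have hlt := Finset.mem_range.1 hn.1
      rw [hord] at hlt
      have hsq : (y ^ n) ^ 2 = 1 := by rw [hn', _root_.conj_pow, hi.1]; group
      have hne : y ^ n ≠ 1 := by
        rw [hn']; exact fun h1 => hi.2 (conj_eq_one_iff.1 h1)
      norm_num at hlt
      interval_cases n
      · exact hne (pow_zero y)
      · exact hy2 (by simpa using hsq)
      · exact hc _ hn'.symm
      · apply hy2
        calc y ^ 2 = (y ^ 3) ^ 2 * (y ^ 4)⁻¹ := by group
          _ = 1 := by rw [hsq, hy4]; simp
  have hcardq : Fintype.card (M ⧸ H) = 270 := by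
    have := Subgroup.card_mul_index H
    rw [Nat.card_zpowers, hord, h.card] at this
    rw [← Nat.card_eq_fintype_card]
    change H.index = _
    omega
  have hsign : Equiv.Perm.sign σ = 1 := by
    have := h.hom_eq_one (Equiv.Perm.sign.comp (MulAction.toPermHom M (M ⧸ H)))
    exact DFunLike.congr_fun this i
  have h0 : Fintype.card (Function.fixedPoints σ) = 0 :=
    Fintype.card_eq_zero_iff.2 ⟨fun q => hfix q.1 q.2⟩
  rw [Equiv.Perm.sign_of_pow_two_eq_one hσ2, hcardq, h0] at hsign
  exact absurd hsign (by decide)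

/-- Each element of order five is inverted by exactly five involutions. -/
theorem card_inverting {g : M} (hg : g ^ 5 = 1) (hg1 : g ≠ 1) :
    ((involutions M).filter fun e => e * g * e⁻¹ = g⁻¹).card = 5 := by
  have hord : orderOf g = 5 := by
    have : Fact (Nat.Prime 5) := ⟨by norm_num⟩
    exact orderOf_eq_prime hg hg1
  obtain ⟨n, hn⟩ := h.conj_inv g hg hg1
  have hn2 : n ^ 2 * g = g * n ^ 2 := by
    calc n ^ 2 * g = n * (n * g * n⁻¹) * n⁻¹ * n ^ 2 := by simp only [pow_two]; group
      _ = (n * g * n⁻¹)⁻¹ * n ^ 2 := by rw [hn, ← _root_.conj_inv, hn]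
      _ = g * n ^ 2 := by rw [hn, inv_inv]
  obtain ⟨k, z, hz, e⟩ := h.commute g hg hg1 _ hn2
  have hk1 : g ^ k = 1 := by
    have h1 : n * (g ^ k * z) * n⁻¹ = (g ^ k)⁻¹ * z := by
      calc n * (g ^ k * z) * n⁻¹ = n * g ^ k * (z * n⁻¹) := by group
        _ = (n * g ^ k * n⁻¹) * z := by rw [← Subgroup.mem_center_iff.1 hz]; group
        _ = _ := by rw [← _root_.conj_pow, hn, inv_pow]
    have h2 : n * (g ^ k * z) * n⁻¹ = g ^ k * z := by rw [← e]; group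
    have h3 : g ^ (k * 2) = 1 := by
      have h4 := mul_right_cancel (h1.symm.trans h2)
      rw [inv_eq_iff_mul_eq_one, ← pow_two, ← pow_mul] at h4
      exact h4
    have h5 := orderOf_dvd_of_pow_eq_one h3
    rw [hord] at h5
    rw [← orderOf_dvd_iff_pow_eq_one, hord]
    exact (Nat.Coprime.dvd_of_dvd_mul_right (by norm_num) h5)
  rw [hk1, one_mul] at e
  have he2 : (n ^ 3) ^ 2 = 1 := by
    rw [← pow_mul, mul_comm, pow_mul, e, h.pow_three_of_mem_center hz]
  have heg : n ^ 3 * g * (n ^ 3)⁻¹ = g⁻¹ := by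
    calc n ^ 3 * g * (n ^ 3)⁻¹ = n * (n ^ 2 * g) * (n ^ 2)⁻¹ * n⁻¹ := by group
      _ = n * g * n⁻¹ := by rw [hn2]; group
      _ = _ := hn
  set e0 := n ^ 3
  have hcom : ∀ k : ℕ, e0 * g ^ k * e0 = (g ^ k)⁻¹ := by
    intro k
    nth_rw 2 [← inv_eq_of_pow_two he2]
    rw [← _root_.conj_pow, heg, inv_pow]
  have hgi : g⁻¹ ≠ g := by
    intro hi
    have h2 : g ^ 2 = 1 := by rw [pow_two]; nth_rw 1 [← hi]; group
    rw [← orderOf_dvd_iff_pow_eq_one, hord] at h2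
    norm_num at h2
  have himg : ((involutions M).filter fun e => e * g * e⁻¹ = g⁻¹) =
      (Finset.range 5).image fun k => e0 * g ^ k := by
    ext e
    rw [Finset.mem_filter, mem_involutions, Finset.mem_image]
    constructor
    · rintro ⟨⟨h2, -⟩, hc⟩
      have hcg : e0 * e * g = g * (e0 * e) := by
        calc e0 * e * g = e0 * (e * g * e⁻¹) * e := by group
          _ = (e0 * g * e0⁻¹)⁻¹ * (e0 * e) := by rw [hc]; group
          _ = _ := by rw [heg, inv_inv]
      obtain ⟨k, y, hy, e'⟩ := h.commute g hg hg1 _ hcg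
      have he : e = e0 * g ^ k * y := by
        calc e = e0⁻¹ * (e0 * e) := by group
          _ = _ := by rw [e', inv_eq_of_pow_two he2, mul_assoc]
      have hy2 : y ^ 2 = 1 := by
        have hcy : Commute (e0 * g ^ k) y := Subgroup.mem_center_iff.1 hy _
        have h1 : (e0 * g ^ k) ^ 2 = 1 := by
          rw [pow_two, ← mul_assoc, hcom]; group
        rw [← h2, he, hcy.mul_pow, h1, one_mul]
      have hy1 : y = 1 := by
        calc y = y ^ 3 * (y ^ 2)⁻¹ := by group
          _ = 1 := by rw [hy2, h.pow_three_of_mem_center hy]; simp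
      refine ⟨k % 5, Finset.mem_range.2 (Nat.mod_lt _ (by norm_num)), ?_⟩
      rw [he, hy1, mul_one, ← pow_eq_pow_mod k hg]
    · rintro ⟨k, -, rfl⟩
      have hc : e0 * g ^ k * g * (e0 * g ^ k)⁻¹ = g⁻¹ := by
        calc e0 * g ^ k * g * (e0 * g ^ k)⁻¹ = e0 * g * e0⁻¹ := by group
          _ = _ := heg
      refine ⟨⟨?_, fun h1 => hgi ?_⟩, hc⟩
      · rw [pow_two, ← mul_assoc, hcom]; group
      · rw [h1] at hc
        simpa using hc.symm
  rw [himg, Finset.card_image_of_injOn, Finset.card_range]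
  intro i hi j hj hij
  have := mul_left_cancel hij
  rw [pow_inj_mod, hord] at this
  rw [Finset.mem_coe, Finset.mem_range] at hi hj
  omega

theorem exists_orderOf_four_sq {i : M} (hi : i ∈ involutions M) :
    ∃ y : M, y ^ 4 = 1 ∧ y ^ 2 = i := by
  obtain ⟨y, hy4, hy2⟩ := h.exists_orderOf_four
  obtain ⟨w, rfl⟩ := h.isConj_of_mem_involutions (i := y ^ 2) (j := i)
    (mem_involutions.2 ⟨by rw [← pow_mul, ← hy4], hy2⟩) hi
  exact ⟨w * y * w⁻¹, by rw [_root_.conj_pow, hy4]; group, by rw [_root_.conj_pow]⟩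

theorem exists_subgroup_card_eight {i : M} (hi : i ∈ involutions M) :
    ∃ Q : Subgroup M, Nat.card Q = 8 ∧ i ∈ Q ∧ Q ≤ Subgroup.centralizer {i} := by
  have : Fact (Nat.Prime 2) := ⟨Nat.prime_two⟩
  obtain ⟨Q, hQ⟩ := Sylow.exists_subgroup_card_pow_prime (G := M) 2 (n := 3)
    (by rw [h.card]; norm_num)
  have hp : IsPGroup 2 Q := IsPGroup.of_card hQ
  have : Nontrivial Q := by
    rw [← Finite.one_lt_card_iff_nontrivial, hQ]; norm_num
  have hnt := hp.center_nontrivial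
  obtain ⟨c, hc⟩ := exists_prime_orderOf_dvd_card' (G := Subgroup.center Q) 2
    ((hp.to_subgroup _).card_eq_or_dvd.resolve_left Finite.one_lt_card.ne')
  have hc2 : ((c : Q) : M) ^ 2 = 1 := by
    have := pow_orderOf_eq_one c
    rw [hc] at this
    exact congrArg (fun x : Subgroup.center Q => ((x : Q) : M)) this
  have hc1 : ((c : Q) : M) ≠ 1 := by
    intro h1
    have : c = 1 := Subtype.ext (Subtype.ext h1)
    rw [this, orderOf_one] at hc
    norm_num at hc
  obtain ⟨w, hw⟩ := h.isConj_of_mem_involutions (mem_involutions.2 ⟨hc2, hc1⟩) hi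
  refine ⟨Q.map (MulAut.conj w).toMonoidHom, ?_, ⟨c, Subtype.property _, hw⟩, ?_⟩
  · exact (Nat.card_congr (Q.equivMapOfInjective _ (MulAut.conj w).injective).toEquiv).symm.trans
      (by rw [hQ]; norm_num)
  · rintro _ ⟨x, hx, rfl⟩
    rw [Subgroup.mem_centralizer_singleton_iff, ← hw]
    have hcx : x * (c : Q) = (c : Q) * x :=
      congrArg Subtype.val (Subgroup.mem_center_iff.1 c.2 ⟨x, hx⟩)
    change w * x * w⁻¹ * (w * (c : Q) * w⁻¹) = w * (c : Q) * w⁻¹ * (w * x * w⁻¹)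
    calc _ = w * (x * (c : Q)) * w⁻¹ := by group
      _ = _ := by rw [hcx]; group

theorem conjFinset_eq_involutions {i : M} (hi : i ∈ involutions M) :
    conjFinset i = involutions M := by
  ext x
  rw [mem_conjFinset]
  constructor
  · rintro ⟨w, rfl⟩; exact conj_mem_involutions w hi
  · intro hx; exact h.isConj_of_mem_involutions hi hx

theorem nonempty_involutions : (involutions M).Nonempty := by
  obtain ⟨y, hy4, hy2⟩ := h.exists_orderOf_four
  exact ⟨y ^ 2, mem_involutions.2 ⟨by rw [← pow_mul, ← hy4], hy2⟩⟩

theorem card_involutions : (involutions M).card = 45 := by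
  obtain ⟨i, hi⟩ := h.nonempty_involutions
  set k := (involutions M).card with hk
  set O := Finset.univ.filter fun x : M => x ^ 5 = 1 ∧ x ≠ 1 with hO
  have hmemO : ∀ x, x ∈ O ↔ x ^ 5 = 1 ∧ x ≠ 1 := fun x => by simp [hO]
  let r : M → M → Prop := fun e g => e * g * e⁻¹ = g⁻¹
  have hdouble := Finset.sum_card_bipartiteAbove_eq_sum_card_bipartiteBelow
    (s := involutions M) (t := O) r
  have hright : ∑ g ∈ O, ((involutions M).bipartiteBelow r g).card = 720 := by
    rw [Finset.sum_congr rfl (g := fun _ => 5), Finset.sum_const, hO, h.card_pow_five]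
    · rfl
    · intro g hg
      exact h.card_inverting ((hmemO g).1 hg).1 ((hmemO g).1 hg).2
  have hconst : ∀ e ∈ involutions M, (O.bipartiteAbove r e).card = (O.bipartiteAbove r i).card := by
    intro e he
    obtain ⟨w, rfl⟩ := h.isConj_of_mem_involutions hi he
    have hmem : ∀ (u e g : M), g ∈ O.bipartiteAbove r e →
        u * g * u⁻¹ ∈ O.bipartiteAbove r (u * e * u⁻¹) := by
      intro u e g hg
      simp only [Finset.mem_bipartiteAbove, hmemO, r] at hg ⊢
      refine ⟨⟨by rw [_root_.conj_pow, hg.1.1]; group, fun h1 => hg.1.2 (conj_eq_one_iff.1 h1)⟩, ?_⟩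
      calc _ = u * (e * g * e⁻¹) * u⁻¹ := by group
        _ = _ := by rw [hg.2]; group
    refine Finset.card_bij' (fun g _ => w⁻¹ * g * w) (fun g _ => w * g * w⁻¹) (fun g hg => ?_)
      (fun g hg => hmem w i g hg) (fun g _ => by group) (fun g _ => by group)
    have := hmem w⁻¹ _ g hg
    rwa [inv_inv, show w⁻¹ * (w * i * w⁻¹) * w = i by group] at this
  rw [hright, Finset.sum_congr rfl hconst, Finset.sum_const, smul_eq_mul, ← hk] at hdouble
  have hle : (O.bipartiteAbove r i).card ≤ k := by
    refine Finset.card_le_card_of_injOn (fun g => i * g) (fun g hg => ?_)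
      (fun x _ y _ hxy => mul_left_cancel hxy)
    rw [Finset.mem_coe, Finset.mem_bipartiteAbove, hmemO] at hg
    rw [Finset.mem_coe, mem_involutions]
    rw [mem_involutions] at hi
    obtain ⟨⟨h5, h1⟩, hr⟩ := hg
    have hr' : i * g * i = g⁻¹ := by
      nth_rw 2 [← inv_eq_of_pow_two hi.1]; exact hr
    refine ⟨by rw [pow_two, ← mul_assoc, hr']; group, fun h0 => h1 ?_⟩
    have hgi : g = i := by
      rw [mul_eq_one_iff_inv_eq, inv_eq_of_pow_two hi.1] at h0; exact h0.symm
    calc g = g ^ 5 * ((g ^ 2) ^ 2)⁻¹ := by group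
      _ = 1 := by rw [h5, hgi, hi.1]; simp
  have h8 : k ∣ 135 := by
    have h1 := card_conjFinset_mul i
    rw [h.conjFinset_eq_involutions hi, h.card, ← hk] at h1
    obtain ⟨Q, hQ, -, hQc⟩ := h.exists_subgroup_card_eight hi
    obtain ⟨c, hc⟩ := Subgroup.card_dvd_of_le hQc
    rw [hc, hQ] at h1
    exact ⟨c, by linarith⟩
  have h45 : k ∣ 45 := by
    have := Nat.dvd_gcd h8 ⟨_, hdouble.symm⟩
    exact this.trans (by norm_num)
  have hsq : 720 ≤ k * k := hdouble ▸ Nat.mul_le_mul_left k hle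
  have hk45 := Nat.le_of_dvd (by norm_num) h45
  interval_cases k <;> omega

theorem card_centralizer {i : M} (hi : i ∈ involutions M) :
    Nat.card (Subgroup.centralizer ({i} : Set M)) = 24 := by
  have h1 := card_conjFinset_mul i
  rw [h.conjFinset_eq_involutions hi, h.card, h.card_involutions] at h1
  omega

end IsValentinerRep

namespace IsValentinerRep

variable {M : Type*} [Group M] [Fintype M]
variable {ρ : M →* Matrix (Fin 3) (Fin 3) ℂ} (h : IsValentinerRep ρ)
include h

theorem card_center : Nat.card (Subgroup.center M) = 3 := by
  obtain ⟨z, ω, hω, hz, hz3, hzc, hall⟩ := h.exists_center_generator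
  have hz1 : z ≠ 1 := by
    rintro rfl
    have h1 := congrFun (congrFun hz 0) 0
    simp at h1
    rw [← h1] at hω
    norm_num at hω
  have : Fact (Nat.Prime 3) := ⟨Nat.prime_three⟩
  have hord := orderOf_eq_prime hz3 hz1
  have : Subgroup.center M = Subgroup.zpowers z := by
    refine le_antisymm (fun y hy => ?_) (Subgroup.zpowers_le.2 hzc)
    obtain ⟨j, -, rfl⟩ := hall y hy
    exact Subgroup.pow_mem _ (Subgroup.mem_zpowers z) j
  rw [this, Nat.card_zpowers, hord]

theorem pow_eight_mem_center {i x : M} (hi : i ∈ involutions M) (hx : x * i = i * x) :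
    x ^ 8 ∈ Subgroup.center M := by
  set C := Subgroup.centralizer ({i} : Set M)
  have hle : Subgroup.center M ≤ C := Subgroup.center_le_centralizer _
  set N := (Subgroup.center M).subgroupOf C
  have hN : N.Normal := Subgroup.normal_subgroupOf
  have hidx : N.index = 8 := by
    have h1 := Subgroup.card_mul_index N
    rw [h.card_centralizer hi, Nat.card_congr (Subgroup.subgroupOfEquivOfLe hle).toEquiv,
      h.card_center] at h1
    omega
  have h2 := Subgroup.pow_index_mem N (⟨x, Subgroup.mem_centralizer_singleton_iff.2 hx⟩ : C)
  rw [hidx] at h2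
  exact Subgroup.mem_subgroupOf.1 h2

/-- The trace of an element of order four has absolute value at least one. -/
theorem normSq_trace_of_pow_four {x : M} (h4 : x ^ 4 = 1) (h2 : x ^ 2 ≠ 1) :
    1 ≤ Complex.normSq (ρ x).trace ∧ (Complex.normSq (ρ x).trace = 1 → (ρ x).trace = 1) := by
  have h1 := trace_sq_add (ρ x) (ρ x⁻¹) (h.det x) (map_mul_map_inv ρ x)
  rw [← map_mul, ← pow_two, trace_map_inv, h.trace_of_mem_involutions (mem_involutions.2
    ⟨by rw [← pow_mul, ← h4], h2⟩)] at h1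
  set t := (ρ x).trace
  have hre := congrArg Complex.re h1
  have him := congrArg Complex.im h1
  simp [pow_two] at hre him
  have him' : t.im * (t.re + 1) = 0 := by linarith
  rw [Complex.normSq_apply]
  rcases mul_eq_zero.1 him' with h0 | h0
  · rw [h0] at hre
    have hr : t.re = 1 := by nlinarith [sq_nonneg (t.re - 1)]
    exact ⟨by rw [hr, h0]; norm_num, fun _ => Complex.ext hr h0⟩
  · have hr : t.re = -1 := by linarith
    rw [hr] at hre
    have : t.im * t.im = 4 := by linarith
    rw [hr, this]
    norm_num

theorem sum_normSq : ∑ g, Complex.normSq (ρ g).trace = 1080 := by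
  have h1 := sum_trace_mul_trace_inv ρ h.irr
  rw [h.fintypeCard, Finset.sum_congr rfl fun g _ => trace_map_mul_inv ρ g] at h1
  exact_mod_cast h1

end IsValentinerRep

/-- The elements of order four of a finite group. -/
noncomputable def elementsOrderFour (M : Type*) [Group M] [Fintype M] : Finset M :=
  Finset.univ.filter fun x => x ^ 4 = 1 ∧ x ^ 2 ≠ 1

theorem mem_elementsOrderFour {M : Type*} [Group M] [Fintype M] {x : M} :
    x ∈ elementsOrderFour M ↔ x ^ 4 = 1 ∧ x ^ 2 ≠ 1 := by
  simp [elementsOrderFour]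

theorem pow_two_mem_involutions {M : Type*} [Group M] [Fintype M] {x : M}
    (hx : x ∈ elementsOrderFour M) : x ^ 2 ∈ involutions M := by
  rw [mem_elementsOrderFour] at hx
  exact mem_involutions.2 ⟨by rw [← pow_mul, ← hx.1], hx.2⟩

theorem inv_ne_self_of_mem {M : Type*} [Group M] [Fintype M] {x : M}
    (hx : x ∈ elementsOrderFour M) : x⁻¹ ≠ x := fun h0 =>
  (mem_elementsOrderFour.1 hx).2 (by rw [pow_two]; nth_rw 1 [← h0]; group)

theorem inv_mem_elementsOrderFour {M : Type*} [Group M] [Fintype M] {x : M}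
    (hx : x ∈ elementsOrderFour M) : x⁻¹ ∈ elementsOrderFour M := by
  rw [mem_elementsOrderFour] at *
  exact ⟨by rw [inv_pow, hx.1, inv_one], by rw [inv_pow]; simpa using hx.2⟩

theorem inv_pow_two_of_mem {M : Type*} [Group M] [Fintype M] {x : M}
    (hx : x ∈ elementsOrderFour M) : x⁻¹ ^ 2 = x ^ 2 := by
  rw [inv_pow, inv_eq_of_pow_two (mem_involutions.1 (pow_two_mem_involutions hx)).1]

namespace IsValentinerRep

variable {M : Type*} [Group M] [Fintype M]
variable {ρ : M →* Matrix (Fin 3) (Fin 3) ℂ} (h : IsValentinerRep ρ)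
include h

theorem two_le_card_sqrt {i : M} (hi : i ∈ involutions M) :
    2 ≤ ((elementsOrderFour M).filter fun y => y ^ 2 = i).card := by
  obtain ⟨y, hy4, hy2⟩ := h.exists_orderOf_four_sq hi
  have hy : y ∈ elementsOrderFour M :=
    mem_elementsOrderFour.2 ⟨hy4, by rw [hy2]; exact (mem_involutions.1 hi).2⟩
  refine (Finset.card_pair (inv_ne_self_of_mem hy)).symm.trans_le
    (Finset.card_le_card fun x hx => ?_)
  rw [Finset.mem_insert, Finset.mem_singleton] at hx
  rw [Finset.mem_filter]
  rcases hx with rfl | rfl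
  · exact ⟨inv_mem_elementsOrderFour hy, by rw [inv_pow_two_of_mem hy, hy2]⟩
  · exact ⟨hy, hy2⟩

omit h in
theorem card_elementsOrderFour_eq_sum : (elementsOrderFour M).card =
    ∑ i ∈ involutions M, ((elementsOrderFour M).filter fun y => y ^ 2 = i).card :=
  Finset.card_eq_sum_card_fiberwise fun _ hx => pow_two_mem_involutions hx

theorem ninety_le_card : 90 ≤ (elementsOrderFour M).card := by
  rw [card_elementsOrderFour_eq_sum (M := M)]
  calc 90 = ∑ i ∈ involutions M, 2 := by rw [Finset.sum_const, h.card_involutions]; rfl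
    _ ≤ _ := Finset.sum_le_sum fun i hi => h.two_le_card_sqrt hi

omit h in
theorem sum_pow_two_of_pow_five (f : M → ℝ) :
    ∑ x ∈ Finset.univ.filter (fun x : M => x ^ 5 = 1 ∧ x ≠ 1), f (x ^ 2) =
      ∑ x ∈ Finset.univ.filter (fun x : M => x ^ 5 = 1 ∧ x ≠ 1), f x := by
  set O := Finset.univ.filter fun x : M => x ^ 5 = 1 ∧ x ≠ 1 with hO
  have hmemO : ∀ x, x ∈ O ↔ x ^ 5 = 1 ∧ x ≠ 1 := fun x => by simp [hO]
  have hsq : ∀ x ∈ O, x ^ 2 ∈ O := fun x hx => by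
    rw [hmemO] at *
    refine ⟨by rw [← pow_mul, mul_comm, pow_mul, hx.1, one_pow], fun h2 => hx.2 ?_⟩
    calc x = x ^ 5 * ((x ^ 2) ^ 2)⁻¹ := by group
      _ = 1 := by rw [hx.1, h2]; simp
  have hcube : ∀ x ∈ O, (x ^ 2) ^ 3 = x := fun x hx => by
    calc (x ^ 2) ^ 3 = x ^ 5 * x := by group
      _ = x := by rw [((hmemO x).1 hx).1, one_mul]
  refine Finset.sum_bij' (fun x _ => x ^ 2) (fun x _ => x ^ 3) hsq (fun x hx => ?_) hcube
    (fun x hx => by rw [← pow_mul, mul_comm, pow_mul, hcube x hx]) (fun _ _ => rfl)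
  have h4 : x ^ 3 = (x ^ 2) ^ 4 := by
    calc x ^ 3 = (x ^ 5)⁻¹ * (x ^ 2) ^ 4 := by group
      _ = _ := by rw [((hmemO x).1 hx).1]; simp
  rw [h4, show 4 = 2 * 2 from rfl, pow_mul]
  exact hsq _ (hsq _ (hsq _ hx))

theorem trace_conj_of_pow_five {x : M} (h5 : x ^ 5 = 1) :
    starRingEnd ℂ (ρ x).trace = (ρ x).trace := by
  by_cases h1 : x = 1
  · rw [h1, map_one, trace_one, Fintype.card_fin]; exact map_ofNat _ 3
  · obtain ⟨n, hn⟩ := h.conj_inv x h5 h1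
    rw [← trace_map_inv, ← hn, trace_map_conj]

theorem sum_normSq_pow_five :
    ∑ x ∈ Finset.univ.filter (fun x : M => x ^ 5 = 1 ∧ x ≠ 1),
      Complex.normSq (ρ x).trace = 216 := by
  have hbij := sum_pow_two_of_pow_five fun x : M => Complex.normSq (ρ x).trace
  set O := Finset.univ.filter fun x : M => x ^ 5 = 1 ∧ x ≠ 1 with hO
  have hmemO : ∀ x, x ∈ O ↔ x ^ 5 = 1 ∧ x ≠ 1 := fun x => by simp [hO]
  have hpt : ∀ x ∈ O, Complex.normSq (ρ x).trace + Complex.normSq (ρ (x ^ 2)).trace = 3 := by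
    intro x hx
    obtain ⟨h5, h1⟩ := (hmemO x).1 hx
    have ht := h.trace_sq x h5 h1
    have hreal := h.trace_conj_of_pow_five h5
    have hreal2 : starRingEnd ℂ (ρ (x ^ 2)).trace = (ρ (x ^ 2)).trace := by
      rw [h.trace_pow_two x h5 h1, map_sub, map_one, hreal]
    have : ((Complex.normSq (ρ x).trace + Complex.normSq (ρ (x ^ 2)).trace : ℝ) : ℂ) = 3 := by
      rw [Complex.ofReal_add, ← Complex.mul_conj, ← Complex.mul_conj, hreal, hreal2,
        h.trace_pow_two x h5 h1]
      linear_combination 2 * ht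
    exact_mod_cast this
  have hsum := Finset.sum_congr rfl hpt
  rw [Finset.sum_add_distrib, hbij, Finset.sum_const, h.card_pow_five] at hsum
  norm_num at hsum
  linarith

/-- The elements whose order divides four or five. -/
noncomputable def smallElements (M : Type*) [Group M] [Fintype M] : Finset M :=
  Finset.univ.filter fun x => x ^ 4 = 1 ∨ x ^ 5 = 1

omit h in
theorem mem_smallElements {x : M} : x ∈ smallElements M ↔ x ^ 4 = 1 ∨ x ^ 5 = 1 := by
  simp [smallElements]

omit h in
theorem sum_smallElements (f : M → ℝ) : ∑ x ∈ smallElements M, f x =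
    f 1 + ∑ x ∈ Finset.univ.filter (fun x : M => x ^ 5 = 1 ∧ x ≠ 1), f x +
      ∑ x ∈ involutions M, f x + ∑ x ∈ elementsOrderFour M, f x := by
  have hd1 : ∀ x : M, x ^ 4 = 1 → x ^ 5 = 1 → x = 1 := fun x h4 h5 => by
    calc x = x ^ 5 * (x ^ 4)⁻¹ := by group
      _ = 1 := by rw [h4, h5]; simp
  rw [← Finset.sum_singleton f 1, ← Finset.sum_union, ← Finset.sum_union, ← Finset.sum_union]
  · congr 1
    ext x
    simp only [mem_smallElements, Finset.mem_union, Finset.mem_singleton, Finset.mem_filter,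
      Finset.mem_univ, true_and, mem_involutions, mem_elementsOrderFour]
    have h24 : x ^ 2 = 1 → x ^ 4 = 1 := fun h2 => by
      rw [show 4 = 2 * 2 from rfl, pow_mul, h2, one_pow]
    have h1 : x = 1 → x ^ 4 = 1 ∧ x ^ 2 = 1 := by rintro rfl; simp
    tauto
  · rw [Finset.disjoint_left]
    intro x hx
    simp only [Finset.mem_union, Finset.mem_singleton, Finset.mem_filter,
      Finset.mem_univ, true_and, mem_involutions] at hx
    rw [mem_elementsOrderFour]
    rintro ⟨h4, h2⟩
    rcases hx with (rfl | hx) | hx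
    · simp at h2
    · exact hx.2 (hd1 x h4 hx.1)
    · exact h2 hx.1
  · rw [Finset.disjoint_left]
    intro x hx
    simp only [Finset.mem_union, Finset.mem_singleton, Finset.mem_filter,
      Finset.mem_univ, true_and] at hx
    rw [mem_involutions]
    rintro ⟨h2, h1⟩
    rcases hx with rfl | hx
    · exact h1 rfl
    · exact h1 (hd1 x (by rw [show 4 = 2 * 2 from rfl, pow_mul, h2, one_pow]) hx.1)
  · rw [Finset.disjoint_left]
    intro x hx
    simp only [Finset.mem_singleton] at hx
    simp [hx]

/-- The character vanishes away from the multiples of the elements of order dividing four or five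
by central elements, elements of order four have trace one, and there are ninety of them. -/
theorem trace_structure :
    (∀ x ∈ elementsOrderFour M, (ρ x).trace = 1) ∧ (elementsOrderFour M).card = 90 ∧
      ∀ x, (ρ x).trace ≠ 0 →
        ∃ t ∈ smallElements M, ∃ z ∈ Subgroup.center M, x = t * z := by
  obtain ⟨z, ω, hω, hz, hz3, hzc, -⟩ := h.exists_center_generator
  have hω3 : ω ^ 3 = 1 := by linear_combination (ω - 1) * hω
  have hz1 : z ≠ 1 := by
    rintro rfl
    have h1 := congrFun (congrFun hz 0) 0
    simp at h1
    rw [← h1] at hω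
    norm_num at hω
  have : Fact (Nat.Prime 3) := ⟨Nat.prime_three⟩
  have hord := orderOf_eq_prime hz3 hz1
  let f : M → ℝ := fun x => Complex.normSq (ρ x).trace
  have hfn : ∀ x, 0 ≤ f x := fun x => Complex.normSq_nonneg _
  let F : M × ℕ → M := fun p => p.1 * z ^ p.2
  have hcomm : ∀ (t : M) (j : ℕ), Commute t (z ^ j) := fun t j =>
    (show Commute t z from Subgroup.mem_center_iff.1 hzc t).pow_right j
  have h20 : ∀ t ∈ smallElements M, t ^ 20 = 1 := fun t ht => by
    rcases mem_smallElements.1 ht with h1 | h1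
    · rw [show 20 = 4 * 5 from rfl, pow_mul, h1, one_pow]
    · rw [show 20 = 5 * 4 from rfl, pow_mul, h1, one_pow]
  have hinj : Set.InjOn F (smallElements M ×ˢ Finset.range 3 : Finset (M × ℕ)) := by
    rintro ⟨t, j⟩ hp ⟨t', j'⟩ hp' he
    rw [Finset.mem_coe, Finset.mem_product] at hp hp'
    change t * z ^ j = t' * z ^ j' at he
    have h1 : z ^ (j * 20) = z ^ (j' * 20) := by
      have := congrArg (· ^ 20) he
      simpa only [(hcomm _ _).mul_pow, h20 t hp.1, h20 t' hp'.1, one_mul, ← pow_mul] using this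
    rw [pow_inj_mod, hord] at h1
    have hj := Finset.mem_range.1 hp.2
    have hj' := Finset.mem_range.1 hp'.2
    simp only at hj hj'
    have hjj : j = j' := by omega
    subst hjj
    rw [mul_right_cancel he]
  have hfF : ∀ p, f (F p) = f p.1 := fun p => by
    change Complex.normSq (ρ (p.1 * z ^ p.2)).trace = _
    have hn : Complex.normSq ω = 1 := by
      have h1 : Complex.normSq ω ^ 3 = 1 := by rw [← map_pow, hω3, map_one]
      exact (pow_eq_one_iff_of_nonneg (Complex.normSq_nonneg _) (by norm_num)).1 h1
    rw [map_mul, map_pow, hz, smul_pow, one_pow, Matrix.mul_smul, mul_one, trace_smul, smul_eq_mul,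
      map_mul, map_pow, hn, one_pow, one_mul]
  set B := (smallElements M ×ˢ Finset.range 3).image F with hB
  have hBsum : ∑ x ∈ B, f x = 3 * ∑ t ∈ smallElements M, f t := by
    rw [hB, Finset.sum_image hinj, Finset.sum_congr rfl fun p _ => hfF p, Finset.sum_product]
    simp [Finset.mul_sum]
  have htot : ∑ x ∈ B, f x + ∑ x ∈ Bᶜ, f x = 1080 := by
    rw [Finset.sum_add_sum_compl]; exact h.sum_normSq
  have hf1 : f 1 = 9 := by
    change Complex.normSq (ρ 1).trace = 9
    rw [map_one, trace_one, Fintype.card_fin]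
    norm_num [Complex.normSq_apply]
  have hfI : ∑ x ∈ involutions M, f x = 45 := by
    rw [Finset.sum_congr rfl (g := fun _ => 1), Finset.sum_const, h.card_involutions]
    · norm_num
    · intro x hx
      change Complex.normSq (ρ x).trace = 1
      rw [h.trace_of_mem_involutions hx]; simp
  have hpt : ∀ x ∈ elementsOrderFour M, 1 ≤ f x := fun x hx =>
    (h.normSq_trace_of_pow_four (mem_elementsOrderFour.1 hx).1 (mem_elementsOrderFour.1 hx).2).1
  rw [hBsum, sum_smallElements, hf1, h.sum_normSq_pow_five, hfI] at htot
  have hge : ((elementsOrderFour M).card : ℝ) ≤ ∑ x ∈ elementsOrderFour M, f x := by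
    rw [← nsmul_one, ← Finset.sum_const]
    exact Finset.sum_le_sum hpt
  have h90 : (90 : ℝ) ≤ (elementsOrderFour M).card := by exact_mod_cast h.ninety_le_card
  have hc0 : 0 ≤ ∑ x ∈ Bᶜ, f x := Finset.sum_nonneg fun x _ => hfn x
  refine ⟨fun x hx => ?_, ?_, fun x hx => ?_⟩
  · refine (h.normSq_trace_of_pow_four (mem_elementsOrderFour.1 hx).1
      (mem_elementsOrderFour.1 hx).2).2 ?_
    have : ∑ x ∈ elementsOrderFour M, (1 : ℝ) = ∑ x ∈ elementsOrderFour M, f x := by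
      rw [Finset.sum_const, nsmul_one]; linarith
    exact ((Finset.sum_eq_sum_iff_of_le hpt).1 this x hx).symm
  · have : ((elementsOrderFour M).card : ℝ) = 90 := by linarith
    exact_mod_cast this
  · have hBc : ∑ x ∈ Bᶜ, f x = 0 := by linarith
    by_contra hcon
    apply hx
    have hxB : x ∈ Bᶜ := by
      rw [Finset.mem_compl, hB, Finset.mem_image]
      rintro ⟨p, hp, rfl⟩
      exact hcon ⟨p.1, (Finset.mem_product.1 hp).1, z ^ p.2, Subgroup.pow_mem _ hzc _, rfl⟩
    exact Complex.normSq_eq_zero.1 ((Finset.sum_eq_zero_iff_of_nonneg fun x _ => hfn x).1 hBc x hxB)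

theorem card_sqrt {i : M} (hi : i ∈ involutions M) :
    ((elementsOrderFour M).filter fun y => y ^ 2 = i).card = 2 := by
  have hc := card_elementsOrderFour_eq_sum (M := M)
  rw [h.trace_structure.2.1] at hc
  have h2 : ∑ i ∈ involutions M, 2 =
      ∑ i ∈ involutions M, ((elementsOrderFour M).filter fun y => y ^ 2 = i).card := by
    rw [← hc, Finset.sum_const, h.card_involutions]; rfl
  exact ((Finset.sum_eq_sum_iff_of_le fun i hi => h.two_le_card_sqrt hi).1 h2 _ hi).symm

theorem pow_four_of_pow_eight {x : M} (h8 : x ^ 8 = 1) : x ^ 4 = 1 := by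
  by_contra h4
  have hy : x ^ 2 ∈ elementsOrderFour M := mem_elementsOrderFour.2
    ⟨by rw [← pow_mul, ← h8], by rw [← pow_mul]; exact h4⟩
  have h1 := trace_sq_add (ρ x) (ρ x⁻¹) (h.det x) (map_mul_map_inv ρ x)
  rw [← map_mul, ← pow_two, h.trace_structure.1 _ hy, trace_map_inv] at h1
  have hx0 : (ρ x).trace ≠ 0 := fun h0 => by rw [h0] at h1; simp at h1
  obtain ⟨t, ht, z, hz, rfl⟩ := h.trace_structure.2.2 x hx0
  have hc : Commute t z := Subgroup.mem_center_iff.1 hz t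
  apply h4
  have h60 : (t * z) ^ 60 = 1 := by
    rw [hc.mul_pow, show 60 = 3 * 20 from rfl, pow_mul z, h.pow_three_of_mem_center hz, one_pow,
      mul_one]
    rcases mem_smallElements.1 ht with h1 | h1
    · rw [show 3 * 20 = 4 * 15 from rfl, pow_mul, h1, one_pow]
    · rw [show 3 * 20 = 5 * 12 from rfl, pow_mul, h1, one_pow]
  calc (t * z) ^ 4 = ((t * z) ^ 8) ^ 8 * ((t * z) ^ 60)⁻¹ := by
        rw [← pow_mul, ← zpow_natCast, ← zpow_natCast, ← zpow_natCast]; group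
    _ = 1 := by rw [h8, h60]; simp

end IsValentinerRep

/-- The stabilizer of a vector. -/
def fixer {M : Type*} [Group M] (ρ : M →* Matrix (Fin 3) (Fin 3) ℂ) (v : Fin 3 → ℂ) :
    Subgroup M where
  carrier := {x | ρ x *ᵥ v = v}
  mul_mem' {x y} hx hy := by
    rw [Set.mem_ofPred_eq] at *
    rw [map_mul, ← mulVec_mulVec, hy, hx]
  one_mem' := by rw [Set.mem_ofPred_eq, map_one, one_mulVec]
  inv_mem' {x} hx := by
    rw [Set.mem_ofPred_eq] at *
    nth_rw 1 [← hx]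
    rw [mulVec_mulVec, ← map_mul, inv_mul_cancel, map_one, one_mulVec]

theorem mem_fixer {M : Type*} [Group M] {ρ : M →* Matrix (Fin 3) (Fin 3) ℂ} {v : Fin 3 → ℂ}
    {x : M} : x ∈ fixer ρ v ↔ ρ x *ᵥ v = v := Iff.rfl

namespace IsValentinerRep

variable {M : Type*} [Group M] [Fintype M]
variable {ρ : M →* Matrix (Fin 3) (Fin 3) ℂ} (h : IsValentinerRep ρ)
include h

theorem exists_scalar_of_mem_center {z : M} (hz : z ∈ Subgroup.center M) :
    ∃ c : ℂ, c ^ 3 = 1 ∧ ρ z = c • 1 := by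
  obtain ⟨z0, ω, hω, hz0, -, -, hall⟩ := h.exists_center_generator
  obtain ⟨j, -, rfl⟩ := hall z hz
  refine ⟨ω ^ j, ?_, by rw [map_pow, hz0, smul_pow, one_pow]⟩
  rw [← pow_mul, mul_comm, pow_mul, show ω ^ 3 = 1 by linear_combination (ω - 1) * hω, one_pow]

theorem eq_one_of_mem_center {z : M} (hz : z ∈ Subgroup.center M) {v : Fin 3 → ℂ} (hv : v ≠ 0)
    (hzv : ρ z *ᵥ v = v) : z = 1 := by
  obtain ⟨c, -, hc⟩ := h.exists_scalar_of_mem_center hz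
  have h1 : (c - 1) • v = 0 := by
    rw [sub_smul, one_smul, sub_eq_zero, ← hzv, hc, smul_mulVec, one_mulVec]
    rw [hc, smul_mulVec, one_mulVec] at hzv
    rw [hzv, hzv]
  have hc1 : c = 1 := sub_eq_zero.1 ((smul_eq_zero.1 h1).resolve_right hv)
  exact h.inj (by rw [hc, hc1, one_smul, map_one])

theorem trace_conj_of_fixed {v : Fin 3 → ℂ} (hv : v ≠ 0) {x : M} (hx : ρ x *ᵥ v = v) :
    starRingEnd ℂ (ρ x).trace = (ρ x).trace := by
  have h0 : (ρ x - 1).det = 0 :=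
    exists_mulVec_eq_zero_iff.1 ⟨v, hv, by rw [sub_mulVec, one_mulVec, hx, sub_self]⟩
  rw [det_sub_one_eq _ _ (h.det x) (map_mul_map_inv ρ x), trace_map_inv] at h0
  linear_combination -h0

theorem trace_conj_of_mem_smallElements {t : M} (ht : t ∈ smallElements M) :
    starRingEnd ℂ (ρ t).trace = (ρ t).trace := by
  rcases mem_smallElements.1 ht with h4 | h5
  · by_cases h1 : t = 1
    · rw [h1, map_one, trace_one, Fintype.card_fin]; exact map_ofNat _ 3
    · by_cases h2 : t ^ 2 = 1
      · rw [h.trace_of_mem_involutions (mem_involutions.2 ⟨h2, h1⟩)]; simp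
      · rw [h.trace_structure.1 t (mem_elementsOrderFour.2 ⟨h4, h2⟩)]; simp
  · exact h.trace_conj_of_pow_five h5

theorem mem_smallElements_of_fixed {v : Fin 3 → ℂ} (hv : v ≠ 0) {x : M} (hx : ρ x *ᵥ v = v)
    (h0 : (ρ x).trace ≠ 0) : x ∈ smallElements M := by
  obtain ⟨t, ht, z, hz, rfl⟩ := h.trace_structure.2.2 x h0
  obtain ⟨c, hc3, hc⟩ := h.exists_scalar_of_mem_center hz
  have hconj := h.trace_conj_of_fixed hv hx
  have ht0 : (ρ (t * z)).trace = c * (ρ t).trace := by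
    rw [map_mul, hc, Matrix.mul_smul, mul_one, trace_smul, smul_eq_mul]
  rw [ht0] at hconj h0
  rw [map_mul, h.trace_conj_of_mem_smallElements ht] at hconj
  have hcc := mul_right_cancel₀ (right_ne_zero_of_mul h0) hconj
  obtain ⟨r, rfl⟩ := Complex.conj_eq_iff_real.1 hcc
  have hr : r ^ 3 = 1 := by exact_mod_cast hc3
  have hr1 : r = 1 := by
    have : (r - 1) * (r ^ 2 + r + 1) = 0 := by linear_combination hr
    rcases mul_eq_zero.1 this with h1 | h1
    · linarith
    · nlinarith [sq_nonneg (r + 1 / 2)]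
  have hz1 : z = 1 := h.inj (by rw [hc, hr1, map_one, Complex.ofReal_one, one_smul])
  rwa [hz1, mul_one]

theorem pow_three_of_fixed {v : Fin 3 → ℂ} (hv : v ≠ 0) {x : M} (hx : ρ x *ᵥ v = v)
    (h0 : x ∉ smallElements M) : (ρ x).trace = 0 ∧ x ^ 3 = 1 := by
  have ht : (ρ x).trace = 0 := by
    by_contra hne
    exact h0 (h.mem_smallElements_of_fixed hv hx hne)
  refine ⟨ht, h.inj ?_⟩
  rw [map_pow, pow_three_of_det_eq_one _ _ (h.det x) (map_mul_map_inv ρ x), trace_map_inv, ht,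
    map_one]
  simp

theorem mem_involutions_of_mulVec_eq_neg {v : Fin 3 → ℂ} (hv : v ≠ 0) {x : M}
    (hx : ρ x *ᵥ v = -v) : x ∈ involutions M := by
  have hneg : -v ≠ v := fun h0 => hv (by
    have : (2 : ℂ) • v = 0 := by rw [two_smul]; nth_rw 1 [← h0]; simp
    exact (smul_eq_zero.1 this).resolve_left two_ne_zero)
  have hpow : ∀ n : ℕ, ρ (x ^ n) *ᵥ v = (-1 : ℂ) ^ n • v := by
    intro n
    induction n with
    | zero => simp
    | succ n ih =>
      rw [pow_succ', map_mul, ← mulVec_mulVec, ih, mulVec_smul, hx, pow_succ, mul_smul]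
      simp
  have hx1 : x ≠ 1 := by
    rintro rfl
    rw [map_one, one_mulVec] at hx
    exact hneg hx.symm
  obtain ⟨k, hk⟩ : Even (orderOf x) := by
    by_contra hodd
    rw [Nat.not_even_iff_odd] at hodd
    have := hpow (orderOf x)
    rw [pow_orderOf_eq_one, map_one, one_mulVec, hodd.neg_one_pow, neg_one_smul] at this
    exact hneg this.symm
  have hpos := orderOf_pos x
  have hi : x ^ k ∈ involutions M := by
    refine mem_involutions.2 ⟨?_, fun h1 => ?_⟩
    · rw [← pow_mul, mul_two, ← hk, pow_orderOf_eq_one]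
    · have := Nat.le_of_dvd (by omega) (orderOf_dvd_of_pow_eq_one h1)
      omega
  have h8 := h.eq_one_of_mem_center
    (h.pow_eight_mem_center hi (Commute.self_pow x k)) hv (by rw [hpow]; norm_num)
  have h4 := h.pow_four_of_pow_eight h8
  refine mem_involutions.2 ⟨?_, hx1⟩
  by_contra h2
  have h0 : (ρ x + 1).det = 0 :=
    exists_mulVec_eq_zero_iff.1 ⟨v, hv, by rw [add_mulVec, one_mulVec, hx]; simp⟩
  rw [det_add_one_eq _ _ (h.det x) (map_mul_map_inv ρ x), trace_map_inv,
    h.trace_structure.1 x (mem_elementsOrderFour.2 ⟨h4, h2⟩)] at h0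
  norm_num at h0

/-- An element of order four fixes the vectors fixed by its square. -/
theorem mulVec_eq_of_pow_two {x : M} (hx : x ∈ elementsOrderFour M) {v : Fin 3 → ℂ}
    (hv : ρ (x ^ 2) *ᵥ v = v) : ρ x *ᵥ v = v := by
  have h3 := pow_three_of_det_eq_one _ _ (h.det x) (map_mul_map_inv ρ x)
  rw [trace_map_inv, h.trace_structure.1 x hx, map_one, one_smul, one_smul, pow_succ', ← map_pow]
    at h3
  have := congrArg (· *ᵥ v) h3
  simp only [add_mulVec, sub_mulVec, one_mulVec, ← mulVec_mulVec, hv] at this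
  have h2 : (2 : ℂ) • (ρ x *ᵥ v - v) = 0 := by
    rw [two_smul]
    nth_rw 1 [this]
    abel
  exact sub_eq_zero.1 ((smul_eq_zero.1 h2).resolve_left two_ne_zero)

theorem card_elementsOrderFour_fixed (v : Fin 3 → ℂ) :
    ((elementsOrderFour M).filter (· ∈ fixer ρ v)).card =
      2 * ((involutions M).filter (· ∈ fixer ρ v)).card := by
  rw [Finset.card_eq_sum_card_fiberwise (f := (· ^ 2))
    (t := (involutions M).filter (· ∈ fixer ρ v)), Finset.sum_congr rfl (g := fun _ => 2),
    Finset.sum_const, smul_eq_mul, mul_comm]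
  · intro c hc
    rw [Finset.mem_filter] at hc
    refine Eq.trans ?_ (h.card_sqrt hc.1)
    rw [Finset.filter_filter]
    congr 1
    refine Finset.filter_congr fun y hy => ⟨fun h1 => h1.2, fun h1 => ⟨?_, h1⟩⟩
    refine h.mulVec_eq_of_pow_two hy ?_
    rw [h1]; exact hc.2
  · intro x hx
    rw [Finset.mem_coe, Finset.mem_filter] at hx
    exact Finset.mem_coe.2 (Finset.mem_filter.2
      ⟨pow_two_mem_involutions hx.1, Subgroup.pow_mem _ hx.2 2⟩)

omit h in
theorem four_le_card_fixed {v : Fin 3 → ℂ} {x : M} (h5 : x ^ 5 = 1) (h1 : x ≠ 1)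
    (hx : x ∈ fixer ρ v) :
    4 ≤ ((Finset.univ.filter fun x : M => x ^ 5 = 1 ∧ x ≠ 1).filter (· ∈ fixer ρ v)).card := by
  have : Fact (Nat.Prime 5) := ⟨by norm_num⟩
  have hord : orderOf x = 5 := orderOf_eq_prime h5 h1
  have hinj : Set.InjOn (fun k : ℕ => x ^ k) (Finset.Icc 1 4 : Finset ℕ) := by
    intro i hi j hj hij
    have := pow_inj_mod.1 hij
    rw [Finset.mem_coe, Finset.mem_Icc] at hi hj
    rw [hord] at this
    omega
  have hc := Finset.card_image_of_injOn hinj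
  rw [Nat.card_Icc] at hc
  refine hc.symm.trans_le (Finset.card_le_card fun y hy => ?_)
  obtain ⟨k, hk, rfl⟩ := Finset.mem_image.1 hy
  rw [Finset.mem_Icc] at hk
  simp only [Finset.mem_filter, Finset.mem_univ, true_and]
  refine ⟨⟨by rw [← pow_mul, mul_comm, pow_mul, h5, one_pow], fun hk1 => ?_⟩,
    Subgroup.pow_mem _ hx k⟩
  have := Nat.le_of_dvd (by omega) (orderOf_dvd_of_pow_eq_one hk1)
  omega

/-- The stabilizers of nonzero vectors are trivial or of order three, four or five. -/
theorem card_fixer_cases {v : Fin 3 → ℂ} (hv : v ≠ 0) (hnt : ∃ x ∈ fixer ρ v, x ≠ 1) :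
    (Nat.card (fixer ρ v) = 4 ∧ ((involutions M).filter (· ∈ fixer ρ v)).card = 1 ∧
      ((Finset.univ.filter fun x : M => x ^ 5 = 1 ∧ x ≠ 1).filter (· ∈ fixer ρ v)).card = 0) ∨
    (Nat.card (fixer ρ v) = 3 ∧ ((involutions M).filter (· ∈ fixer ρ v)).card = 0 ∧
      ((Finset.univ.filter fun x : M => x ^ 5 = 1 ∧ x ≠ 1).filter (· ∈ fixer ρ v)).card = 0) ∨
    (Nat.card (fixer ρ v) = 5 ∧ ((involutions M).filter (· ∈ fixer ρ v)).card = 0 ∧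
      ((Finset.univ.filter fun x : M => x ^ 5 = 1 ∧ x ≠ 1).filter (· ∈ fixer ρ v)).card = 4) := by
  have h4 := h.card_elementsOrderFour_fixed v
  have hfour : ∀ x : M, x ^ 5 = 1 → x ≠ 1 → x ∈ fixer ρ v → 4 ≤ _ :=
    fun x => four_le_card_fixed (v := v)
  set S := fixer ρ v
  set O := Finset.univ.filter fun x : M => x ^ 5 = 1 ∧ x ≠ 1 with hO
  have hmemO : ∀ x, x ∈ O ↔ x ^ 5 = 1 ∧ x ≠ 1 := fun x => by simp [hO]
  set u2 := ((involutions M).filter (· ∈ S)).card with hu2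
  set u5 := (O.filter (· ∈ S)).card with hu5
  set R := (smallElements M)ᶜ.filter (· ∈ S) with hR
  let f : M → ℝ := fun x => if x ∈ S then (ρ x).trace.re else 0
  let g : M → ℝ := fun x => if x ∈ S then 1 else 0
  have hg : ∀ B : Finset M, ∑ x ∈ B, g x = (B.filter (· ∈ S)).card := fun B => by
    rw [Finset.sum_ite, Finset.sum_const_zero, add_zero, Finset.sum_const, nsmul_one]
  have hgtot : (Nat.card S : ℝ) = 1 + u5 + 3 * u2 + R.card := by
    have h1 := Finset.sum_add_sum_compl (smallElements M) g
    rw [sum_smallElements, hg, hg, hg, hg, hg, card_filter_mem_subgroup, h4] at h1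
    simp only [g, S.one_mem, if_true] at h1
    rw [← h1]
    push_cast
    ring
  have hfO : 2 * ∑ x ∈ O, f x = u5 := by
    have hd := sum_pow_two_of_pow_five f
    rw [two_mul]
    nth_rw 1 [← hd]
    rw [← Finset.sum_add_distrib, ← hg]
    refine Finset.sum_congr rfl fun x hx => ?_
    obtain ⟨h5, h1⟩ := (hmemO x).1 hx
    have hiff : x ^ 2 ∈ S ↔ x ∈ S := by
      refine ⟨fun h2 => ?_, fun h2 => S.pow_mem h2 2⟩
      have : x = (x ^ 2) ^ 3 := by
        calc x = x ^ 5 * x := by rw [h5, one_mul]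
          _ = _ := by group
      rw [this]; exact S.pow_mem h2 3
    simp only [f, g, hiff]
    split_ifs
    · rw [h.trace_pow_two x h5 h1]; simp
    · simp
  have hftot : ∑ x, f x = 3 + u2 + u5 / 2 := by
    rw [← Finset.sum_add_sum_compl (smallElements M) f, sum_smallElements,
      Finset.sum_congr rfl (g := fun x => -g x) (s₁ := involutions M),
      Finset.sum_congr rfl (g := g) (s₁ := elementsOrderFour M),
      Finset.sum_eq_zero (s := (smallElements M)ᶜ), Finset.sum_neg_distrib, hg, hg, h4]
    · have : f 1 = 3 := by simp [f, S.one_mem]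
      rw [this]
      push_cast
      linarith
    · intro x hx
      simp only [f]
      split_ifs with hxS
      · rw [(h.pow_three_of_fixed hv hxS (Finset.mem_compl.1 hx)).1, Complex.zero_re]
      · rfl
    · intro x hx
      simp only [f, g, h.trace_structure.1 x hx, Complex.one_re]
    · intro x hx
      simp only [f, g, h.trace_of_mem_involutions hx]
      split_ifs <;> simp
  obtain ⟨m, hm, hm1⟩ := exists_sum_trace_subgroup ρ S
  have hm1' : (1 : ℝ) ≤ m := by exact_mod_cast hm1 ⟨v, hv, fun x hx => hx⟩
  have hmre : ∑ x, f x = Nat.card S * m := by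
    have := congrArg Complex.re hm
    rw [Complex.re_sum] at this
    simp only [f]
    rw [← Finset.sum_filter, this]
    simp
  have hle : (Nat.card S : ℝ) ≤ ∑ x, f x := by
    rw [hmre]; exact le_mul_of_one_le_right (Nat.cast_nonneg _) hm1'
  rw [hftot, hgtot] at hle
  have hleN : 4 * u2 + 2 * R.card + u5 ≤ 4 := by
    have : (4 * u2 + 2 * R.card + u5 : ℝ) ≤ 4 := by linarith
    exact_mod_cast this
  have hcardN : Nat.card S = 1 + u5 + 3 * u2 + R.card := by exact_mod_cast hgtot
  have hu5' : u5 = 0 ∨ 4 ≤ u5 := by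
    rcases Finset.eq_empty_or_nonempty (O.filter (· ∈ S)) with h0 | ⟨x, hx⟩
    · left; rw [hu5, h0, Finset.card_empty]
    · right
      rw [Finset.mem_filter, hmemO] at hx
      exact hfour x hx.1.1 hx.1.2 hx.2
  have hR' : R.card = 0 ∨ 2 ≤ R.card := by
    rcases Finset.eq_empty_or_nonempty R with h0 | ⟨x, hx⟩
    · left; rw [h0, Finset.card_empty]
    · right
      rw [hR, Finset.mem_filter, Finset.mem_compl] at hx
      have h3 := (h.pow_three_of_fixed hv hx.2 hx.1).2
      have hne : x ≠ x⁻¹ := by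
        intro he
        apply hx.1
        have h2 : x ^ 2 = 1 := by rw [pow_two]; nth_rw 2 [he]; group
        exact mem_smallElements.2 (Or.inl (by rw [show 4 = 2 * 2 from rfl, pow_mul, h2, one_pow]))
      refine (Finset.card_pair hne).symm.trans_le (Finset.card_le_card fun y hy => ?_)
      rw [Finset.mem_insert, Finset.mem_singleton] at hy
      rw [hR, Finset.mem_filter, Finset.mem_compl]
      rcases hy with rfl | rfl
      · exact hx
      · refine ⟨fun hs => hx.1 ?_, S.inv_mem hx.2⟩
        rw [mem_smallElements] at hs ⊢
        simpa using hs
  have hpos : Nat.card S ≠ 1 := by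
    obtain ⟨x, hxS, hx1⟩ := hnt
    intro h1
    rw [Subgroup.card_eq_one] at h1
    rw [h1, Subgroup.mem_bot] at hxS
    exact hx1 hxS
  omega

end IsValentinerRep

theorem exists_eq_span_of_finrank_eq_one {p : Submodule ℂ (Fin 3 → ℂ)} (hp : finrank ℂ p = 1) :
    ∃ v, v ≠ 0 ∧ p = Submodule.span ℂ {v} := by
  obtain ⟨v, hvp, hv⟩ := p.exists_mem_ne_zero_of_ne_bot (by rintro rfl; simp at hp)
  refine ⟨v, hv, (Submodule.eq_of_le_of_finrank_eq ?_ ?_).symm⟩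
  · rwa [Submodule.span_singleton_le_iff_mem]
  · rw [finrank_span_singleton hv, hp]

theorem finrank_inf_eq_one {U V : Submodule ℂ (Fin 3 → ℂ)} (hU : finrank ℂ U = 2)
    (hV : finrank ℂ V = 2) (hne : U ≠ V) : finrank ℂ ↥(U ⊓ V) = 1 := by
  have h1 := Submodule.finrank_sup_add_finrank_inf_eq U V
  have h2 : finrank ℂ ↥(U ⊔ V) ≤ 3 := by simpa using Submodule.finrank_le (U ⊔ V)
  have h3 : finrank ℂ ↥(U ⊓ V) < 2 := by
    by_contra! hge
    have hl := Submodule.eq_of_le_of_finrank_le (inf_le_left : U ⊓ V ≤ U) (by omega)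
    have hr := Submodule.eq_of_le_of_finrank_le (inf_le_right : U ⊓ V ≤ V) (by omega)
    exact hne (hl.symm.trans hr)
  omega

/-- The `-1`-eigenspace of a group element. -/
noncomputable def mirror {M : Type*} [Group M] (ρ : M →* Matrix (Fin 3) (Fin 3) ℂ) (e : M) :
    Submodule ℂ (Fin 3 → ℂ) :=
  LinearMap.ker (toLin' (ρ e + 1))

theorem mem_mirror {M : Type*} [Group M] {ρ : M →* Matrix (Fin 3) (Fin 3) ℂ} {e : M}
    {v : Fin 3 → ℂ} : v ∈ mirror ρ e ↔ ρ e *ᵥ v = -v := by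
  rw [mirror, LinearMap.mem_ker, toLin'_apply, add_mulVec, one_mulVec, add_eq_zero_iff_eq_neg]

/-- The space of vectors fixed by a group element. -/
noncomputable def fixedLine {M : Type*} [Group M] (ρ : M →* Matrix (Fin 3) (Fin 3) ℂ) (x : M) :
    Submodule ℂ (Fin 3 → ℂ) :=
  LinearMap.ker (toLin' (ρ x - 1))

theorem mem_fixedLine {M : Type*} [Group M] {ρ : M →* Matrix (Fin 3) (Fin 3) ℂ} {x : M}
    {v : Fin 3 → ℂ} : v ∈ fixedLine ρ x ↔ x ∈ fixer ρ v := by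
  rw [fixedLine, LinearMap.mem_ker, toLin'_apply, sub_mulVec, one_mulVec, sub_eq_zero, mem_fixer]

section Counting

variable {M : Type*} [Group M] [Fintype M] (ρ : M →* Matrix (Fin 3) (Fin 3) ℂ)

/-- The number of mirrors of involutions containing a subspace. -/
noncomputable def mirrorCount (p : Submodule ℂ (Fin 3 → ℂ)) : ℕ :=
  ((involutions M).filter fun e => p ≤ mirror ρ e).card

/-- The intersections of two distinct mirrors. -/
noncomputable def mirrorLines : Finset (Submodule ℂ (Fin 3 → ℂ)) :=
  (involutions M).offDiag.image fun q => mirror ρ q.1 ⊓ mirror ρ q.2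

end Counting

namespace IsValentinerRep

variable {M : Type*} [Group M] [Fintype M]
variable {ρ : M →* Matrix (Fin 3) (Fin 3) ℂ} (h : IsValentinerRep ρ)
include h

theorem finrank_mirror {e : M} (he : e ∈ involutions M) : finrank ℂ (mirror ρ e) = 2 := by
  have h1 : mirror ρ e = LinearMap.ker (toLin' (-ρ e - 1)) := by
    ext v
    rw [mem_mirror, LinearMap.mem_ker, toLin'_apply, sub_mulVec, one_mulVec, neg_mulVec,
      sub_eq_zero, neg_eq_iff_eq_neg]
  rw [h1]
  refine finrank_fixed_eq_two_of_sq ?_ ?_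
  · rw [neg_sq, ← map_pow, (mem_involutions.1 he).1, map_one]
  · rw [trace_neg, h.trace_of_mem_involutions he, neg_neg]

theorem mirror_injOn : Set.InjOn (mirror ρ) (involutions M : Set M) := by
  intro e he f hf hef
  rw [Finset.mem_coe] at he hf
  have hle : mirror ρ e ≤ LinearMap.ker (toLin' (ρ (e * f) - 1)) := by
    intro v hv
    have hv' : v ∈ mirror ρ f := hef ▸ hv
    rw [mem_mirror] at hv hv'
    rw [LinearMap.mem_ker, toLin'_apply, sub_mulVec, one_mulVec, map_mul, ← mulVec_mulVec, hv',
      mulVec_neg, hv, neg_neg, sub_self]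
  have h2 := Submodule.finrank_mono hle
  rw [h.finrank_mirror he] at h2
  have h1 := eq_one_of_finrank_fixed Fintype.card_pos (map_pow_card_eq_one ρ (e * f))
    (h.det _) h2
  have h3 : e * f = 1 := h.inj (h1.trans (map_one ρ).symm)
  rw [mul_eq_one_iff_eq_inv, inv_eq_of_pow_two (mem_involutions.1 hf).1] at h3
  exact h3

theorem finrank_mirror_inf {e f : M} (he : e ∈ involutions M) (hf : f ∈ involutions M)
    (hne : e ≠ f) : finrank ℂ ↥(mirror ρ e ⊓ mirror ρ f) = 1 :=
  finrank_inf_eq_one (h.finrank_mirror he) (h.finrank_mirror hf)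
    fun h0 => hne (h.mirror_injOn he hf h0)

theorem eq_mirror_inf {p : Submodule ℂ (Fin 3 → ℂ)} (hp : finrank ℂ p = 1) {e f : M}
    (he : e ∈ involutions M) (hf : f ∈ involutions M) (hne : e ≠ f) (hpe : p ≤ mirror ρ e)
    (hpf : p ≤ mirror ρ f) : mirror ρ e ⊓ mirror ρ f = p :=
  (Submodule.eq_of_le_of_finrank_eq (le_inf hpe hpf)
    (hp.trans (h.finrank_mirror_inf he hf hne).symm)).symm

theorem mem_mirrorLines {p : Submodule ℂ (Fin 3 → ℂ)} :
    p ∈ mirrorLines ρ ↔ finrank ℂ p = 1 ∧ 2 ≤ mirrorCount ρ p := by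
  rw [mirrorLines, Finset.mem_image]
  constructor
  · rintro ⟨⟨e, f⟩, hef, rfl⟩
    obtain ⟨he, hf, hne⟩ := Finset.mem_offDiag.1 hef
    refine ⟨h.finrank_mirror_inf he hf hne, ?_⟩
    refine Finset.one_lt_card.2 ⟨e, ?_, f, ?_, hne⟩
    · exact Finset.mem_filter.2 ⟨he, inf_le_left⟩
    · exact Finset.mem_filter.2 ⟨hf, inf_le_right⟩
  · rintro ⟨hp, h2⟩
    obtain ⟨e, he, f, hf, hne⟩ := Finset.one_lt_card.1 h2
    rw [Finset.mem_filter] at he hf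
    exact ⟨(e, f), Finset.mem_offDiag.2 ⟨he.1, hf.1, hne⟩,
      h.eq_mirror_inf hp he.1 hf.1 hne he.2 hf.2⟩

theorem finrank_fixedLine {x : M} (hx1 : x ≠ 1)
    (hx : starRingEnd ℂ (ρ x).trace = (ρ x).trace) : finrank ℂ (fixedLine ρ x) = 1 := by
  have hlt : finrank ℂ (fixedLine ρ x) < 2 := by
    by_contra! h2
    have h1 := eq_one_of_finrank_fixed Fintype.card_pos (map_pow_card_eq_one ρ x) (h.det _) h2
    exact hx1 (h.inj (h1.trans (map_one ρ).symm))
  have hpos : finrank ℂ (fixedLine ρ x) ≠ 0 := by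
    intro h0
    rw [Submodule.finrank_eq_zero] at h0
    obtain ⟨v, hv, hxv⟩ := exists_fixed_vector (A := ρ x) (by
      rw [det_sub_one_eq _ _ (h.det x) (map_mul_map_inv ρ x), trace_map_inv, hx]; ring)
    have : v ∈ fixedLine ρ x := mem_fixedLine.2 hxv
    rw [h0, Submodule.mem_bot] at this
    exact hv this
  omega

theorem mirrorCount_span {v : Fin 3 → ℂ} (hv : v ≠ 0) {e : M} (hev : ρ e *ᵥ v = -v) :
    mirrorCount ρ (Submodule.span ℂ {v}) = Nat.card (fixer ρ v) := by
  rw [mirrorCount, ← card_filter_mem_subgroup]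
  have he := (mem_involutions.1 (h.mem_involutions_of_mulVec_eq_neg hv hev)).1
  have hee : ∀ x : M, e * (e * x) = x := fun x => by rw [← mul_assoc, ← pow_two, he, one_mul]
  refine Finset.card_bij' (fun x _ => e * x) (fun x _ => e * x) (fun x hx => ?_) (fun x hx => ?_)
    (fun x _ => hee x) (fun x _ => hee x)
  · rw [Finset.mem_filter, Submodule.span_singleton_le_iff_mem, mem_mirror] at hx
    rw [Finset.mem_filter, mem_fixer, map_mul, ← mulVec_mulVec, hx.2, mulVec_neg, hev, neg_neg]
    exact ⟨Finset.mem_univ _, rfl⟩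
  · rw [Finset.mem_filter, mem_fixer] at hx
    have : ρ (e * x) *ᵥ v = -v := by rw [map_mul, ← mulVec_mulVec, hx.2, hev]
    rw [Finset.mem_filter, Submodule.span_singleton_le_iff_mem, mem_mirror]
    exact ⟨h.mem_involutions_of_mulVec_eq_neg hv this, this⟩

/-- A line of the lattice is spanned by a vector whose stabilizer counts the mirrors through it. -/
theorem exists_span_of_mem_mirrorLines {p : Submodule ℂ (Fin 3 → ℂ)} (hp : p ∈ mirrorLines ρ) :
    ∃ v, v ≠ 0 ∧ p = Submodule.span ℂ {v} ∧ mirrorCount ρ p = Nat.card (fixer ρ v) ∧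
      ∃ x ∈ fixer ρ v, x ≠ 1 := by
  obtain ⟨hp1, hp2⟩ := h.mem_mirrorLines.1 hp
  obtain ⟨v, hv, rfl⟩ := exists_eq_span_of_finrank_eq_one hp1
  obtain ⟨e, he, f, hf, hne⟩ := Finset.one_lt_card.1 hp2
  rw [Finset.mem_filter, Submodule.span_singleton_le_iff_mem, mem_mirror] at he hf
  refine ⟨v, hv, rfl, h.mirrorCount_span hv he.2, e * f, ?_, fun h1 => hne ?_⟩
  · rw [mem_fixer, map_mul, ← mulVec_mulVec, hf.2, mulVec_neg, he.2, neg_neg]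
  · rwa [mul_eq_one_iff_eq_inv, inv_eq_of_pow_two (mem_involutions.1 hf.1).1] at h1

theorem mirrorCount_cases {p : Submodule ℂ (Fin 3 → ℂ)} (hp : p ∈ mirrorLines ρ) :
    mirrorCount ρ p = 3 ∨ mirrorCount ρ p = 4 ∨ mirrorCount ρ p = 5 := by
  obtain ⟨v, hv, -, hc, hnt⟩ := h.exists_span_of_mem_mirrorLines hp
  have := h.card_fixer_cases hv hnt
  omega

theorem fixedLine_eq_span {x : M} (hx1 : x ≠ 1)
    (hx : starRingEnd ℂ (ρ x).trace = (ρ x).trace) :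
    ∃ v, v ≠ 0 ∧ fixedLine ρ x = Submodule.span ℂ {v} ∧ x ∈ fixer ρ v := by
  obtain ⟨v, hv, he⟩ := exists_eq_span_of_finrank_eq_one (h.finrank_fixedLine hx1 hx)
  exact ⟨v, hv, he, mem_fixedLine.1 (he ▸ Submodule.mem_span_singleton_self v)⟩

theorem fixedLine_eq_span_iff {x : M} (hx1 : x ≠ 1)
    (hx : starRingEnd ℂ (ρ x).trace = (ρ x).trace) {v : Fin 3 → ℂ} (hv : v ≠ 0) :
    fixedLine ρ x = Submodule.span ℂ {v} ↔ x ∈ fixer ρ v := by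
  refine ⟨fun he => mem_fixedLine.1 (he ▸ Submodule.mem_span_singleton_self v), fun hxv => ?_⟩
  refine (Submodule.eq_of_le_of_finrank_eq ?_ ?_).symm
  · rw [Submodule.span_singleton_le_iff_mem, mem_fixedLine]; exact hxv
  · rw [finrank_span_singleton hv, h.finrank_fixedLine hx1 hx]

/-- The lines on `k` mirrors are counted by the elements of a suitable set fixing them. -/
theorem card_mirrorLines_mul (B : Finset M) (k n : ℕ)
    (hB : ∀ x ∈ B, x ≠ 1 ∧ starRingEnd ℂ (ρ x).trace = (ρ x).trace)
    (hmaps : ∀ x ∈ B, fixedLine ρ x ∈ (mirrorLines ρ).filter (mirrorCount ρ · = k))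
    (hfib : ∀ v, v ≠ 0 → (∃ x ∈ fixer ρ v, x ≠ 1) → Nat.card (fixer ρ v) = k →
      (B.filter (· ∈ fixer ρ v)).card = n) :
    ((mirrorLines ρ).filter (mirrorCount ρ · = k)).card * n = B.card := by
  rw [Finset.card_eq_sum_card_fiberwise hmaps, Finset.sum_congr rfl (g := fun _ => n),
    Finset.sum_const, smul_eq_mul]
  intro p hp
  rw [Finset.mem_filter] at hp
  obtain ⟨v, hv, rfl, hc, hnt⟩ := h.exists_span_of_mem_mirrorLines hp.1
  rw [← hfib v hv hnt (hc ▸ hp.2)]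
  congr 1
  exact Finset.filter_congr fun x hx => h.fixedLine_eq_span_iff (hB x hx).1 (hB x hx).2 hv

omit [Fintype M] h in
/-- An element normalizing the span of a vector and of order dividing four either fixes it or has a
power negating it. -/
theorem exists_mulVec_eq_neg {v : Fin 3 → ℂ} (hv : v ≠ 0) {q : M} (hq4 : q ^ 4 = 1)
    (hq : ρ q *ᵥ v ∈ Submodule.span ℂ {v}) (hqv : q ∉ fixer ρ v) : ∃ e, ρ e *ᵥ v = -v := by
  obtain ⟨c, hc⟩ := Submodule.mem_span_singleton.1 hq
  have h2 : ρ (q ^ 2) *ᵥ v = c ^ 2 • v := by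
    rw [pow_two, map_mul, ← mulVec_mulVec, ← hc, mulVec_smul, ← hc, smul_smul, pow_two]
  have h4 : c ^ 4 • v = v := by
    have : ρ (q ^ 4) *ᵥ v = c ^ 4 • v := by
      rw [show q ^ 4 = q ^ 2 * q ^ 2 by group, map_mul, ← mulVec_mulVec, h2, mulVec_smul, h2,
        smul_smul]
      ring_nf
    rw [← this, hq4, map_one, one_mulVec]
  have h41 : c ^ 4 = 1 := smul_left_injective ℂ hv (by simpa using h4)
  have hf : (c - 1) * ((c + 1) * (c ^ 2 + 1)) = 0 := by linear_combination h41
  rcases mul_eq_zero.1 hf with h0 | h0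
  · refine absurd (mem_fixer.2 ?_) hqv
    rw [← hc, show c = 1 by linear_combination h0, one_smul]
  rcases mul_eq_zero.1 h0 with h0 | h0
  · exact ⟨q, by rw [← hc, show c = -1 by linear_combination h0, neg_one_smul]⟩
  · exact ⟨q ^ 2, by rw [h2, show c ^ 2 = -1 by linear_combination h0, neg_one_smul]⟩

theorem card_mirrorLines_four : ((mirrorLines ρ).filter (mirrorCount ρ · = 4)).card = 45 := by
  have hB : ∀ x ∈ involutions M, x ≠ 1 ∧ starRingEnd ℂ (ρ x).trace = (ρ x).trace := fun x hx =>
    ⟨(mem_involutions.1 hx).2, by rw [h.trace_of_mem_involutions hx]; simp⟩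
  have := h.card_mirrorLines_mul (involutions M) 4 1 hB ?_ ?_
  · rw [mul_one, h.card_involutions] at this
    exact this
  · intro c hc
    obtain ⟨v, hv, he, hcv⟩ := h.fixedLine_eq_span (hB c hc).1 (hB c hc).2
    have hpos : 0 < ((involutions M).filter (· ∈ fixer ρ v)).card :=
      Finset.card_pos.2 ⟨c, Finset.mem_filter.2 ⟨hc, hcv⟩⟩
    have hcases := h.card_fixer_cases hv ⟨c, hcv, (hB c hc).1⟩
    have h4 : Nat.card (fixer ρ v) = 4 := by omega
    obtain ⟨Q, hQ, -, hQc⟩ := h.exists_subgroup_card_eight hc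
    obtain ⟨q, hqQ, hqv⟩ : ∃ q ∈ Q, q ∉ fixer ρ v := by
      by_contra! hle
      have := Nat.le_of_dvd (by omega) (Subgroup.card_dvd_of_le (show Q ≤ fixer ρ v from hle))
      omega
    have hq8 : q ^ 8 = 1 := by
      have : (⟨q, hqQ⟩ : Q) ^ Nat.card Q = 1 := pow_card_eq_one'
      rw [hQ] at this
      exact congrArg Subtype.val this
    obtain ⟨e, hev⟩ := exists_mulVec_eq_neg (ρ := ρ) hv (h.pow_four_of_pow_eight hq8) (by
      rw [← he, mem_fixedLine, mem_fixer, mulVec_mulVec, ← map_mul,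
        ← Subgroup.mem_centralizer_singleton_iff.1 (hQc hqQ), map_mul, ← mulVec_mulVec, hcv]) hqv
    have hcount := h.mirrorCount_span hv hev
    rw [Finset.mem_filter, h.mem_mirrorLines, he]
    refine ⟨⟨finrank_span_singleton hv, ?_⟩, ?_⟩ <;> omega
  · intro v hv hnt h4
    have := h.card_fixer_cases hv hnt
    omega

theorem card_mirrorLines_five : ((mirrorLines ρ).filter (mirrorCount ρ · = 5)).card = 36 := by
  set O := Finset.univ.filter fun x : M => x ^ 5 = 1 ∧ x ≠ 1 with hO
  have hmemO : ∀ x, x ∈ O ↔ x ^ 5 = 1 ∧ x ≠ 1 := fun x => by simp [hO]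
  have hB : ∀ x ∈ O, x ≠ 1 ∧ starRingEnd ℂ (ρ x).trace = (ρ x).trace := fun x hx =>
    ⟨((hmemO x).1 hx).2, h.trace_conj_of_pow_five ((hmemO x).1 hx).1⟩
  have := h.card_mirrorLines_mul O 5 4 hB ?_ ?_
  · rw [hO, h.card_pow_five] at this
    omega
  · intro x hx
    obtain ⟨v, hv, he, hxv⟩ := h.fixedLine_eq_span (hB x hx).1 (hB x hx).2
    have hpos : 0 < (O.filter (· ∈ fixer ρ v)).card :=
      Finset.card_pos.2 ⟨x, Finset.mem_filter.2 ⟨hx, hxv⟩⟩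
    have hcases := h.card_fixer_cases hv ⟨x, hxv, (hB x hx).1⟩
    rw [← hO] at hcases
    have hI : ((involutions M).filter (· ∈ fixer ρ v)).card = 0 := by omega
    have h5 : Nat.card (fixer ρ v) = 5 := by omega
    have hinv := h.card_inverting ((hmemO x).1 hx).1 ((hmemO x).1 hx).2
    obtain ⟨q, hq⟩ := Finset.card_pos.1 (by rw [hinv]; norm_num :
      0 < ((involutions M).filter fun e => e * x * e⁻¹ = x⁻¹).card)
    rw [Finset.mem_filter] at hq
    have hqx : x⁻¹ * q = q * x := by rw [← hq.2]; group
    obtain ⟨e, hev⟩ := exists_mulVec_eq_neg (ρ := ρ) hv (q := q)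
      (by rw [show 4 = 2 * 2 from rfl, pow_mul, (mem_involutions.1 hq.1).1, one_pow]) (by
        rw [← he, mem_fixedLine, ← inv_mem_iff, mem_fixer, mulVec_mulVec, ← map_mul, hqx, map_mul,
          ← mulVec_mulVec, hxv]) (fun hqv => by
        have : 0 < ((involutions M).filter (· ∈ fixer ρ v)).card :=
          Finset.card_pos.2 ⟨q, Finset.mem_filter.2 ⟨hq.1, hqv⟩⟩
        omega)
    have hcount := h.mirrorCount_span hv hev
    rw [Finset.mem_filter, h.mem_mirrorLines, he]
    refine ⟨⟨finrank_span_singleton hv, ?_⟩, ?_⟩ <;> omega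
  · intro v hv hnt h5
    have := h.card_fixer_cases hv hnt
    rw [← hO] at this
    omega

omit h in
theorem sum_mirrorLines (hcases : ∀ p ∈ mirrorLines ρ,
      mirrorCount ρ p = 3 ∨ mirrorCount ρ p = 4 ∨ mirrorCount ρ p = 5) (f : ℕ → ℕ) :
    ∑ p ∈ mirrorLines ρ, f (mirrorCount ρ p) =
      ((mirrorLines ρ).filter (mirrorCount ρ · = 3)).card * f 3 +
      ((mirrorLines ρ).filter (mirrorCount ρ · = 4)).card * f 4 +
      ((mirrorLines ρ).filter (mirrorCount ρ · = 5)).card * f 5 := by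
  simp only [Finset.card_filter, Finset.sum_mul, ← Finset.sum_add_distrib]
  refine Finset.sum_congr rfl fun p hp => ?_
  rcases hcases p hp with h1 | h1 | h1 <;> simp [h1]

theorem card_mirrorLines_three : ((mirrorLines ρ).filter (mirrorCount ρ · = 3)).card = 120 := by
  have h1 : (involutions M).offDiag.card =
      ∑ p ∈ mirrorLines ρ, (mirrorCount ρ p * mirrorCount ρ p - mirrorCount ρ p) := by
    have hmaps : ∀ q ∈ (involutions M).offDiag, mirror ρ q.1 ⊓ mirror ρ q.2 ∈ mirrorLines ρ :=
      fun q hq => Finset.mem_image_of_mem (fun q : M × M => mirror ρ q.1 ⊓ mirror ρ q.2) hq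
    rw [Finset.card_eq_sum_card_fiberwise hmaps]
    refine Finset.sum_congr rfl fun p hp => ?_
    rw [mirrorCount, ← Finset.offDiag_card]
    congr 1
    ext ⟨e, f⟩
    simp only [Finset.mem_filter, Finset.mem_offDiag]
    constructor
    · rintro ⟨⟨he, hf, hne⟩, rfl⟩
      exact ⟨⟨he, inf_le_left⟩, ⟨hf, inf_le_right⟩, hne⟩
    · rintro ⟨⟨he, hpe⟩, ⟨hf, hpf⟩, hne⟩
      exact ⟨⟨he, hf, hne⟩, h.eq_mirror_inf (h.mem_mirrorLines.1 hp).1 he hf hne hpe hpf⟩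
  rw [Finset.offDiag_card, h.card_involutions,
    sum_mirrorLines (fun p hp => h.mirrorCount_cases hp) (fun m => m * m - m),
    h.card_mirrorLines_four, h.card_mirrorLines_five] at h1
  norm_num only at h1
  omega

omit [Fintype M] h in
theorem comap_mirror (w e : M) :
    (mirror ρ e).comap (toLin' (ρ w⁻¹)) = mirror ρ (w * e * w⁻¹) := by
  ext v
  rw [Submodule.mem_comap, mem_mirror, mem_mirror, toLin'_apply, map_mul, map_mul]
  constructor
  · intro hv
    rw [← mulVec_mulVec, ← mulVec_mulVec, hv, mulVec_neg, mulVec_mulVec, map_mul_map_inv,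
      one_mulVec]
  · intro hv
    have := congrArg (ρ w⁻¹ *ᵥ ·) hv
    simpa only [mulVec_mulVec, ← mul_assoc, map_inv_mul_map, one_mul, mulVec_neg] using this

theorem card_mirrorLines_le {e : M} (he : e ∈ involutions M) :
    ((mirrorLines ρ).filter (· ≤ mirror ρ e)).card = 16 := by
  have hdouble := Finset.sum_card_bipartiteAbove_eq_sum_card_bipartiteBelow
    (s := involutions M) (t := mirrorLines ρ) fun e p => p ≤ mirror ρ e
  have hright : ∑ p ∈ mirrorLines ρ,
      ((involutions M).bipartiteBelow (fun e p => p ≤ mirror ρ e) p).card = 720 := by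
    refine (sum_mirrorLines (fun p hp => h.mirrorCount_cases hp) fun m => m).trans ?_
    rw [h.card_mirrorLines_three, h.card_mirrorLines_four, h.card_mirrorLines_five]
  have hmem : ∀ (w : M) (f : M), ∀ p ∈ (mirrorLines ρ).filter (· ≤ mirror ρ f),
      p.comap (toLin' (ρ w⁻¹)) ∈ (mirrorLines ρ).filter (· ≤ mirror ρ (w * f * w⁻¹)) := by
    intro w f p hp
    rw [Finset.mem_filter, mirrorLines, Finset.mem_image] at hp ⊢
    obtain ⟨⟨⟨a, b⟩, hab, rfl⟩, hle⟩ := hp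
    obtain ⟨ha, hb, hne⟩ := Finset.mem_offDiag.1 hab
    refine ⟨⟨(w * a * w⁻¹, w * b * w⁻¹), Finset.mem_offDiag.2 ⟨conj_mem_involutions w ha,
      conj_mem_involutions w hb, fun h0 => hne (mul_left_cancel (mul_right_cancel h0))⟩, ?_⟩, ?_⟩
    · rw [Submodule.comap_inf, comap_mirror, comap_mirror]
    · rw [← comap_mirror]
      exact Submodule.comap_mono hle
  have hinv : ∀ (w : M) (p : Submodule ℂ (Fin 3 → ℂ)),
      (p.comap (toLin' (ρ w))).comap (toLin' (ρ w⁻¹)) = p := by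
    intro w p
    rw [← Submodule.comap_comp, ← toLin'_mul, map_mul_map_inv, toLin'_one, Submodule.comap_id]
  have hconst : ∀ f ∈ involutions M,
      ((mirrorLines ρ).bipartiteAbove (fun e p => p ≤ mirror ρ e) f).card =
        ((mirrorLines ρ).filter (· ≤ mirror ρ e)).card := by
    intro f hf
    obtain ⟨w, rfl⟩ := h.isConj_of_mem_involutions he hf
    refine Finset.card_bij' (fun p _ => p.comap (toLin' (ρ w)))
      (fun p _ => p.comap (toLin' (ρ w⁻¹))) (fun p hp => ?_) (fun p hp => hmem w e p hp)
      (fun p _ => hinv w p) (fun p _ => by simpa using hinv w⁻¹ p)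
    have := hmem w⁻¹ _ p hp
    rwa [inv_inv, show w⁻¹ * (w * e * w⁻¹) * w = e by group] at this
  rw [hright, Finset.sum_congr rfl hconst, Finset.sum_const, smul_eq_mul, h.card_involutions]
    at hdouble
  omega

end IsValentinerRep

namespace IsValentinerRep

variable {M : Type*} [Group M] [Fintype M]
variable {ρ : M →* Matrix (Fin 3) (Fin 3) ℂ} (h : IsValentinerRep ρ)
include h

theorem ncard_mirrors_ge (p : Submodule ℂ (Fin 3 → ℂ)) :
    {H ∈ mirror ρ '' (involutions M : Set M) | p ≤ H}.ncard = mirrorCount ρ p := by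
  have hset : {H ∈ mirror ρ '' (involutions M : Set M) | p ≤ H} =
      mirror ρ '' (((involutions M).filter fun e => p ≤ mirror ρ e : Finset M) : Set M) := by
    ext H
    constructor
    · rintro ⟨⟨e, he, rfl⟩, hp⟩
      exact ⟨e, Finset.mem_coe.2 (Finset.mem_filter.2 ⟨he, hp⟩), rfl⟩
    · rintro ⟨e, he, rfl⟩
      obtain ⟨he, hp⟩ := Finset.mem_filter.1 (Finset.mem_coe.1 he)
      exact ⟨⟨e, he, rfl⟩, hp⟩
  rw [hset, (h.mirror_injOn.mono (Finset.coe_subset.2 (Finset.filter_subset _ _))).ncard_image,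
    Set.ncard_coe_finset, mirrorCount]

theorem mem_mirrorLines_iff_mem_setLattice {p : Submodule ℂ (Fin 3 → ℂ)} :
    p ∈ mirrorLines ρ ↔
      p ∈ setLattice (mirror ρ '' (involutions M : Set M)) ∧ finrank ℂ p = 1 := by
  constructor
  · intro hp
    refine ⟨?_, (h.mem_mirrorLines.1 hp).1⟩
    rw [mirrorLines, Finset.mem_image] at hp
    obtain ⟨⟨e, f⟩, hef, rfl⟩ := hp
    obtain ⟨he, hf, -⟩ := Finset.mem_offDiag.1 hef
    refine ⟨{mirror ρ e, mirror ρ f}, ?_, by simp⟩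
    intro H hH
    rcases Finset.mem_insert.1 (Finset.mem_coe.1 hH) with rfl | hH
    · exact ⟨e, he, rfl⟩
    · exact ⟨f, hf, (Finset.mem_singleton.1 hH).symm⟩
  · rintro ⟨⟨s, hs, rfl⟩, hp⟩
    have hle : ∀ H ∈ s, s.inf id ≤ H := fun H hH => Finset.inf_le (f := id) hH
    have hcard : 1 < s.card := by
      by_contra! hc
      rcases Nat.le_one_iff_eq_zero_or_eq_one.1 hc with h0 | h1
      · rw [Finset.card_eq_zero] at h0
        rw [h0, Finset.inf_empty, finrank_top, finrank_fin_fun] at hp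
        omega
      · obtain ⟨H, rfl⟩ := Finset.card_eq_one.1 h1
        obtain ⟨e, he, rfl⟩ := hs (by simp : H ∈ _)
        rw [Finset.inf_singleton, id, h.finrank_mirror he] at hp
        omega
    obtain ⟨A, hA, B, hB, hne⟩ := Finset.one_lt_card.1 hcard
    have hpA := hle A hA
    have hpB := hle B hB
    obtain ⟨a, ha, rfl⟩ := hs hA
    obtain ⟨b, hb, rfl⟩ := hs hB
    exact h.mem_mirrorLines.2 ⟨hp, Finset.one_lt_card.2 ⟨a, Finset.mem_filter.2 ⟨ha, hpA⟩, b,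
      Finset.mem_filter.2 ⟨hb, hpB⟩, fun hab => hne (congrArg _ hab)⟩⟩

theorem restriction_mirrors {e : M} (he : e ∈ involutions M) :
    (fun H => mirror ρ e ⊓ H) '' (mirror ρ '' (involutions M : Set M) \ {mirror ρ e}) =
      (((mirrorLines ρ).filter (· ≤ mirror ρ e) : Finset _) : Set (Submodule ℂ (Fin 3 → ℂ))) := by
  ext p
  rw [Finset.mem_coe, Finset.mem_filter, mirrorLines, Finset.mem_image]
  constructor
  · rintro ⟨-, ⟨⟨f, hf, rfl⟩, hne⟩, rfl⟩
    refine ⟨⟨(e, f), Finset.mem_offDiag.2 ⟨he, hf, fun hef => hne ?_⟩, rfl⟩, inf_le_left⟩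
    exact congrArg (mirror ρ) (Eq.symm hef)
  · rintro ⟨⟨⟨a, b⟩, hab, rfl⟩, hle⟩
    obtain ⟨ha, hb, hne⟩ := Finset.mem_offDiag.1 hab
    obtain ⟨f, hf, hfe, hpf⟩ : ∃ f ∈ involutions M, f ≠ e ∧
        mirror ρ a ⊓ mirror ρ b ≤ mirror ρ f := by
      by_cases hae : a = e
      · exact ⟨b, hb, fun hbe => hne (hae.trans hbe.symm), inf_le_right⟩
      · exact ⟨a, ha, hae, inf_le_left⟩
    exact ⟨mirror ρ f, ⟨⟨f, hf, rfl⟩, fun h0 => hfe (h.mirror_injOn hf he h0)⟩,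
      h.eq_mirror_inf (h.finrank_mirror_inf ha hb hne) he hf hfe.symm hle hpf⟩

theorem ncard_points (k : ℕ) :
    {p ∈ setLattice (mirror ρ '' (involutions M : Set M)) | finrank ℂ p = 1 ∧
      {H ∈ mirror ρ '' (involutions M : Set M) | p ≤ H}.ncard = k}.ncard =
        ((mirrorLines ρ).filter (mirrorCount ρ · = k)).card := by
  rw [← Set.ncard_coe_finset]
  congr 1
  ext p
  rw [Finset.mem_coe, Finset.mem_filter, h.mem_mirrorLines_iff_mem_setLattice, and_assoc,
    ← h.ncard_mirrors_ge]
  rfl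

end IsValentinerRep

section ReflectionGroup

variable (W : Subgroup (GL (Fin 3) ℂ))

/-- The tautological representation of a matrix group. -/
def matrixRep : W →* Matrix (Fin 3) (Fin 3) ℂ := (Units.coeHom _).comp W.subtype

variable {W}

theorem isReflectionIn_matrixRep {g : W} :
    IsReflectionIn (matrixRep W) g ↔ IsReflection (g : GL (Fin 3) ℂ) :=
  and_congr (not_congr (Subtype.ext_iff.trans Iff.rfl)) Iff.rfl

theorem isReflectionRep_matrixRep [Fintype W] (hcard : Nat.card W = 2160)
    (hrefl : W = Subgroup.closure {g : GL (Fin 3) ℂ | g ∈ W ∧ IsReflection g})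
    (hirr : ∀ U : Submodule ℂ (Fin 3 → ℂ),
      (∀ g ∈ W, U.map (toLin' (g : Matrix (Fin 3) (Fin 3) ℂ)) ≤ U) → U = ⊥ ∨ U = ⊤) :
    IsReflectionRep (matrixRep W) where
  card := hcard
  inj g g' hgg := Subtype.ext (Units.ext hgg)
  irr U hU := hirr U fun g hg => Submodule.map_le_iff_le_comap.2 fun v hv => by
    rw [Submodule.mem_comap, toLin'_apply]
    exact hU ⟨g, hg⟩ v hv
  gen K hK := by
    have hle : W ≤ K.map W.subtype := by
      conv_lhs => rw [hrefl]
      rw [Subgroup.closure_le]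
      rintro g ⟨hg, hgr⟩
      exact ⟨⟨g, hg⟩, hK _ (isReflectionIn_matrixRep.2 hgr), rfl⟩
    rw [eq_top_iff]
    rintro g -
    obtain ⟨k, hk, hkg⟩ := hle g.2
    rwa [← Subtype.ext hkg]

theorem fixedSp_eq_mirror [Fintype W] {r : W} {s : (IsReflectionRep.detHom (matrixRep W)).ker}
    (hrs : matrixRep W r = -matrixRep W s) :
    fixedSp (r : GL (Fin 3) ℂ) =
      mirror ((matrixRep W).comp (IsReflectionRep.detHom (matrixRep W)).ker.subtype) s := by
  ext v
  rw [mem_mirror, fixedSp, LinearMap.mem_ker, toLin'_apply, sub_mulVec, one_mulVec, sub_eq_zero]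
  change matrixRep W r *ᵥ v = v ↔ matrixRep W s *ᵥ v = -v
  rw [hrs, neg_mulVec, neg_eq_iff_eq_neg]

theorem reflecting_hyperplanes_eq [Fintype W] (h : IsReflectionRep (matrixRep W)) :
    {X | ∃ g ∈ W, IsReflection g ∧ X = fixedSp g} =
      mirror ((matrixRep W).comp (IsReflectionRep.detHom (matrixRep W)).ker.subtype) ''
        (involutions (IsReflectionRep.detHom (matrixRep W)).ker :
          Set (IsReflectionRep.detHom (matrixRep W)).ker) := by
  ext X
  constructor
  · rintro ⟨g, hg, hgr, rfl⟩
    obtain ⟨s, hs, hs1, hrs⟩ :=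
      h.sq_eq_one_of_reflection (isReflectionIn_matrixRep (g := ⟨g, hg⟩).2 hgr)
    exact ⟨s, Finset.mem_coe.2 (mem_involutions.2 ⟨hs, hs1⟩), (fixedSp_eq_mirror hrs).symm⟩
  · rintro ⟨s, hs, rfl⟩
    obtain ⟨hs, hs1⟩ := mem_involutions.1 (Finset.mem_coe.1 hs)
    obtain ⟨r, hr⟩ := h.exists_map_eq_neg (s : W)
    exact ⟨r, r.2, isReflectionIn_matrixRep.1 (h.isReflectionIn_of_sq hs hs1 hr),
      (fixedSp_eq_mirror hr).symm⟩

end ReflectionGroup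

/-- For the reflection arrangement `𝓐` of the complex reflection group `G₂₇` (the
irreducible rank-3 complex reflection group of order 2160, with 45 hyperplanes), every
restriction `𝓐^H` has exactly 16 elements, and the point multiplicities form the
multiset `{{3^120, 4^45, 5^36}}`. -/
theorem G27_lattice_invariants
    (W : Subgroup (GL (Fin 3) ℂ)) (hfin : Finite W)
    (hcard : Nat.card W = 2160)
    (hrefl : W = Subgroup.closure {g : GL (Fin 3) ℂ | g ∈ W ∧ IsReflection g})
    (hirr : ∀ U : Submodule ℂ (Fin 3 → ℂ),
      (∀ g ∈ W, U.map (Matrix.toLin' (g : Matrix (Fin 3) (Fin 3) ℂ)) ≤ U) →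
        U = ⊥ ∨ U = ⊤)
    (𝓐 : Set (Submodule ℂ (Fin 3 → ℂ)))
    (h𝓐 : 𝓐 = {X | ∃ g ∈ W, IsReflection g ∧ X = fixedSp g})
    :
    𝓐.ncard = 45 ∧
      (∀ H ∈ 𝓐, ((fun H' => H ⊓ H') '' (𝓐 \ {H})).ncard = 16) ∧
      (∀ p ∈ setLattice 𝓐, Module.finrank ℂ p = 1 →
        {H ∈ 𝓐 | p ≤ H}.ncard ∈ ({3, 4, 5} : Set ℕ)) ∧
      {p ∈ setLattice 𝓐 | Module.finrank ℂ p = 1 ∧ {H ∈ 𝓐 | p ≤ H}.ncard = 3}.ncard = 120 ∧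
      {p ∈ setLattice 𝓐 | Module.finrank ℂ p = 1 ∧ {H ∈ 𝓐 | p ≤ H}.ncard = 4}.ncard = 45 ∧
      {p ∈ setLattice 𝓐 | Module.finrank ℂ p = 1 ∧ {H ∈ 𝓐 | p ≤ H}.ncard = 5}.ncard = 36 := by
  have : Fintype W := Fintype.ofFinite W
  have hW := isReflectionRep_matrixRep hcard hrefl hirr
  have h := hW.isValentinerRep
  rw [reflecting_hyperplanes_eq hW] at h𝓐
  subst h𝓐
  rw [h.ncard_points, h.ncard_points, h.ncard_points]
  refine ⟨?_, ?_, ?_, h.card_mirrorLines_three, h.card_mirrorLines_four, h.card_mirrorLines_five⟩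
  · rw [h.mirror_injOn.ncard_image, Set.ncard_coe_finset, h.card_involutions]
  · rintro _ ⟨e, he, rfl⟩
    rw [h.restriction_mirrors he, Set.ncard_coe_finset, h.card_mirrorLines_le he]
  · intro p hp hp1
    rw [h.ncard_mirrors_ge]
    exact h.mirrorCount_cases (h.mem_mirrorLines_iff_mem_setLattice.2 ⟨hp, hp1⟩)
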